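/- arXiv:1003.3578 — 3 statements merged into one kernel-verified Lean document; each statement's English description precedes it below -/
import Mathlib

section
/- Let N ≥ 1, let B be the open unit ball of ℝ^N, and let f ∈ C¹(ℝ) satisfy conditions (2) and (3). Assume in addition that there exist a nondecreasing function f̃ : ℝ → ℝ and a constant K such that f(t) = f̃(t) − K t for all t ∈ ℝ. Then every boundary blow-up solution u of Δu = f(u) in B is radially symmetric (u(x) depends only on |x|), and its radial derivative satisfies ∂u/∂r(x) > 0 for every x ∈ B \ {0}. -/
open MeasureTheory Filter Metric Set Topology

/-- The Euclidean Laplacian: sum of pure second partial derivatives. -/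
noncomputable def lap {N : ℕ} (u : EuclideanSpace ℝ (Fin N) → ℝ)
    (x : EuclideanSpace ℝ (Fin N)) : ℝ :=
  ∑ i, fderiv ℝ (fun y => fderiv ℝ u y (EuclideanSpace.single i 1)) x (EuclideanSpace.single i 1)

/-- A boundary blow-up solution of `Δu = f(u)` on the open unit ball. -/
def IsBlowUp {N : ℕ} (f : ℝ → ℝ) (u : EuclideanSpace ℝ (Fin N) → ℝ) : Prop :=
  ContDiffOn ℝ 2 u (ball 0 1) ∧
  (∀ x ∈ ball (0 : EuclideanSpace ℝ (Fin N)) 1, lap u x = f (u x)) ∧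
  ∀ x₀ : EuclideanSpace ℝ (Fin N), ‖x₀‖ = 1 →
    Tendsto u (𝓝[ball (0 : EuclideanSpace ℝ (Fin N)) 1] x₀) atTop


namespace BU

/-- `h` has derivative `h'` near `t₀` and `h'` has derivative `c` at `t₀`. -/
def D2At (h h' : ℝ → ℝ) (c t₀ : ℝ) : Prop :=
  (∀ᶠ t in 𝓝 t₀, HasDerivAt h (h' t) t) ∧ HasDerivAt h' c t₀

lemma D2At.add {h h' k k' : ℝ → ℝ} {c d t : ℝ} (H : D2At h h' c t) (K : D2At k k' d t) :
    D2At (fun s => h s + k s) (fun s => h' s + k' s) (c + d) t :=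
  ⟨by filter_upwards [H.1, K.1] with s a b using a.add b, H.2.add K.2⟩

lemma D2At.sub {h h' k k' : ℝ → ℝ} {c d t : ℝ} (H : D2At h h' c t) (K : D2At k k' d t) :
    D2At (fun s => h s - k s) (fun s => h' s - k' s) (c - d) t :=
  ⟨by filter_upwards [H.1, K.1] with s a b using a.sub b, H.2.sub K.2⟩

lemma D2At.const_mul {h h' : ℝ → ℝ} {c t : ℝ} (L : ℝ) (H : D2At h h' c t) :
    D2At (fun s => L * h s) (fun s => L * h' s) (L * c) t :=
  ⟨by filter_upwards [H.1] with s a using a.const_mul L, H.2.const_mul L⟩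

lemma D2At.const (L t : ℝ) : D2At (fun _ => L) (fun _ => 0) 0 t :=
  ⟨Eventually.of_forall fun s => hasDerivAt_const s L, hasDerivAt_const t 0⟩

/-- second derivative test -/
lemma D2At.max {h h' : ℝ → ℝ} {c t : ℝ} (H : D2At h h' c t) (hm : IsLocalMax h t) :
    h' t = 0 ∧ c ≤ 0 := by
  have h1 : HasDerivAt h (h' t) t := H.1.self_of_nhds
  have h0 : h' t = 0 := hm.hasDerivAt_eq_zero h1
  refine ⟨h0, ?_⟩
  by_contra hc
  push Not at hc
  have e1 : deriv h =ᶠ[𝓝 t] h' := by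
    filter_upwards [H.1] with s hs using hs.deriv
  have e2 : deriv (deriv h) t = c := by rw [e1.deriv_eq]; exact H.2.deriv
  have hmin : IsLocalMin h t :=
    isLocalMin_of_deriv_deriv_pos (by rw [e2]; exact hc) (by rw [h1.deriv, h0]) h1.continuousAt
  have e3 : h =ᶠ[𝓝 t] fun _ => h t := by
    filter_upwards [hm, hmin] with s a b using le_antisymm a b
  have e4 : deriv h =ᶠ[𝓝 t] fun _ => 0 := by
    filter_upwards [e3.eventuallyEq_nhds] with s hs
    rw [hs.deriv_eq]; simp
  rw [e4.deriv_eq] at e2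
  simp at e2
  linarith

variable {N : ℕ}

/-- second derivative quadratic form -/
noncomputable def Q (u : EuclideanSpace ℝ (Fin N) → ℝ) (x v : EuclideanSpace ℝ (Fin N)) : ℝ :=
  fderiv ℝ (fderiv ℝ u) x v v

lemma diff_fderiv {u : EuclideanSpace ℝ (Fin N) → ℝ} {x : EuclideanSpace ℝ (Fin N)}
    (hu : ContDiffAt ℝ 2 u x) : DifferentiableAt ℝ (fderiv ℝ u) x := by
  have : ContDiffAt ℝ 1 (fderiv ℝ u) x := hu.fderiv_right (by norm_num)
  exact this.differentiableAt (by norm_num)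

lemma slice {u : EuclideanSpace ℝ (Fin N) → ℝ} {γ γ' : ℝ → EuclideanSpace ℝ (Fin N)} {t₀ : ℝ}
    {a : EuclideanSpace ℝ (Fin N)}
    (hu : ContDiffAt ℝ 2 u (γ t₀)) (hγ : ∀ᶠ t in 𝓝 t₀, HasDerivAt γ (γ' t) t)
    (hγ' : HasDerivAt γ' a t₀) :
    D2At (fun t => u (γ t)) (fun t => fderiv ℝ u (γ t) (γ' t))
      (Q u (γ t₀) (γ' t₀) + fderiv ℝ u (γ t₀) a) t₀ := by
  have hc : ContinuousAt γ t₀ := hγ.self_of_nhds.continuousAt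
  constructor
  · have : ∀ᶠ y in 𝓝 (γ t₀), DifferentiableAt ℝ u y := by
      filter_upwards [hu.eventually (by simp)] with y hy using hy.differentiableAt (by norm_num)
    filter_upwards [hγ, hc.eventually this] with t h1 h2
    exact h2.hasFDerivAt.comp_hasDerivAt t h1
  · have h1 : HasDerivAt (fun t => fderiv ℝ u (γ t)) (fderiv ℝ (fderiv ℝ u) (γ t₀) (γ' t₀)) t₀ :=
      (diff_fderiv hu).hasFDerivAt.comp_hasDerivAt t₀ hγ.self_of_nhds
    exact h1.clm_apply hγ'

lemma lap_onb {u : EuclideanSpace ℝ (Fin N) → ℝ} {x : EuclideanSpace ℝ (Fin N)}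
    (hu : ContDiffAt ℝ 2 u x) {ι : Type*} [Fintype ι]
    (b : OrthonormalBasis ι ℝ (EuclideanSpace ℝ (Fin N))) : lap u x = ∑ i, Q u x (b i) := by
  have key : ∀ {κ : Type _} [Fintype κ] (c : OrthonormalBasis κ ℝ (EuclideanSpace ℝ (Fin N))),
      Laplacian.laplacian u x = ∑ i, Q u x (c i) := by
    intro κ _ c
    rw [InnerProductSpace.laplacian_eq_iteratedFDeriv_orthonormalBasis u c]
    refine Finset.sum_congr rfl fun i _ => ?_
    simp [iteratedFDeriv_two_apply, Q]
  have k2 := InnerProductSpace.laplacian_eq_iteratedFDeriv_orthonormalBasis u b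
  have k1 : Laplacian.laplacian u x = ∑ i, Q u x (b i) := by
    rw [k2]
    refine Finset.sum_congr rfl fun i _ => ?_
    simp [iteratedFDeriv_two_apply, Q]
  rw [← k1, key (EuclideanSpace.basisFun (Fin N) ℝ), lap]
  refine Finset.sum_congr rfl fun i _ => ?_
  have := (diff_fderiv hu).hasFDerivAt.clm_apply
    (hasFDerivAt_const (EuclideanSpace.single i (1 : ℝ) : EuclideanSpace ℝ (Fin N)) x)
  rw [this.fderiv]
  simp [Q]

/-- `w` has slices with second derivatives summing to `ℓ` at `x`. -/
def HasLap (w : EuclideanSpace ℝ (Fin N) → ℝ) (x : EuclideanSpace ℝ (Fin N)) (ℓ : ℝ) : Prop :=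
  ∃ (d : Fin N → ℝ → ℝ) (c : Fin N → ℝ),
    (∀ i, D2At (fun t => w (x + t • EuclideanSpace.basisFun (Fin N) ℝ i)) (d i) (c i) 0) ∧
      ∑ i, c i = ℓ

lemma HasLap.add {w v : EuclideanSpace ℝ (Fin N) → ℝ} {x : EuclideanSpace ℝ (Fin N)} {ℓ m : ℝ}
    (H : HasLap w x ℓ) (K : HasLap v x m) : HasLap (fun y => w y + v y) x (ℓ + m) := by
  obtain ⟨d, c, h1, rfl⟩ := H
  obtain ⟨d', c', h1', rfl⟩ := K
  exact ⟨fun i s => d i s + d' i s, fun i => c i + c' i, fun i => (h1 i).add (h1' i),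
    Finset.sum_add_distrib⟩

lemma HasLap.sub {w v : EuclideanSpace ℝ (Fin N) → ℝ} {x : EuclideanSpace ℝ (Fin N)} {ℓ m : ℝ}
    (H : HasLap w x ℓ) (K : HasLap v x m) : HasLap (fun y => w y - v y) x (ℓ - m) := by
  obtain ⟨d, c, h1, rfl⟩ := H
  obtain ⟨d', c', h1', rfl⟩ := K
  exact ⟨fun i s => d i s - d' i s, fun i => c i - c' i, fun i => (h1 i).sub (h1' i),
    Finset.sum_sub_distrib _ _⟩

lemma HasLap.const_mul {w : EuclideanSpace ℝ (Fin N) → ℝ} {x : EuclideanSpace ℝ (Fin N)} {ℓ : ℝ}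
    (L : ℝ) (H : HasLap w x ℓ) : HasLap (fun y => L * w y) x (L * ℓ) := by
  obtain ⟨d, c, h1, rfl⟩ := H
  exact ⟨fun i s => L * d i s, fun i => L * c i, fun i => (h1 i).const_mul L,
    (Finset.mul_sum _ _ _).symm⟩

lemma HasLap.const (L : ℝ) (x : EuclideanSpace ℝ (Fin N)) : HasLap (fun _ => L) x 0 :=
  ⟨fun _ _ => 0, fun _ => 0, fun _ => D2At.const L 0, by simp⟩

lemma HasLap.max {w : EuclideanSpace ℝ (Fin N) → ℝ} {x : EuclideanSpace ℝ (Fin N)} {ℓ : ℝ}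
    (H : HasLap w x ℓ) (hm : IsLocalMax w x) : ℓ ≤ 0 := by
  obtain ⟨d, c, h1, rfl⟩ := H
  refine Finset.sum_nonpos fun i _ => ((h1 i).max ?_).2
  have hc : ContinuousAt (fun t : ℝ => x + t • EuclideanSpace.basisFun (Fin N) ℝ i) 0 := by
    fun_prop
  have hm' : ∀ᶠ y in 𝓝 (x + (0 : ℝ) • EuclideanSpace.basisFun (Fin N) ℝ i), w y ≤ w x := by
    rw [zero_smul, add_zero]; exact hm
  filter_upwards [hc.eventually hm'] with t ht
  simpa using ht

lemma hasDerivAt_line (x v : EuclideanSpace ℝ (Fin N)) (t : ℝ) :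
    HasDerivAt (fun t : ℝ => x + t • v) v t := by
  simpa using ((hasDerivAt_id t).smul_const v).const_add x

lemma hasLap_comp {u : EuclideanSpace ℝ (Fin N) → ℝ} {x c : EuclideanSpace ℝ (Fin N)}
    (R : EuclideanSpace ℝ (Fin N) ≃ₗᵢ[ℝ] EuclideanSpace ℝ (Fin N))
    (hu : ContDiffAt ℝ 2 u (R x + c)) : HasLap (fun y => u (R y + c)) x (lap u (R x + c)) := by
  rw [lap_onb hu ((EuclideanSpace.basisFun (Fin N) ℝ).map R)]
  have : ∀ i, D2At (fun t : ℝ => u ((R x + c) + t • R (EuclideanSpace.basisFun (Fin N) ℝ i)))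
      (fun t : ℝ => fderiv ℝ u ((R x + c) + t • R (EuclideanSpace.basisFun (Fin N) ℝ i))
        (R (EuclideanSpace.basisFun (Fin N) ℝ i)))
      (Q u (R x + c) (R (EuclideanSpace.basisFun (Fin N) ℝ i))) 0 := by
    intro i
    have := slice (u := u)
      (γ := fun t : ℝ => (R x + c) + t • R (EuclideanSpace.basisFun (Fin N) ℝ i))
      (γ' := fun _ => R (EuclideanSpace.basisFun (Fin N) ℝ i)) (t₀ := 0) (a := 0)
      (by simpa using hu) (Eventually.of_forall fun t => hasDerivAt_line _ _ t)
      (hasDerivAt_const _ _)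
    simpa using this
  refine ⟨fun i t => fderiv ℝ u ((R x + c) + t • R (EuclideanSpace.basisFun (Fin N) ℝ i))
        (R (EuclideanSpace.basisFun (Fin N) ℝ i)), _, fun i => ?_, rfl⟩
  · have h := this i
    simp only [OrthonormalBasis.map_apply]
    convert h using 3
    simp only [map_add, map_smul]
    abel

lemma hasLap_lap {u : EuclideanSpace ℝ (Fin N) → ℝ} {x : EuclideanSpace ℝ (Fin N)}
    (hu : ContDiffAt ℝ 2 u x) : HasLap u x (lap u x) := by
  have := hasLap_comp (u := u) (x := x) (c := 0) (LinearIsometryEquiv.refl ℝ _) (by simpa using hu)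
  simpa using this

lemma d2_comp {h h' : ℝ → ℝ} {k k' : ℝ → ℝ} {h'' k'' t : ℝ}
    (hh : ∀ᶠ s in 𝓝 (k t), HasDerivAt h (h' s) s) (hh' : HasDerivAt h' h'' (k t))
    (hk : D2At k k' k'' t) :
    D2At (fun s => h (k s)) (fun s => h' (k s) * k' s) (h'' * k' t ^ 2 + h' (k t) * k'') t := by
  constructor
  · filter_upwards [hk.1, hk.1.self_of_nhds.continuousAt.eventually hh] with s h1 h2
    exact h2.comp s h1
  · have := (hh'.comp t hk.1.self_of_nhds).mul hk.2
    refine HasDerivAt.congr_deriv this ?_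
    simp only [Function.comp]
    ring

/-- Laplacian of a function of the squared distance -/
lemma hasLap_radial {h h' h'' : ℝ → ℝ} (hh : ∀ s, HasDerivAt h (h' s) s)
    (hh' : ∀ s, HasDerivAt h' (h'' s) s) (p x : EuclideanSpace ℝ (Fin N)) :
    HasLap (fun y => h (‖y - p‖ ^ 2)) x
      (4 * ‖x - p‖ ^ 2 * h'' (‖x - p‖ ^ 2) + 2 * N * h' (‖x - p‖ ^ 2)) := by
  set b := EuclideanSpace.basisFun (Fin N) ℝ
  have e : ∀ i (t : ℝ), ‖x + t • b i - p‖ ^ 2 = ‖x - p‖ ^ 2 + 2 * inner ℝ (x - p) (b i) * t + t ^ 2 := by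
    intro i t
    have : x + t • b i - p = (x - p) + t • b i := by abel
    rw [this, norm_add_sq_real, norm_smul, b.norm_eq_one, inner_smul_right]
    simp
    ring
  have hk : ∀ i, D2At (fun t : ℝ => ‖x - p‖ ^ 2 + 2 * inner ℝ (x - p) (b i) * t + t ^ 2)
      (fun t => 2 * inner ℝ (x - p) (b i) + 2 * t) 2 0 := by
    intro i
    constructor
    · refine Eventually.of_forall fun t => ?_
      have := (((hasDerivAt_id t).const_mul (2 * inner ℝ (x - p) (b i))).const_add
        (‖x - p‖ ^ 2)).add (hasDerivAt_pow 2 t)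
      refine HasDerivAt.congr_deriv this ?_
      simp
    · have := ((hasDerivAt_id (0:ℝ)).const_mul 2).const_add (2 * inner ℝ (x - p) (b i))
      simpa using this
  have hs : ∑ i, (inner ℝ (x - p) (b i)) ^ 2 = ‖x - p‖ ^ 2 := by
    have := b.sum_sq_norm_inner_left (x - p)
    simpa using this
  refine ⟨fun i s => h' (‖x - p‖ ^ 2 + 2 * inner ℝ (x - p) (b i) * s + s ^ 2) *
    (2 * inner ℝ (x - p) (b i) + 2 * s),
    fun i => h'' (‖x - p‖ ^ 2) * (2 * inner ℝ (x - p) (b i)) ^ 2 + h' (‖x - p‖ ^ 2) * 2,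
    fun i => ?_, ?_⟩
  · have := d2_comp (h := h) (h' := h') (h'' := h'' (‖x - p‖ ^ 2)) (Eventually.of_forall hh)
      (by simpa using hh' _) (hk i)
    have e' : (fun t : ℝ => h (‖x + t • b i - p‖ ^ 2)) =
      fun t => h (‖x - p‖ ^ 2 + 2 * inner ℝ (x - p) (b i) * t + t ^ 2) := by
      funext t; rw [e]
    change D2At (fun t : ℝ => h (‖x + t • b i - p‖ ^ 2)) _ _ _
    rw [e']
    simpa using this
  · rw [Finset.sum_add_distrib, ← Finset.mul_sum]
    simp only [mul_pow, ← Finset.mul_sum, hs]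
    simp
    ring

/-- Laplacian of a function of one coordinate -/
lemma hasLap_coord {h h' h'' : ℝ → ℝ} (hh : ∀ s, HasDerivAt h (h' s) s)
    (hh' : ∀ s, HasDerivAt h' (h'' s) s) (e x : EuclideanSpace ℝ (Fin N)) :
    HasLap (fun y => h (inner ℝ y e)) x (‖e‖ ^ 2 * h'' (inner ℝ x e)) := by
  set b := EuclideanSpace.basisFun (Fin N) ℝ
  have hk : ∀ i, D2At (fun t : ℝ => inner ℝ x e + inner ℝ (b i) e * t)
      (fun t => inner ℝ (b i) e) 0 0 := by
    intro i
    refine ⟨Eventually.of_forall fun t => ?_, hasDerivAt_const _ _⟩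
    simpa using ((hasDerivAt_id t).const_mul (inner ℝ (b i) e)).const_add (inner ℝ x e)
  have hs : ∑ i, (inner ℝ (b i) e) ^ 2 = ‖e‖ ^ 2 := by
    have := b.sum_sq_norm_inner_right e
    simpa using this
  refine ⟨fun i s => h' (inner ℝ x e + inner ℝ (b i) e * s) * inner ℝ (b i) e,
    fun i => h'' (inner ℝ x e) * inner ℝ (b i) e ^ 2, fun i => ?_, ?_⟩
  · have := d2_comp (h := h) (h' := h') (h'' := h'' (inner ℝ x e)) (Eventually.of_forall hh)
      (by simpa using hh' _) (hk i)
    have e' : (fun t : ℝ => h (inner ℝ (x + t • b i) e)) =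
      fun t => h (inner ℝ x e + inner ℝ (b i) e * t) := by
      funext t; rw [inner_add_left, inner_smul_left]; simp [mul_comm]
    change D2At (fun t : ℝ => h (inner ℝ (x + t • b i) e)) _ _ _
    rw [e']
    simpa using this
  · rw [← Finset.mul_sum, hs, mul_comm]

lemma deriv_nonpos_right {k : ℝ → ℝ} {c ε : ℝ} (hε : 0 < ε) (hk : HasDerivAt k c 0)
    (h : ∀ t, 0 < t → t < ε → k t ≤ k 0) : c ≤ 0 := by
  refine le_of_tendsto hk.tendsto_slope_zero_right ?_
  filter_upwards [Ioo_mem_nhdsGT hε] with t ht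
  have := h t ht.1 ht.2
  simp only [zero_add, smul_eq_mul]
  exact mul_nonpos_of_nonneg_of_nonpos (inv_nonneg.2 ht.1.le) (by linarith)

lemma hasLap_exp (α C : ℝ) (p x : EuclideanSpace ℝ (Fin N)) :
    HasLap (fun y => Real.exp (-α * ‖y - p‖ ^ 2) - C) x
      ((4 * α ^ 2 * ‖x - p‖ ^ 2 - 2 * N * α) * Real.exp (-α * ‖x - p‖ ^ 2)) := by
  have h1 : ∀ s : ℝ, HasDerivAt (fun s => Real.exp (-α * s)) (-α * Real.exp (-α * s)) s := by
    intro s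
    have := ((hasDerivAt_id s).const_mul (-α)).exp
    refine HasDerivAt.congr_deriv this ?_
    simp [mul_comm]
  have h2 : ∀ s : ℝ, HasDerivAt (fun s => -α * Real.exp (-α * s))
      (-α * (-α * Real.exp (-α * s))) s := fun s => (h1 s).const_mul _
  have := (hasLap_radial h1 h2 p x).sub (HasLap.const C x)
  convert this using 1
  ring

lemma hopf {w : EuclideanSpace ℝ (Fin N) → ℝ} {p y : EuclideanSpace ℝ (Fin N)} {R Λ : ℝ}
    (hR : 0 < R) (hΛ : 0 ≤ Λ) (hc : ContinuousOn w (closedBall p R))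
    (hneg : ∀ x ∈ ball p R, w x < 0) (hy : ‖y - p‖ = R) (hwy : w y = 0)
    (hlap : ∀ x ∈ ball p R, ∃ ℓ, HasLap w x ℓ ∧ Λ * w x ≤ ℓ)
    {w' : EuclideanSpace ℝ (Fin N) →L[ℝ] ℝ} (hd : HasFDerivAt w w' y) : w' (p - y) < 0 := by
  set α : ℝ := (2 * N + Λ + 1) / R ^ 2 + 1 with hα
  have hR2 : 0 < R ^ 2 := by positivity
  have hα1 : 1 ≤ α := by
    have : 0 ≤ (2 * N + Λ + 1) / R ^ 2 := by positivity
    linarith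
  have hαR : 2 * N + Λ + 1 ≤ α * R ^ 2 := by
    have : (2 * N + Λ + 1) / R ^ 2 * R ^ 2 = 2 * N + Λ + 1 := by field_simp
    rw [hα, add_mul, this]; nlinarith
  set b : EuclideanSpace ℝ (Fin N) → ℝ :=
    fun x => Real.exp (-α * ‖x - p‖ ^ 2) - Real.exp (-α * R ^ 2) with hb
  have hbc : Continuous b := by fun_prop
  have hnonpos : ∀ x ∈ closedBall p R, w x ≤ 0 := by
    intro x hx
    rw [← closure_ball p hR.ne'] at hx hc
    exact le_on_closure (f := w) (g := fun _ => 0) (fun x hx => (hneg x hx).le) hc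
      continuousOn_const hx
  obtain ⟨δ, hδ, hδw⟩ : ∃ δ > 0, ∀ x ∈ closedBall p (R / 2), w x ≤ -δ := by
    have hsub : closedBall p (R / 2) ⊆ ball p R := closedBall_subset_ball (by linarith)
    obtain ⟨z, hz, hzm⟩ := (isCompact_closedBall p (R / 2)).exists_isMaxOn
      ⟨p, mem_closedBall_self (by linarith)⟩ (hc.mono (hsub.trans ball_subset_closedBall))
    exact ⟨-w z, by linarith [hneg z (hsub hz)], fun x hx => by simpa using hzm hx⟩
  have claim : ∀ x ∈ closedBall p R, R / 2 ≤ ‖x - p‖ → w x + δ * b x ≤ 0 := by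
    have hcomp : IsCompact (closedBall p R ∩ {x | R / 2 ≤ ‖x - p‖}) :=
      (isCompact_closedBall p R).inter_right (isClosed_le continuous_const (by fun_prop))
    have hcon : ContinuousOn (fun x => w x + δ * b x) (closedBall p R ∩ {x | R / 2 ≤ ‖x - p‖}) :=
      (hc.mono inter_subset_left).add (by fun_prop)
    obtain ⟨z, hz, hzm⟩ := hcomp.exists_isMaxOn
      ⟨y, by simp [dist_eq_norm, hy], by simp [hy]; linarith⟩ hcon
    intro x hx hx2
    refine le_trans (hzm ⟨hx, hx2⟩) ?_
    change w z + δ * b z ≤ 0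
    by_contra hpos
    push Not at hpos
    have hz1 : ‖z - p‖ ≤ R := by simpa [dist_eq_norm] using hz.1
    have hz2 : R / 2 ≤ ‖z - p‖ := hz.2
    have hexp1 : Real.exp (-α * ‖z - p‖ ^ 2) ≤ 1 := by
      rw [Real.exp_le_one_iff]; nlinarith [sq_nonneg ‖z - p‖]
    have hb1 : b z ≤ Real.exp (-α * ‖z - p‖ ^ 2) := by
      simp only [hb]; linarith [Real.exp_pos (-α * R ^ 2)]
    rcases hz1.eq_or_lt with h | h
    · have : b z = 0 := by simp [hb, h]
      rw [this] at hpos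
      have := hnonpos z hz.1
      linarith
    rcases hz2.eq_or_lt with h' | h'
    · have := hδw z (by simp [dist_eq_norm, ← h'])
      nlinarith
    have hzb : z ∈ ball p R := by simpa [dist_eq_norm] using h
    obtain ⟨ℓ, hℓ, hℓ2⟩ := hlap z hzb
    have hmax : IsLocalMax (fun x => w x + δ * b x) z := by
      have : closedBall p R ∩ {x | R / 2 ≤ ‖x - p‖} ∈ 𝓝 z := by
        refine inter_mem (mem_of_superset (isOpen_ball.mem_nhds hzb) ball_subset_closedBall) ?_
        refine mem_of_superset ((isOpen_lt (continuous_const (y := R / 2))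
          (f := fun _ => R / 2) (g := fun x => ‖x - p‖) (by fun_prop)).mem_nhds h') ?_
        intro x hx; exact le_of_lt (show R / 2 < ‖x - p‖ from hx)
      exact hzm.isLocalMax this
    have := (hℓ.add ((hasLap_exp α (Real.exp (-α * R ^ 2)) p z).const_mul δ)).max hmax
    set E := Real.exp (-α * ‖z - p‖ ^ 2)
    have hE : 0 < E := Real.exp_pos _
    have h4 : R ^ 2 ≤ 4 * ‖z - p‖ ^ 2 := by nlinarith
    have h5 : Λ + 1 ≤ 4 * α ^ 2 * ‖z - p‖ ^ 2 - 2 * N * α := by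
      have : α * (α * R ^ 2 - 2 * N) ≤ 4 * α ^ 2 * ‖z - p‖ ^ 2 - 2 * N * α := by nlinarith
      nlinarith
    have h6 : (Λ + 1) * E ≤ (4 * α ^ 2 * ‖z - p‖ ^ 2 - 2 * N * α) * E := by gcongr
    have h7 : δ * ((Λ + 1) * E) ≤ δ * ((4 * α ^ 2 * ‖z - p‖ ^ 2 - 2 * N * α) * E) := by gcongr
    have h8 : Λ * (δ * b z) ≤ Λ * (δ * E) := by gcongr
    have h9 : 0 ≤ Λ * (w z + δ * b z) := by positivity
    nlinarith
  have hline := hasDerivAt_line y (p - y) 0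
  have hk1 : HasDerivAt (fun t : ℝ => w (y + t • (p - y))) (w' (p - y)) 0 := by
    refine HasFDerivAt.comp_hasDerivAt (f := fun t : ℝ => y + t • (p - y)) 0 ?_ hline
    simpa using hd
  have hnorm : ∀ t : ℝ, ‖y + t • (p - y) - p‖ ^ 2 = (1 - t) ^ 2 * R ^ 2 := by
    intro t
    have : y + t • (p - y) - p = (1 - t) • (y - p) := by module
    rw [this, norm_smul, mul_pow, hy]; simp
  have hk2 : HasDerivAt (fun t : ℝ => b (y + t • (p - y)))
      (2 * α * R ^ 2 * Real.exp (-α * R ^ 2)) 0 := by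
    simp only [hb, hnorm]
    have h1 : HasDerivAt (fun t : ℝ => -α * ((1 - t) ^ 2 * R ^ 2)) (2 * α * R ^ 2) 0 := by
      have := ((((hasDerivAt_id (0:ℝ)).const_sub 1).pow 2).mul_const (R ^ 2)).const_mul (-α)
      refine HasDerivAt.congr_deriv this ?_
      simp; ring
    refine HasDerivAt.congr_deriv (h1.exp.sub_const _) ?_
    simp; ring
  have hk := hk1.add (hk2.const_mul δ)
  have := deriv_nonpos_right (ε := 1 / 2) (by norm_num) hk (by
    intro t ht0 ht1
    have hn : ‖y + t • (p - y) - p‖ = (1 - t) * R := by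
      have : y + t • (p - y) - p = (1 - t) • (y - p) := by module
      rw [this, norm_smul, hy, Real.norm_eq_abs, abs_of_pos (by linarith)]
    have h1 := claim (y + t • (p - y)) (by simp only [mem_closedBall, dist_eq_norm, hn]; nlinarith)
      (by rw [hn]; nlinarith)
    have h2 : b y = 0 := by simp [hb, hy]
    simp only [Pi.add_apply, zero_smul, add_zero, hwy, h2]
    simpa using h1)
  have : 0 < δ * (2 * α * R ^ 2 * Real.exp (-α * R ^ 2)) := by positivity
  linarith

lemma unif_blow {u : EuclideanSpace ℝ (Fin N) → ℝ}
    (hb : ∀ x₀ : EuclideanSpace ℝ (Fin N), ‖x₀‖ = 1 →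
      Tendsto u (𝓝[ball (0 : EuclideanSpace ℝ (Fin N)) 1] x₀) atTop) (M : ℝ) :
    ∃ r₀ : ℝ, 0 < r₀ ∧ r₀ < 1 ∧ ∀ x, r₀ ≤ ‖x‖ → ‖x‖ < 1 → M < u x := by
  set W : Set (EuclideanSpace ℝ (Fin N)) := {x | x ∈ ball (0 : EuclideanSpace ℝ (Fin N)) 1 → M < u x}
  have hW : sphere (0 : EuclideanSpace ℝ (Fin N)) 1 ⊆ interior W := by
    intro x hx
    rw [mem_interior_iff_mem_nhds]
    have := (hb x (by simpa using hx)).eventually_gt_atTop M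
    rw [eventually_nhdsWithin_iff] at this
    exact this
  obtain ⟨δ, hδ, hδW⟩ := (isCompact_sphere (0 : EuclideanSpace ℝ (Fin N)) 1).exists_cthickening_subset_open
    isOpen_interior hW
  refine ⟨max (1 / 2) (1 - δ), by positivity, by simp; norm_num [hδ], ?_⟩
  intro x hx hx1
  have h1 : 1 / 2 ≤ ‖x‖ := (le_max_left _ _).trans hx
  have h2 : 1 - δ ≤ ‖x‖ := (le_max_right _ _).trans hx
  have hpos : 0 < ‖x‖ := by linarith
  have hmem : x ∈ cthickening δ (sphere (0 : EuclideanSpace ℝ (Fin N)) 1) := by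
    refine mem_cthickening_of_dist_le x (‖x‖⁻¹ • x) δ _ ?_ ?_
    · simp [norm_smul, hpos.ne']
    · have : x - ‖x‖⁻¹ • x = (1 - ‖x‖⁻¹) • x := by module
      rw [dist_eq_norm, this, norm_smul, Real.norm_eq_abs, abs_of_nonpos]
      · have : -(1 - ‖x‖⁻¹) * ‖x‖ = 1 - ‖x‖ := by field_simp; ring
        linarith
      · have := (one_le_inv₀ hpos).2 hx1.le
        linarith
  exact interior_subset (hδW hmem) (by simpa using hx1)

lemma hasLap_sq (x : EuclideanSpace ℝ (Fin N)) : HasLap (fun y => ‖y‖ ^ 2) x (2 * N) := by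
  have := hasLap_radial (h := fun s => s) (h' := fun _ => 1) (h'' := fun _ => 0)
    (fun s => hasDerivAt_id s) (fun s => hasDerivAt_const s 1) 0 x
  simpa using this

lemma contDiffAt_of {u : EuclideanSpace ℝ (Fin N) → ℝ} (hu : ContDiffOn ℝ 2 u (ball 0 1))
    {x : EuclideanSpace ℝ (Fin N)} (hx : ‖x‖ < 1) : ContDiffAt ℝ 2 u x :=
  hu.contDiffAt (isOpen_ball.mem_nhds (by simpa using hx))

lemma ballmax (hN : 1 ≤ N) {f : ℝ → ℝ} {a : ℝ} {u : EuclideanSpace ℝ (Fin N) → ℝ}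
    (hf0 : ∀ t > a, 0 ≤ f t)
    (hu : ContDiffOn ℝ 2 u (ball 0 1))
    (hE : ∀ x ∈ ball (0 : EuclideanSpace ℝ (Fin N)) 1, lap u x = f (u x))
    {r C : ℝ} (hr1 : r < 1) (haC : a ≤ C)
    (hC : ∀ x, ‖x‖ = r → u x ≤ C) : ∀ y, ‖y‖ ≤ r → u y ≤ C := by
  intro y hy
  by_contra hcon
  push Not at hcon
  set ε := (u y - C) / 2 with hε
  have hε0 : 0 < ε := by simp only [hε]; linarith
  have hr0 : 0 ≤ r := (norm_nonneg y).trans hy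
  have hsub : closedBall (0 : EuclideanSpace ℝ (Fin N)) r ⊆ ball 0 1 := closedBall_subset_ball hr1
  obtain ⟨z, hz, hzm⟩ := (isCompact_closedBall (0 : EuclideanSpace ℝ (Fin N)) r).exists_isMaxOn
    (f := fun x => u x + ε * ‖x‖ ^ 2)
    ⟨y, by simpa using hy⟩ ((hu.continuousOn.mono hsub).add (by fun_prop))
  have h1 : u y + ε * ‖y‖ ^ 2 ≤ u z + ε * ‖z‖ ^ 2 := hzm (show y ∈ closedBall _ r by simpa using hy)
  have hz' : ‖z‖ ≤ r := by simpa using hz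
  have hyy : 0 ≤ ε * ‖y‖ ^ 2 := by positivity
  have hr2 : ε * r ^ 2 ≤ ε * 1 := by gcongr; nlinarith
  have hzr : ‖z‖ < r := by
    refine lt_of_le_of_ne hz' fun h => ?_
    have := hC z h
    rw [h] at h1
    linarith
  have hzz : ε * ‖z‖ ^ 2 ≤ ε * r ^ 2 := by gcongr
  have hlm : IsLocalMax (fun x => u x + ε * ‖x‖ ^ 2) z :=
    hzm.isLocalMax (mem_of_superset (isOpen_ball.mem_nhds (by simpa using hzr))
      ball_subset_closedBall)
  have := ((hasLap_lap (contDiffAt_of hu (hzr.trans hr1))).add ((hasLap_sq z).const_mul ε)).max hlm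
  rw [hE z (by simpa using hzr.trans hr1)] at this
  have h3 := hf0 (u z) (by linarith)
  have : (1 : ℝ) ≤ N := by exact_mod_cast hN
  nlinarith

lemma circle {u : EuclideanSpace ℝ (Fin N) → ℝ} {e τ : EuclideanSpace ℝ (Fin N)} {r : ℝ}
    (hu : ContDiffAt ℝ 2 u (r • e)) (he : ‖e‖ = 1) (hτ : ‖τ‖ = 1) (ho : inner ℝ e τ = 0)
    (hr : 0 < r) :
    ∃ (γ : ℝ → EuclideanSpace ℝ (Fin N)) (d : ℝ → ℝ), (∀ t, ‖γ t‖ = r) ∧ γ 0 = r • e ∧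
      D2At (fun t => u (γ t)) d (r ^ 2 * Q u (r • e) τ - r * fderiv ℝ u (r • e) e) 0 := by
  have h := slice (u := u) (γ := fun t : ℝ => (r * Real.cos t) • e + (r * Real.sin t) • τ)
    (γ' := fun t : ℝ => (r * -Real.sin t) • e + (r * Real.cos t) • τ) (t₀ := 0)
    (a := (r * -Real.cos 0) • e + (r * -Real.sin 0) • τ)
    (by simpa using hu)
    (Eventually.of_forall fun t => (((Real.hasDerivAt_cos t).const_mul r).smul_const e).add
      (((Real.hasDerivAt_sin t).const_mul r).smul_const τ))
    ((((Real.hasDerivAt_sin 0).neg.const_mul r).smul_const e).add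
      (((Real.hasDerivAt_cos 0).const_mul r).smul_const τ))
  refine ⟨fun t => (r * Real.cos t) • e + (r * Real.sin t) • τ,
    fun t => fderiv ℝ u ((r * Real.cos t) • e + (r * Real.sin t) • τ)
      ((r * -Real.sin t) • e + (r * Real.cos t) • τ), ?_, ?_, ?_⟩
  · intro t
    have : ‖(r * Real.cos t) • e + (r * Real.sin t) • τ‖ ^ 2 = r ^ 2 := by
      rw [norm_add_sq_real, norm_smul, norm_smul, inner_smul_left, inner_smul_right, ho, he, hτ]
      simp only [Real.norm_eq_abs, mul_one, sq_abs, mul_zero, add_zero]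
      have := Real.sin_sq_add_cos_sq t
      linear_combination r ^ 2 * this
    exact (pow_left_inj₀ (norm_nonneg _) hr.le two_ne_zero).1 this
  · simp
  · convert h using 1
    simp [Q]
    ring

lemma exists_onb (hN : 1 ≤ N) {e : EuclideanSpace ℝ (Fin N)} (he : ‖e‖ = 1) :
    ∃ (b : OrthonormalBasis (Fin N) ℝ (EuclideanSpace ℝ (Fin N))) (i₀ : Fin N), b i₀ = e := by
  have hc : Module.finrank ℝ (EuclideanSpace ℝ (Fin N)) = Fintype.card (Fin N) := by simp
  obtain ⟨b, hb⟩ := Orthonormal.exists_orthonormalBasis_extension_of_card_eq hc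
    (v := fun _ : Fin N => e) (s := {⟨0, hN⟩}) (by
      rw [orthonormal_iff_ite]
      rintro ⟨i, hi⟩ ⟨j, hj⟩
      simp only [mem_singleton_iff] at hi hj
      subst hi; subst hj
      simp [he])
  exact ⟨b, ⟨0, hN⟩, hb _ rfl⟩

lemma sphere_max (hN : 1 ≤ N) {u : EuclideanSpace ℝ (Fin N) → ℝ} {e : EuclideanSpace ℝ (Fin N)}
    {r : ℝ} (hu : ContDiffAt ℝ 2 u (r • e)) (he : ‖e‖ = 1) (hr : 0 < r)
    (hm : ∀ y, ‖y‖ = r → u y ≤ u (r • e)) :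
    lap u (r • e) ≤ Q u (r • e) e + (N - 1) * (fderiv ℝ u (r • e) e / r) := by
  obtain ⟨b, i₀, hb⟩ := exists_onb hN he
  rw [lap_onb hu b, ← Finset.add_sum_erase _ _ (Finset.mem_univ i₀), hb]
  gcongr
  have : ∀ i ∈ Finset.univ.erase i₀, Q u (r • e) (b i) ≤ fderiv ℝ u (r • e) e / r := by
    intro i hi
    have hi : i ≠ i₀ := by simpa using hi
    obtain ⟨γ, d, h1, h2, h3⟩ := circle (τ := b i) hu he (b.norm_eq_one i)
      (by rw [← hb]; exact b.orthonormal.2 hi.symm) hr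
    have := (h3.max (Eventually.of_forall fun t => by
      show u (γ t) ≤ u (γ 0)
      rw [h2]; exact hm _ (h1 t))).2
    rw [le_div_iff₀ hr]
    nlinarith
  refine (Finset.sum_le_card_nsmul _ _ _ this).trans ?_
  rw [Finset.card_erase_of_mem (Finset.mem_univ _)]
  simp [Nat.cast_sub hN]

lemma sphere_min (hN : 1 ≤ N) {u : EuclideanSpace ℝ (Fin N) → ℝ} {e : EuclideanSpace ℝ (Fin N)}
    {r : ℝ} (hu : ContDiffAt ℝ 2 u (r • e)) (he : ‖e‖ = 1) (hr : 0 < r)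
    (hm : ∀ y, ‖y‖ = r → u (r • e) ≤ u y) :
    Q u (r • e) e + (N - 1) * (fderiv ℝ u (r • e) e / r) ≤ lap u (r • e) := by
  obtain ⟨b, i₀, hb⟩ := exists_onb hN he
  rw [lap_onb hu b, ← Finset.add_sum_erase _ _ (Finset.mem_univ i₀), hb]
  gcongr
  have : ∀ i ∈ Finset.univ.erase i₀, fderiv ℝ u (r • e) e / r ≤ Q u (r • e) (b i) := by
    intro i hi
    have hi : i ≠ i₀ := by simpa using hi
    obtain ⟨γ, d, h1, h2, h3⟩ := circle (τ := b i) hu he (b.norm_eq_one i)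
      (by rw [← hb]; exact b.orthonormal.2 hi.symm) hr
    have := ((h3.const_mul (-1)).max (Eventually.of_forall fun t => by
      have := hm _ (h1 t)
      rw [← h2] at this
      linarith)).2
    rw [div_le_iff₀ hr]
    nlinarith
  refine le_trans ?_ (Finset.card_nsmul_le_sum _ _ _ this)
  rw [Finset.card_erase_of_mem (Finset.mem_univ _)]
  simp [Nat.cast_sub hN]

/-- standing hypotheses -/
structure Sol (f : ℝ → ℝ) (a K : ℝ) (u : EuclideanSpace ℝ (Fin N) → ℝ) : Prop where
  hN : 1 ≤ N
  hf : ContDiff ℝ 1 f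
  hf0 : ∀ t > a, 0 ≤ f t
  hK0 : 0 ≤ K
  hK : ∀ s t, s ≤ t → -K * (t - s) ≤ f t - f s
  hu : ContDiffOn ℝ 2 u (ball 0 1)
  hE : ∀ x ∈ ball (0 : EuclideanSpace ℝ (Fin N)) 1, lap u x = f (u x)
  hb : ∀ x₀ : EuclideanSpace ℝ (Fin N), ‖x₀‖ = 1 →
      Tendsto u (𝓝[ball (0 : EuclideanSpace ℝ (Fin N)) 1] x₀) atTop

lemma osc_alg {n r δ t P p A B fx fy L φ φ' : ℝ} (hn : 1 ≤ n) (hr : 1 / 2 ≤ r) (hr1 : r < 1)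
    (hδ : 0 ≤ δ) (hδn : n * δ ≤ 1 / 8) (ht : 0 < t) (ht1 : t < 1)
    (hφ : φ = r + t * (1 - 4 * n * δ ^ 2)) (hφ' : φ' = 1 - 8 * n * t * δ)
    (hP : 0 ≤ P) (h1 : P = φ' * p - 2 * L * r) (h2 : A ≤ φ' ^ 2 * B - 8 * n * t * p - 2 * L)
    (h3 : fx ≤ A + (n - 1) * (P / r)) (h4 : B + (n - 1) * (p / φ) ≤ fy) (hfy : 0 ≤ fy)
    (hL : 0 < L) : fx ≤ fy - 2 * L := by
  have ha : 0 ≤ t * (n * δ) := by positivity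
  have ha1 : t * (n * δ) ≤ t * (1 / 8) := by gcongr
  have hφ'0 : 0 < φ' := by rw [hφ']; nlinarith
  have hφ'1 : φ' ≤ 1 := by rw [hφ']; nlinarith
  have hδ1 : δ ≤ 1 / 8 := by nlinarith
  have hd2 : n * δ ^ 2 ≤ 1 / 64 := by
    have : n * δ * δ ≤ 1 / 8 * (1 / 8) := by gcongr
    nlinarith
  have hd20 : 0 ≤ n * δ ^ 2 := by positivity
  have hφr : r ≤ φ := by rw [hφ]; nlinarith
  have hφ2 : φ - r * φ' ≤ 2 * t := by
    rw [hφ, hφ']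
    have : r * (t * (n * δ)) ≤ 1 * (t * (1 / 8)) := by gcongr
    nlinarith
  have hp : 0 ≤ p := by
    by_contra hc
    push Not at hc
    nlinarith [mul_pos hφ'0 (neg_pos.2 hc), mul_pos hL (by linarith : 0 < r)]
  have hφp : 0 < φ := by linarith
  have hrp : 0 < r := by linarith
  have hφ2sq : φ' ^ 2 ≤ 1 := by nlinarith
  have hB : φ' ^ 2 * B ≤ fy - φ' ^ 2 * ((n - 1) * (p / φ)) := by
    have : φ' ^ 2 * (B + (n - 1) * (p / φ)) ≤ φ' ^ 2 * fy := by gcongr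
    nlinarith
  have hbr : (n - 1) * φ' * (φ - r * φ') / (r * φ) ≤ 8 * n * t := by
    have hrφ : 1 / 4 ≤ r * φ := by nlinarith
    rw [div_le_iff₀ (by positivity)]
    have h5 : (n - 1) * φ' * (φ - r * φ') ≤ (n - 1) * φ' * (2 * t) :=
      mul_le_mul_of_nonneg_left hφ2 (mul_nonneg (by linarith) hφ'0.le)
    have h6 : (n - 1) * φ' * (2 * t) ≤ (n - 1) * 1 * (2 * t) := by
      have : 0 ≤ n - 1 := by linarith
      gcongr
    have h7 : 8 * n * t * (1 / 4) ≤ 8 * n * t * (r * φ) := by gcongr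
    linarith
  have hid : (n - 1) * (P / r) - φ' ^ 2 * ((n - 1) * (p / φ)) =
      p * ((n - 1) * φ' * (φ - r * φ') / (r * φ)) - 2 * (n - 1) * L := by
    rw [h1]; field_simp; ring
  have h8 := mul_le_mul_of_nonneg_left hbr hp
  have h9 : 0 ≤ (n - 1) * L := mul_nonneg (by linarith) hL.le
  linarith

lemma osc_point {f : ℝ → ℝ} {a K : ℝ} {u : EuclideanSpace ℝ (Fin N) → ℝ} (S : Sol f a K u)
    {e e' : EuclideanSpace ℝ (Fin N)} (he : ‖e‖ = 1) (he' : ‖e'‖ = 1) {r r₁ t L : ℝ} {φ : ℝ → ℝ}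
    (hφ : φ = fun r => r + t * (1 - 4 * N * (r - r₁) ^ 2))
    (hr₁ : 1 / 2 ≤ r₁) (hr : r₁ ≤ r) (hr1 : r < 1) (hφ1 : φ r < 1) (hδ : N * (1 - r₁) ≤ 1 / 8)
    (ht : 0 < t) (ht1 : t < 1) (hφr : r ≤ φ r) (hL : 0 < L) (hKr : K * (1 - r ^ 2) ≤ 1)
    (hua : ∀ x, r₁ ≤ ‖x‖ → ‖x‖ < 1 → a < u x)
    (heq : u (r • e) - u (φ r • e') = L * (1 - r ^ 2))
    (hm1 : ∀ y, ‖y‖ = r → u y ≤ u (r • e)) (hm2 : ∀ y, ‖y‖ = φ r → u (φ r • e') ≤ u y)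
    (hm3 : ∀ᶠ ρ in 𝓝 r, u (ρ • e) - u (φ ρ • e') - L * (1 - ρ ^ 2) ≤ 0) : False := by
  have hrp : 0 < r := by linarith
  have hnx : ‖r • e‖ = r := by rw [norm_smul, he, mul_one, Real.norm_eq_abs, abs_of_pos hrp]
  have hny : ‖φ r • e'‖ = φ r := by
    rw [norm_smul, he', mul_one, Real.norm_eq_abs, abs_of_pos (by linarith)]
  have hcx := contDiffAt_of S.hu (x := r • e) (by rw [hnx]; exact hr1)
  have hcy := contDiffAt_of S.hu (x := φ r • e') (by rw [hny]; exact hφ1)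
  have hax := hua (r • e) (by rw [hnx]; exact hr) (by rw [hnx]; exact hr1)
  have hay := hua (φ r • e') (by rw [hny]; linarith) (by rw [hny]; exact hφ1)
  have hdφ : ∀ ρ, HasDerivAt φ (1 - 8 * N * t * (ρ - r₁)) ρ := by
    intro ρ
    rw [hφ]
    have := (hasDerivAt_id ρ).add ((((((hasDerivAt_id ρ).sub_const r₁).pow 2).const_mul
      (4 * N : ℝ)).const_sub 1).const_mul t)
    refine HasDerivAt.congr_deriv this ?_
    simp; ring
  have hdφ' : HasDerivAt (fun ρ => 1 - 8 * N * t * (ρ - r₁)) (- (8 * N * t)) r := by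
    have := ((((hasDerivAt_id r).sub_const r₁).const_mul (8 * N * t : ℝ)).const_sub 1)
    simpa using this
  have d1 := slice (u := u) (γ := fun ρ : ℝ => ρ • e) (γ' := fun _ => e) (t₀ := r) (a := 0) hcx
    (Eventually.of_forall fun ρ => by simpa using (hasDerivAt_id ρ).smul_const e)
    (hasDerivAt_const _ _)
  have d2 := slice (u := u) (γ := fun ρ : ℝ => φ ρ • e')
    (γ' := fun ρ => (1 - 8 * N * t * (ρ - r₁)) • e') (t₀ := r) (a := (- (8 * N * t)) • e') hcy
    (Eventually.of_forall fun ρ => (hdφ ρ).smul_const e')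
    (hdφ'.smul_const e')
  have d3 : D2At (fun ρ : ℝ => L * (1 - ρ ^ 2)) (fun ρ => L * (-(2 * ρ))) (L * (-(2 * 1))) r := by
    refine D2At.const_mul L ⟨Eventually.of_forall fun ρ => ?_, ?_⟩
    · simpa using (hasDerivAt_pow 2 ρ).const_sub 1
    · exact ((hasDerivAt_id r).const_mul 2).neg
  have hmx := ((d1.sub d2).sub d3).max (by
    filter_upwards [hm3] with ρ hρ
    rw [heq]
    linarith)
  obtain ⟨m1, m2⟩ := hmx
  simp only [map_smul, Q, map_zero, add_zero, smul_eq_mul, _root_.smul_apply] at m1 m2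
  have hP : 0 ≤ fderiv ℝ u (r • e) e := by
    have hbm := ballmax S.hN S.hf0 S.hu S.hE hr1 hax.le hm1
    have hk : HasDerivAt (fun τ : ℝ => u (r • e + τ • (-e))) (fderiv ℝ u (r • e) (-e)) 0 := by
      refine HasFDerivAt.comp_hasDerivAt (f := fun τ : ℝ => r • e + τ • (-e)) 0 ?_
        (hasDerivAt_line _ _ _)
      simpa using (hcx.differentiableAt (by norm_num)).hasFDerivAt
    have := deriv_nonpos_right hrp hk (by
      intro τ h0 h1
      have : r • e + τ • (-e) = (r - τ) • e := by module
      simp only [this, zero_smul, add_zero]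
      apply hbm
      rw [norm_smul, he, Real.norm_eq_abs, abs_of_pos (by linarith)]
      linarith)
    simp at this
    exact this
  have s1 := sphere_max S.hN hcx he hrp hm1
  have s2 := sphere_min S.hN hcy he' (by linarith) hm2
  rw [S.hE _ (by simpa [hnx] using hr1)] at s1
  rw [S.hE _ (by rw [mem_ball_zero_iff, hny]; exact hφ1)] at s2
  have hNr : (1 : ℝ) ≤ N := by exact_mod_cast S.hN
  have := osc_alg (n := N) (δ := r - r₁) (φ := φ r) (φ' := 1 - 8 * N * t * (r - r₁)) (L := L)
    hNr (hr₁.trans hr) hr1 (by linarith)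
    (by have : (N : ℝ) * (r - r₁) ≤ N * (1 - r₁) := by gcongr
        linarith) ht ht1 (by rw [hφ]) rfl hP (p := fderiv ℝ u (φ r • e') e') (by linarith)
    (B := Q u (φ r • e') e') (by simp only [Q]; nlinarith) s1 s2 (S.hf0 _ hay) hL
  have hr2 : 0 < 1 - r ^ 2 := by nlinarith
  have hle := S.hK (u (φ r • e')) (u (r • e)) (by nlinarith [mul_pos hL hr2])
  rw [heq] at hle
  nlinarith [mul_le_mul_of_nonneg_left hKr hL.le]

lemma osc_t {f : ℝ → ℝ} {a K : ℝ} {u : EuclideanSpace ℝ (Fin N) → ℝ} (S : Sol f a K u)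
    {r₁ t L : ℝ} {φ : ℝ → ℝ}
    (hφ : φ = fun r => r + t * (1 - 4 * N * (r - r₁) ^ 2))
    (hr₁ : 1 / 2 ≤ r₁) (hr₁1 : r₁ < 1) (hδ : N * (1 - r₁) ≤ 1 / 8)
    (ht : 0 < t) (ht1 : t < 1) (hL : 0 ≤ L) (hKr : ∀ r, r₁ ≤ r → r < 1 → K * (1 - r ^ 2) ≤ 1)
    (hua : ∀ x, r₁ ≤ ‖x‖ → ‖x‖ < 1 → a < u x)
    (hC : ∀ x, ‖x‖ = r₁ → u x - a ≤ L * (1 - r₁ ^ 2))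
    {r : ℝ} (hr : r₁ ≤ r) (hr1 : r ≤ 1) (hφ1 : φ r < 1) {e e' : EuclideanSpace ℝ (Fin N)} (he : ‖e‖ = 1)
    (he' : ‖e'‖ = 1) : u (r • e) - u (φ r • e') ≤ L * (1 - r ^ 2) := by
  by_contra hcon
  push Not at hcon
  have hNr : (1 : ℝ) ≤ N := by exact_mod_cast S.hN
  have hq : ∀ ρ, r₁ ≤ ρ → ρ ≤ 1 → 4 * N * (ρ - r₁) ^ 2 ≤ 1 / 2 := by
    intro ρ h1 h2
    have h3 : (N : ℝ) * (ρ - r₁) ≤ N * (1 - r₁) := by gcongr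
    have h4 : (N * (ρ - r₁)) * (ρ - r₁) ≤ (1 / 8) * 1 := by
      have h0 : 0 ≤ ρ - r₁ := by linarith
      have : ρ - r₁ ≤ 1 := by linarith
      have : (N : ℝ) * (ρ - r₁) ≤ 1 / 8 := by linarith
      gcongr
    nlinarith
  have hφc : Continuous φ := by rw [hφ]; fun_prop
  have hφlow : ∀ ρ, r₁ ≤ ρ → ρ ≤ 1 → ρ + t / 2 ≤ φ ρ := by
    intro ρ h1 h2
    have := hq ρ h1 h2
    rw [hφ]
    nlinarith
  have hnorm : ∀ (ρ : ℝ) (v : EuclideanSpace ℝ (Fin N)), 0 ≤ ρ → ‖v‖ = 1 → ‖ρ • v‖ = ρ := by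
    intro ρ v h1 h2
    rw [norm_smul, h2, mul_one, Real.norm_eq_abs, abs_of_nonneg h1]
  set R := 1 - t / 2 with hR
  obtain ⟨z, -, hz⟩ := (isCompact_closedBall (0 : EuclideanSpace ℝ (Fin N)) R).exists_isMaxOn
    ⟨0, by simp [hR]; linarith⟩
    (S.hu.continuousOn.mono (closedBall_subset_ball (by linarith)))
  obtain ⟨s, hs0, hs1, hs⟩ := unif_blow S.hb (u z)
  have hRz : ∀ ρ v, 0 ≤ ρ → ρ ≤ R → ‖v‖ = 1 → u (ρ • v) ≤ u z := by
    intro ρ v h1 h2 h3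
    exact hz (by rw [mem_closedBall_zero_iff, hnorm ρ v h1 h3]; exact h2)
  have hpos : ∀ ρ : ℝ, 0 < ρ → ρ < 1 → 0 < 1 - ρ ^ 2 := by intro ρ h1 h2; nlinarith
  have hlt : ∀ ρ v v', r₁ ≤ ρ → ρ ≤ 1 → φ ρ < 1 → ‖v‖ = 1 → ‖v'‖ = 1 →
      u (φ ρ • v') < u (ρ • v) → φ ρ < s := by
    intro ρ v v' h1 h2 h3 hv hv' h4
    by_contra hc
    push Not at hc
    have h5 := hφlow ρ h1 h2
    have h6 := hs (φ ρ • v') (by rw [hnorm _ _ (by linarith) hv']; exact hc)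
      (by rw [hnorm _ _ (by linarith) hv']; exact h3)
    have h7 := hRz ρ v (by linarith) (by linarith) hv
    linarith
  have hφr := hφlow r hr hr1
  have hr2 : 0 < 1 - r ^ 2 := hpos r (by linarith) (by linarith)
  have hφs := hlt r e e' hr hr1 hφ1 he he' (by nlinarith)
  set T : Set (ℝ × EuclideanSpace ℝ (Fin N) × EuclideanSpace ℝ (Fin N)) :=
    (Icc r₁ 1 ×ˢ sphere 0 1 ×ˢ sphere 0 1) ∩ {q | φ q.1 ≤ s} with hT
  have hTc : IsCompact T := by
    refine IsCompact.inter_right ?_ (isClosed_le (by fun_prop) continuous_const)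
    exact isCompact_Icc.prod ((isCompact_sphere _ _).prod (isCompact_sphere _ _))
  have hTm : ∀ ρ v v', r₁ ≤ ρ → ρ ≤ 1 → φ ρ ≤ s → ‖v‖ = 1 → ‖v'‖ = 1 → (ρ, v, v') ∈ T := by
    intro ρ v v' h1 h2 h3 h4 h5
    exact ⟨⟨⟨h1, h2⟩, by simpa using h4, by simpa using h5⟩, h3⟩
  have hGc : ContinuousOn (fun q : ℝ × EuclideanSpace ℝ (Fin N) × EuclideanSpace ℝ (Fin N) =>
      (u (q.1 • q.2.1) - u (φ q.1 • q.2.2)) / (1 - q.1 ^ 2)) T := by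
    refine ContinuousOn.div (ContinuousOn.sub ?_ ?_) (by fun_prop) ?_
    · refine S.hu.continuousOn.comp (by fun_prop) ?_
      rintro ⟨ρ, v, v'⟩ ⟨⟨⟨h1, h2⟩, h3, h4⟩, h5⟩
      simp only [mem_ofPred_eq, mem_sphere_zero_iff_norm] at h1 h2 h3 h4 h5 ⊢
      rw [mem_ball_zero_iff, hnorm _ _ (by linarith) h3]
      linarith [hφlow ρ h1 h2]
    · refine S.hu.continuousOn.comp (by fun_prop) ?_
      rintro ⟨ρ, v, v'⟩ ⟨⟨⟨h1, h2⟩, h3, h4⟩, h5⟩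
      simp only [mem_ofPred_eq, mem_sphere_zero_iff_norm] at h1 h2 h3 h4 h5 ⊢
      rw [mem_ball_zero_iff, hnorm _ _ (by linarith [hφlow ρ h1 h2]) h4]
      linarith
    · rintro ⟨ρ, v, v'⟩ ⟨⟨⟨h1, h2⟩, h3, h4⟩, h5⟩
      simp only [mem_ofPred_eq, mem_sphere_zero_iff_norm] at h1 h2 h3 h4 h5 ⊢
      exact (hpos ρ (by linarith) (by linarith [hφlow ρ h1 h2])).ne'
  obtain ⟨⟨ρ, v, v'⟩, hqT, hqm⟩ := hTc.exists_isMaxOn ⟨_, hTm r e e' hr hr1 hφs.le he he'⟩ hGc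
  have hm := fun q (hq : q ∈ T) => (isMaxOn_iff.1 hqm) q hq
  obtain ⟨⟨⟨h1, h2⟩, h3, h4⟩, h5⟩ := hqT
  simp only [mem_ofPred_eq, mem_sphere_zero_iff_norm] at h1 h2 h3 h4 h5 hm
  set L' := (u (ρ • v) - u (φ ρ • v')) / (1 - ρ ^ 2) with hL'
  have hφρ := hφlow ρ h1 h2
  have hρ1 : ρ < 1 := by linarith
  have hρ2 : 0 < 1 - ρ ^ 2 := hpos ρ (by linarith) hρ1
  have hLL : L < L' := by
    refine lt_of_lt_of_le ?_ (hm _ (hTm r e e' hr hr1 hφs.le he he'))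
    rw [lt_div_iff₀ hr2]; exact hcon
  have heq : u (ρ • v) - u (φ ρ • v') = L' * (1 - ρ ^ 2) := by
    rw [hL']; field_simp
  have hmain : ∀ ρ' w w', r₁ ≤ ρ' → ρ' ≤ 1 → φ ρ' ≤ s → ‖w‖ = 1 → ‖w'‖ = 1 →
      u (ρ' • w) - u (φ ρ' • w') ≤ L' * (1 - ρ' ^ 2) := by
    intro ρ' w w' g1 g2 g3 g4 g5
    have := hm _ (hTm ρ' w w' g1 g2 g3 g4 g5)
    rwa [div_le_iff₀ (hpos ρ' (by linarith) (by linarith [hφlow ρ' g1 g2]))] at this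
  have hρr : r₁ < ρ := by
    refine lt_of_le_of_ne h1 fun h => ?_
    have g1 := hC (ρ • v) (by rw [hnorm _ _ (by linarith) h3, h])
    have g2 := hua (φ ρ • v') (by rw [hnorm _ _ (by linarith) h4]; linarith)
      (by rw [hnorm _ _ (by linarith) h4]; linarith)
    have g3 := mul_lt_mul_of_pos_right hLL hρ2
    rw [h] at g1
    linarith
  have hφs' := hlt ρ v v' h1 h2 (by linarith) h3 h4 (by nlinarith)
  have hunit : ∀ (y : EuclideanSpace ℝ (Fin N)) (c : ℝ), 0 < c → ‖y‖ = c →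
      ∃ w : EuclideanSpace ℝ (Fin N), ‖w‖ = 1 ∧ y = c • w := by
    intro y c hc hy
    refine ⟨c⁻¹ • y, ?_, ?_⟩
    · rw [norm_smul, hy, Real.norm_eq_abs, abs_of_pos (inv_pos.2 hc), inv_mul_cancel₀ hc.ne']
    · rw [smul_smul, mul_inv_cancel₀ hc.ne', one_smul]
  refine osc_point S h3 h4 hφ hr₁ h1 hρ1 (by linarith) hδ ht ht1 (by linarith)
    (by linarith : 0 < L') (hKr ρ h1 hρ1) hua heq ?_ ?_ ?_
  · intro y hy
    obtain ⟨w, hw, rfl⟩ := hunit y ρ (by linarith) hy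
    have := hmain ρ w v' h1 h2 h5 hw h4
    linarith
  · intro y hy
    obtain ⟨w, hw, rfl⟩ := hunit y (φ ρ) (by linarith) hy
    have := hmain ρ v w h1 h2 h5 h3 hw
    linarith
  · filter_upwards [lt_mem_nhds hρr, gt_mem_nhds hρ1,
      hφc.continuousAt.eventually (gt_mem_nhds hφs')] with τ t1 t2 t3
    have := hmain τ v v' t1.le t2.le t3.le h3 h4
    linarith

lemma osc {f : ℝ → ℝ} {a K : ℝ} {u : EuclideanSpace ℝ (Fin N) → ℝ} (S : Sol f a K u) :
    ∃ r₁ L : ℝ, 0 < r₁ ∧ r₁ < 1 ∧ 0 ≤ L ∧ (∀ x, r₁ ≤ ‖x‖ → ‖x‖ < 1 → a < u x) ∧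
      ∀ x y, r₁ ≤ ‖x‖ → ‖x‖ < 1 → ‖x‖ = ‖y‖ → u x - u y ≤ L * (1 - ‖x‖ ^ 2) := by
  have hNr : (1 : ℝ) ≤ N := by exact_mod_cast S.hN
  have hK0 := S.hK0
  obtain ⟨ra, ha0, ha1, ha⟩ := unif_blow S.hb a
  set η : ℝ := min (1 - ra) (min (1 / (8 * N)) (1 / (2 * K + 2))) with hη
  have hη0 : 0 < η := by
    refine lt_min (by linarith) (lt_min (by positivity) (by positivity))
  have hη1 : η ≤ 1 - ra := min_le_left _ _
  have hη2 : η ≤ 1 / (8 * N) := (min_le_right _ _).trans (min_le_left _ _)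
  have hη3 : η ≤ 1 / (2 * K + 2) := (min_le_right _ _).trans (min_le_right _ _)
  rw [le_div_iff₀ (by positivity)] at hη2 hη3
  set r₁ := 1 - η with hr₁
  have hr₁h : 1 / 2 ≤ r₁ := by nlinarith
  have hua : ∀ x : EuclideanSpace ℝ (Fin N), r₁ ≤ ‖x‖ → ‖x‖ < 1 → a < u x :=
    fun x h1 h2 => ha x (by linarith) h2
  have hr₁2 : 0 < 1 - r₁ ^ 2 := by nlinarith
  obtain ⟨z, -, hz⟩ := (isCompact_closedBall (0 : EuclideanSpace ℝ (Fin N)) r₁).exists_isMaxOn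
    ⟨0, by simp; linarith⟩
    (S.hu.continuousOn.mono (closedBall_subset_ball (by linarith)))
  set L := max 0 ((u z - a) / (1 - r₁ ^ 2)) with hL
  have hLz : u z - a ≤ L * (1 - r₁ ^ 2) := by
    rw [← div_le_iff₀ hr₁2]; exact le_max_right _ _
  refine ⟨r₁, L, by linarith, by linarith, le_max_left _ _, hua, ?_⟩
  intro x y hx hx1 hxy
  set r := ‖x‖ with hr
  have hrp : 0 < r := by linarith
  have hunit : ∀ (y : EuclideanSpace ℝ (Fin N)) (c : ℝ), 0 < c → ‖y‖ = c →
      ∃ w : EuclideanSpace ℝ (Fin N), ‖w‖ = 1 ∧ y = c • w := by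
    intro y c hc hy
    refine ⟨c⁻¹ • y, ?_, ?_⟩
    · rw [norm_smul, hy, Real.norm_eq_abs, abs_of_pos (inv_pos.2 hc), inv_mul_cancel₀ hc.ne']
    · rw [smul_smul, mul_inv_cancel₀ hc.ne', one_smul]
  obtain ⟨e, he, hxe⟩ := hunit x r hrp hr.symm
  obtain ⟨e', he', hye⟩ := hunit y r hrp hxy.symm
  set ψ : ℝ → ℝ := fun t => r + t * (1 - 4 * N * (r - r₁) ^ 2) with hψ
  have hψc : Continuous ψ := by fun_prop
  have hψ0 : ψ 0 = r := by simp [hψ]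
  have hev : ∀ᶠ t in 𝓝[>] (0 : ℝ), u (r • e) - u (ψ t • e') ≤ L * (1 - r ^ 2) := by
    have h1 : ∀ᶠ t in 𝓝[>] (0 : ℝ), ψ t < 1 :=
      nhdsWithin_le_nhds (hψc.continuousAt.eventually (gt_mem_nhds (by rw [hψ0]; exact hx1)))
    filter_upwards [h1, Ioo_mem_nhdsGT one_pos] with t h1 ht
    refine osc_t S (φ := fun r => r + t * (1 - 4 * N * (r - r₁) ^ 2)) rfl hr₁h (by linarith)
      (by simp only [hr₁]; linarith) ht.1 ht.2 (le_max_left _ _) ?_ hua ?_ hx hx1.le h1 he he'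
    · intro ρ g1 g2
      have g3 : 1 - ρ ^ 2 ≤ 2 * η := by nlinarith
      have g4 := mul_le_mul_of_nonneg_left g3 hK0
      nlinarith
    · intro x hx
      have : u x ≤ u z := hz (by rw [mem_closedBall_zero_iff, hx])
      linarith
  have hcont : Tendsto (fun t => u (r • e) - u (ψ t • e')) (𝓝[>] (0 : ℝ))
      (𝓝 (u (r • e) - u (r • e'))) := by
    have hc : ContinuousAt u (r • e') := by
      rw [← hye]; exact (contDiffAt_of S.hu (by rw [← hxy]; exact hx1)).continuousAt
    have : ContinuousAt (fun t => u (ψ t • e')) 0 := by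
      refine ContinuousAt.comp (g := u) ?_ (by fun_prop)
      rw [hψ0]; exact hc
    have h2 := this.tendsto
    rw [hψ0] at h2
    exact (tendsto_const_nhds.sub h2).mono_left nhdsWithin_le_nhds
  rw [hye]
  conv_lhs => rw [hxe]
  exact le_of_tendsto hcont hev

lemma key {f : ℝ → ℝ} {a K : ℝ} {u : EuclideanSpace ℝ (Fin N) → ℝ} (S : Sol f a K u) {ε : ℝ}
    (hε : 0 < ε) : ∃ r₀, 0 < r₀ ∧ r₀ < 1 ∧ ∀ x y : EuclideanSpace ℝ (Fin N), r₀ ≤ ‖x‖ → ‖x‖ < 1 →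
      ‖y‖ ≤ ‖x‖ → u y ≤ u x + ε := by
  obtain ⟨r₁, L, h0, h1, hL, hua, h⟩ := osc S
  set η := min (1 - r₁) (ε / (2 * L + 1)) with hη
  have hη0 : 0 < η := lt_min (by linarith) (by positivity)
  have hη1 : η ≤ 1 - r₁ := min_le_left _ _
  have hη2 : η ≤ ε / (2 * L + 1) := min_le_right _ _
  rw [le_div_iff₀ (by positivity)] at hη2
  refine ⟨1 - η, by linarith, by linarith, ?_⟩
  intro x y hx hx1 hy
  have g3 : 1 - ‖x‖ ^ 2 ≤ 2 * η := by nlinarith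
  have g4 := mul_le_mul_of_nonneg_left g3 hL
  have g5 : L * (1 - ‖x‖ ^ 2) ≤ ε := by linarith
  refine ballmax S.hN S.hf0 S.hu S.hE hx1 ?_ ?_ y hy
  · linarith [hua x (by linarith) hx1]
  · intro z hz
    have := h z x (by linarith) (by linarith) hz
    rw [hz] at this
    linarith

/-- reflection in the hyperplane `⟪x,e⟫ = l` -/
noncomputable def rf (e : EuclideanSpace ℝ (Fin N)) (l : ℝ) (x : EuclideanSpace ℝ (Fin N)) :
    EuclideanSpace ℝ (Fin N) := x + (2 * (l - inner ℝ x e)) • e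

lemma rf_eq {e : EuclideanSpace ℝ (Fin N)} (he : ‖e‖ = 1) :
    ∃ R : EuclideanSpace ℝ (Fin N) ≃ₗᵢ[ℝ] EuclideanSpace ℝ (Fin N),
      ∀ l x, rf e l x = R x + (2 * l) • e := by
  refine ⟨(ℝ ∙ e)ᗮ.reflection, fun l x => ?_⟩
  rw [Submodule.reflection_orthogonal_apply, Submodule.reflection_singleton_apply, he, rf,
    real_inner_comm e x]
  simp only [one_pow, RCLike.ofReal_real_eq_id, id, div_one]
  module

lemma rf_norm {e : EuclideanSpace ℝ (Fin N)} (he : ‖e‖ = 1) (l : ℝ)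
    (x : EuclideanSpace ℝ (Fin N)) :
    ‖rf e l x‖ ^ 2 = ‖x‖ ^ 2 + 4 * l * (l - inner ℝ x e) := by
  rw [rf, norm_add_sq_real, norm_smul, he, inner_smul_right, mul_one, Real.norm_eq_abs, sq_abs]
  ring

lemma rf_le {e : EuclideanSpace ℝ (Fin N)} (he : ‖e‖ = 1) {l : ℝ} (hl : 0 ≤ l)
    {x : EuclideanSpace ℝ (Fin N)} (hx : l ≤ inner ℝ x e) : ‖rf e l x‖ ≤ ‖x‖ := by
  have := rf_norm he l x
  refine (pow_le_pow_iff_left₀ (norm_nonneg _) (norm_nonneg _) two_ne_zero).1 ?_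
  rw [this]; nlinarith

lemma rf_cont (e : EuclideanSpace ℝ (Fin N)) :
    Continuous (fun q : ℝ × EuclideanSpace ℝ (Fin N) => rf e q.1 q.2) := by
  unfold rf; fun_prop

lemma rf_cont' (e : EuclideanSpace ℝ (Fin N)) (l : ℝ) : Continuous (rf e l) := by
  unfold rf; fun_prop

/-- the difference of the reflected solution and the solution -/
noncomputable def wf (u : EuclideanSpace ℝ (Fin N) → ℝ) (e : EuclideanSpace ℝ (Fin N)) (l : ℝ)
    (x : EuclideanSpace ℝ (Fin N)) : ℝ := u (rf e l x) - u x

lemma wf_contAt {u : EuclideanSpace ℝ (Fin N) → ℝ} (hu : ContDiffOn ℝ 2 u (ball 0 1))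
    {e : EuclideanSpace ℝ (Fin N)} (he : ‖e‖ = 1) {l : ℝ} (hl : 0 ≤ l)
    {x : EuclideanSpace ℝ (Fin N)} (hx : ‖x‖ < 1) (hx' : l ≤ inner ℝ x e) :
    ContinuousAt (fun q : ℝ × EuclideanSpace ℝ (Fin N) => wf u e q.1 q.2) (l, x) := by
  have h1 := (contDiffAt_of hu hx).continuousAt
  have h2 := (contDiffAt_of hu ((rf_le he hl hx').trans_lt hx)).continuousAt
  refine ContinuousAt.sub ?_ ?_
  · exact ContinuousAt.comp (g := u) (f := fun q : ℝ × EuclideanSpace ℝ (Fin N) => rf e q.1 q.2)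
      h2 (rf_cont e).continuousAt
  · exact ContinuousAt.comp (g := u) (f := fun q : ℝ × EuclideanSpace ℝ (Fin N) => q.2)
      h1 continuousAt_snd

lemma wf_contAt' {u : EuclideanSpace ℝ (Fin N) → ℝ} (hu : ContDiffOn ℝ 2 u (ball 0 1))
    {e : EuclideanSpace ℝ (Fin N)} (he : ‖e‖ = 1) {l : ℝ} (hl : 0 ≤ l)
    {x : EuclideanSpace ℝ (Fin N)} (hx : ‖x‖ < 1) (hx' : l ≤ inner ℝ x e) :
    ContinuousAt (wf u e l) x :=
  ContinuousAt.comp (f := fun x => (l, x)) (wf_contAt hu he hl hx hx') (by fun_prop)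

lemma wf_hasLap {f : ℝ → ℝ} {a K : ℝ} {u : EuclideanSpace ℝ (Fin N) → ℝ} (S : Sol f a K u)
    {e : EuclideanSpace ℝ (Fin N)} (he : ‖e‖ = 1) {l : ℝ} (hl : 0 ≤ l)
    {x : EuclideanSpace ℝ (Fin N)} (hx : ‖x‖ < 1) (hx' : l ≤ inner ℝ x e) :
    HasLap (wf u e l) x (f (u (rf e l x)) - f (u x)) := by
  have hr := (rf_le he hl hx').trans_lt hx
  obtain ⟨R, hR⟩ := rf_eq he
  have h1 := hasLap_comp (u := u) (x := x) (c := (2 * l) • e) R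
    (by rw [← hR]; exact contDiffAt_of S.hu hr)
  simp only [← hR] at h1
  rw [S.hE _ (by simpa using hr)] at h1
  have h2 := hasLap_lap (contDiffAt_of S.hu hx)
  rw [S.hE _ (by simpa using hx)] at h2
  exact h1.sub h2

lemma thin {f : ℝ → ℝ} {a K : ℝ} {u : EuclideanSpace ℝ (Fin N) → ℝ} (S : Sol f a K u) :
    ∃ ε : ℝ, 0 < ε ∧ ε < 1 ∧ ∀ e : EuclideanSpace ℝ (Fin N), ‖e‖ = 1 → ∀ l, 0 ≤ l →
      (∀ x, ‖x‖ ≤ 1 - ε → l + ε ≤ inner ℝ x e → wf u e l x ≤ 0) →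
      ∀ x, ‖x‖ < 1 → l < inner ℝ x e → wf u e l x ≤ 0 := by
  have hK0 := S.hK0
  have hNr : (1 : ℝ) ≤ N := by exact_mod_cast S.hN
  set β : ℝ := 3 * K + 1 with hβ
  have hβ1 : 1 ≤ β := by linarith
  refine ⟨1 / (4 * β), by positivity, by rw [div_lt_one (by positivity)]; linarith, ?_⟩
  set ε := 1 / (4 * β) with hε
  have hβε : β * ε = 1 / 4 := by rw [hε]; field_simp
  have hε0 : 0 < ε := by positivity
  intro e he l hl hthin x₀ hx₀ hx₀e
  by_contra hcon
  push Not at hcon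
  set φ : EuclideanSpace ℝ (Fin N) → ℝ := fun x => 3 - Real.exp (-β) *
    (Real.exp (-(-β) * ‖x - 0‖ ^ 2) - 0) - Real.exp (-β * (inner ℝ x e - l)) with hφ
  have hφc : Continuous φ := by fun_prop
  have hφ1 : ∀ x, ‖x‖ < 1 → l ≤ inner ℝ x e → 1 ≤ φ x := by
    intro x h1 h2
    have g1 : Real.exp (-β) * (Real.exp (-(-β) * ‖x - 0‖ ^ 2) - 0) ≤ 1 := by
      rw [sub_zero, ← Real.exp_add, Real.exp_le_one_iff, sub_zero]
      have : ‖x‖ ^ 2 ≤ 1 := by nlinarith [norm_nonneg x]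
      nlinarith
    have g2 : Real.exp (-β * (inner ℝ x e - l)) ≤ 1 := by
      rw [Real.exp_le_one_iff]; nlinarith
    simp only [hφ]; linarith
  have hφ3 : ∀ x, φ x ≤ 3 := by
    intro x
    have g1 : 0 ≤ Real.exp (-β) * (Real.exp (-(-β) * ‖x - 0‖ ^ 2) - 0) := by
      rw [sub_zero]; positivity
    have g2 := Real.exp_pos (-β * (inner ℝ x e - l))
    simp only [hφ]; linarith
  have hφL : ∀ x, ‖x‖ < 1 → l ≤ inner ℝ x e → (1 - ε < ‖x‖ ∨ inner ℝ x e < l + ε) →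
      ∃ ℓ, HasLap φ x ℓ ∧ ℓ < -3 * K := by
    intro x h1 h2 h3
    have c1 : ∀ s : ℝ, HasDerivAt (fun s => Real.exp (-β * (s - l)))
        (-β * Real.exp (-β * (s - l))) s := by
      intro s
      have := (((hasDerivAt_id s).sub_const l).const_mul (-β)).exp
      refine HasDerivAt.congr_deriv this ?_
      simp [mul_comm]
    have L1 := ((HasLap.const 3 x).sub ((hasLap_exp (-β) 0 0 x).const_mul (Real.exp (-β)))).sub
      (hasLap_coord c1 (fun s => (c1 s).const_mul (-β)) e x)
    refine ⟨_, L1, ?_⟩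
    rw [he, sub_zero]
    have p1 : 0 ≤ β ^ 2 * Real.exp (-β * (inner ℝ x e - l)) := by positivity
    have p2 : (2 * β) * Real.exp (β * (‖x‖ ^ 2 - 1)) ≤ Real.exp (-β) * ((4 * (-β) ^ 2 * ‖x‖ ^ 2 - 2 * N * (-β)) *
        Real.exp (-(-β) * ‖x‖ ^ 2)) := by
      have : Real.exp (β * (‖x‖ ^ 2 - 1)) = Real.exp (-β) * Real.exp (-(-β) * ‖x‖ ^ 2) := by
        rw [← Real.exp_add]; congr 1; ring
      have h4 : 2 * β ≤ (4 * (-β) ^ 2 * ‖x‖ ^ 2 - 2 * N * (-β)) := by nlinarith [sq_nonneg (β * ‖x‖)]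
      have h5 := mul_le_mul_of_nonneg_right h4 (Real.exp_pos (β * (‖x‖ ^ 2 - 1))).le
      rw [this] at h5 ⊢
      linarith
    have p3 : 0 < (2 * β) * Real.exp (β * (‖x‖ ^ 2 - 1)) := by positivity
    rcases h3 with h3 | h3
    · have h4 : -(2 * ε) ≤ ‖x‖ ^ 2 - 1 := by nlinarith [norm_nonneg x]
      have h5 := Real.add_one_le_exp (β * (‖x‖ ^ 2 - 1))
      have h6 : 1 / 2 ≤ Real.exp (β * (‖x‖ ^ 2 - 1)) := by nlinarith
      have h7 : (2 * β) * (1 / 2) ≤ (2 * β) * Real.exp (β * (‖x‖ ^ 2 - 1)) := by gcongr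
      nlinarith
    · have h5 := Real.add_one_le_exp (-β * (inner ℝ x e - l))
      have h6 : 1 / 2 ≤ Real.exp (-β * (inner ℝ x e - l)) := by nlinarith
      have h7 : β ^ 2 * (1 / 2) ≤ β ^ 2 * Real.exp (-β * (inner ℝ x e - l)) := by gcongr
      have h8 : 3 * K < β ^ 2 * (1 / 2) := by rw [hβ]; nlinarith
      nlinarith
  set M₀ := wf u e l x₀ / φ x₀ with hM₀
  have hφx₀ := hφ1 x₀ hx₀ hx₀e.le
  have hM₀p : 0 < M₀ := div_pos hcon (by linarith)
  obtain ⟨r₀, hr₀, hr₀1, hkey⟩ := key S (half_pos hM₀p)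
  have hnear : ∀ x, ‖x‖ < 1 → l ≤ inner ℝ x e → M₀ ≤ wf u e l x → ‖x‖ < r₀ := by
    intro x h1 h2 h3
    by_contra hc
    push Not at hc
    have := hkey x (rf e l x) hc h1 (rf_le he hl h2)
    simp only [wf] at h3
    linarith
  set T : Set (EuclideanSpace ℝ (Fin N)) := closedBall 0 r₀ ∩ {x | l ≤ inner ℝ x e}
  have hT : IsCompact T :=
    (isCompact_closedBall _ _).inter_right (isClosed_le continuous_const (by fun_prop))
  have hTx₀ : x₀ ∈ T := by
    refine ⟨?_, hx₀e.le⟩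
    rw [mem_closedBall_zero_iff]
    refine (hnear x₀ hx₀ hx₀e.le ?_).le
    rw [hM₀, div_le_iff₀ (by linarith)]
    nlinarith
  have hcT : ContinuousOn (fun x => wf u e l x / φ x) T := by
    intro x hx
    have h1 : ‖x‖ < 1 := (mem_closedBall_zero_iff.1 hx.1).trans_lt hr₀1
    refine ContinuousAt.continuousWithinAt (ContinuousAt.div (wf_contAt' S.hu he hl h1 hx.2)
      hφc.continuousAt ?_)
    linarith [hφ1 x h1 hx.2]
  obtain ⟨z, hzT, hzm⟩ := hT.exists_isMaxOn ⟨x₀, hTx₀⟩ hcT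
  have hzm' := isMaxOn_iff.1 hzm
  set M := wf u e l z / φ z with hM
  have hMM : M₀ ≤ M := hzm' x₀ hTx₀
  have hz1 : ‖z‖ < 1 := (mem_closedBall_zero_iff.1 hzT.1).trans_lt hr₀1
  have hze : l ≤ inner ℝ z e := hzT.2
  have hφz := hφ1 z hz1 hze
  have hwz : wf u e l z = M * φ z := by rw [hM]; field_simp
  have hwzM : M ≤ wf u e l z := by rw [hwz]; nlinarith
  have hzr : ‖z‖ < r₀ := hnear z hz1 hze (by linarith)
  have hze' : l < inner ℝ z e := by
    refine lt_of_le_of_ne hze fun h => ?_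
    have : wf u e l z = 0 := by simp [wf, rf, ← h]
    linarith
  have hthinz : 1 - ε < ‖z‖ ∨ inner ℝ z e < l + ε := by
    by_contra hc
    push Not at hc
    have := hthin z hc.1 hc.2
    linarith
  obtain ⟨ℓ, hℓ, hℓ3⟩ := hφL z hz1 hze hthinz
  have hlm : IsLocalMax (fun x => wf u e l x - M * φ x) z := by
    have o1 : ∀ᶠ x : EuclideanSpace ℝ (Fin N) in 𝓝 z, ‖x‖ < r₀ :=
      continuous_norm.continuousAt.eventually (gt_mem_nhds hzr)
    have o2 : ∀ᶠ x : EuclideanSpace ℝ (Fin N) in 𝓝 z, l < inner ℝ x e :=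
      (show Continuous fun x : EuclideanSpace ℝ (Fin N) => (inner ℝ x e : ℝ) by
        fun_prop).continuousAt.eventually (lt_mem_nhds hze')
    filter_upwards [o1, o2] with x h1 h2
    have h3 := hzm' x ⟨mem_closedBall_zero_iff.2 h1.le, h2.le⟩
    have h4 := hφ1 x (h1.trans hr₀1) h2.le
    change wf u e l x / φ x ≤ M at h3
    rw [div_le_iff₀ (by linarith)] at h3
    rw [hwz]; linarith
  have h5 := ((wf_hasLap S he hl hz1 hze).sub (hℓ.const_mul M)).max hlm
  have h6 := S.hK (u z) (u (rf e l z)) (by simp only [wf] at hwzM; linarith)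
  have h7 : u (rf e l z) - u z = M * φ z := hwz
  rw [h7] at h6
  have hMp : 0 < M := by linarith
  have h8 : K * (M * φ z) ≤ K * (M * 3) := by have := hφ3 z; gcongr
  have h9 := mul_lt_mul_of_pos_left hℓ3 hMp
  nlinarith

lemma f_lip {f : ℝ → ℝ} (hf : ContDiff ℝ 1 f) (A B : ℝ) :
    ∃ Λ : ℝ, 0 ≤ Λ ∧ ∀ s ∈ Icc A B, ∀ t ∈ Icc A B, s ≤ t → f t - f s ≤ Λ * (t - s) := by
  have hc : Continuous (deriv f) := hf.continuous_deriv (by norm_num)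
  obtain ⟨C, hC⟩ := (isCompact_Icc (a := A) (b := B)).exists_bound_of_continuousOn hc.continuousOn
  refine ⟨max C 0, le_max_right _ _, ?_⟩
  refine (convex_Icc A B).image_sub_le_mul_sub_of_deriv_le hf.continuous.continuousOn
    ((hf.differentiable (by norm_num)).differentiableOn) ?_
  intro x hx
  exact ((le_abs_self _).trans (hC x (interior_subset hx))).trans (le_max_left _ _)

lemma wf_lap {f : ℝ → ℝ} {a K : ℝ} {u : EuclideanSpace ℝ (Fin N) → ℝ} (S : Sol f a K u)
    {e : EuclideanSpace ℝ (Fin N)} (he : ‖e‖ = 1) {l : ℝ} (hl : 0 ≤ l) {ρ : ℝ} (hρ : ρ < 1) :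
    ∃ Λ : ℝ, 0 ≤ Λ ∧ ∀ x, ‖x‖ ≤ ρ → l ≤ inner ℝ x e → wf u e l x ≤ 0 →
      ∃ ℓ, HasLap (wf u e l) x ℓ ∧ Λ * wf u e l x ≤ ℓ := by
  obtain ⟨C, hC⟩ := (isCompact_closedBall (0 : EuclideanSpace ℝ (Fin N)) ρ).exists_bound_of_continuousOn
    (S.hu.continuousOn.mono (closedBall_subset_ball hρ))
  obtain ⟨Λ, hΛ, h⟩ := f_lip S.hf (-C) C
  refine ⟨Λ, hΛ, fun x hx hxe hw => ⟨_, wf_hasLap S he hl (hx.trans_lt hρ) hxe, ?_⟩⟩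
  have h1 := abs_le.1 (hC x (by simpa using hx))
  have h2 := abs_le.1 (hC (rf e l x) (by simpa using (rf_le he hl hxe).trans hx))
  simp only [wf] at hw ⊢
  have := h _ h2 _ h1 (by linarith)
  linarith

lemma wf_hasFDerivAt {u : EuclideanSpace ℝ (Fin N) → ℝ} (hu : ContDiffOn ℝ 2 u (ball 0 1))
    {e : EuclideanSpace ℝ (Fin N)} (he : ‖e‖ = 1) {l : ℝ} (hl : 0 ≤ l)
    {x : EuclideanSpace ℝ (Fin N)} (hx : ‖x‖ < 1) (hx' : l ≤ inner ℝ x e) :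
    ∃ w' : EuclideanSpace ℝ (Fin N) →L[ℝ] ℝ, HasFDerivAt (wf u e l) w' x ∧
      w' e = - fderiv ℝ u (rf e l x) e - fderiv ℝ u x e := by
  obtain ⟨R, hR⟩ := rf_eq he
  have h1 := ((contDiffAt_of hu hx).differentiableAt (by norm_num)).hasFDerivAt
  have h2 := ((contDiffAt_of hu ((rf_le he hl hx').trans_lt hx)).differentiableAt
    (by norm_num)).hasFDerivAt
  have h3 : HasFDerivAt (rf e l) (R.toContinuousLinearEquiv :
      EuclideanSpace ℝ (Fin N) →L[ℝ] EuclideanSpace ℝ (Fin N)) x := by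
    have : rf e l = fun x => R x + (2 * l) • e := by funext x; exact hR l x
    rw [this]
    exact (R.toContinuousLinearEquiv.hasFDerivAt).add_const _
  refine ⟨_, (h2.comp x h3).sub h1, ?_⟩
  have hRe : R e = -e := by
    have := hR 0 e
    simp only [rf, mul_zero, zero_smul, add_zero, real_inner_self_eq_norm_sq, he] at this
    rw [← this]; module
  simp [hRe]

lemma smp {f : ℝ → ℝ} {a K : ℝ} {u : EuclideanSpace ℝ (Fin N) → ℝ} (S : Sol f a K u)
    {e : EuclideanSpace ℝ (Fin N)} (he : ‖e‖ = 1) {l : ℝ} (hl : 0 < l) (hl1 : l < 1)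
    (hw : ∀ x, ‖x‖ < 1 → l < inner ℝ x e → wf u e l x ≤ 0) :
    ∀ x, ‖x‖ < 1 → l < inner ℝ x e → wf u e l x < 0 := by
  set Sg : Set (EuclideanSpace ℝ (Fin N)) := ball 0 1 ∩ {x | l < inner ℝ x e} with hSg
  have hopen : IsOpen Sg := isOpen_ball.inter (isOpen_lt continuous_const (by fun_prop))
  have hconv : Convex ℝ Sg := by
    refine (convex_ball _ _).inter ?_
    have : {x : EuclideanSpace ℝ (Fin N) | l < inner ℝ x e} =
        {x | l < (innerSL ℝ e : EuclideanSpace ℝ (Fin N) → ℝ) x} := by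
      ext x; simp [real_inner_comm]
    rw [this]
    exact convex_halfSpace_gt (innerSL ℝ e).toLinearMap.isLinear l
  have hcont : ContinuousOn (wf u e l) Sg := fun x hx =>
    (wf_contAt' S.hu he hl.le (by simpa using hx.1) (le_of_lt hx.2)).continuousWithinAt
  set A : Set (EuclideanSpace ℝ (Fin N)) := Sg ∩ wf u e l ⁻¹' Iio 0 with hA
  have hAo : IsOpen A := hcont.isOpen_inter_preimage hopen isOpen_Iio
  suffices h : Sg ⊆ A by
    intro x h1 h2
    exact (h ⟨by simpa using h1, h2⟩).2
  refine hconv.isPreconnected.subset_of_closure_inter_subset hAo ?_ ?_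
  · set ρ := max |2 * l - 1| l with hρ
    have hρ1 : ρ < 1 := by
      refine max_lt ?_ hl1
      rw [abs_lt]; constructor <;> linarith
    obtain ⟨z, -, hz⟩ := (isCompact_closedBall (0 : EuclideanSpace ℝ (Fin N)) ρ).exists_isMaxOn
      ⟨0, by simp [hρ]⟩
      (S.hu.continuousOn.mono (closedBall_subset_ball hρ1))
    obtain ⟨r₀, hr0, hr1, hr⟩ := unif_blow S.hb (u z)
    set s := max r₀ ((1 + l) / 2) with hs
    have hs1 : s < 1 := max_lt hr1 (by linarith)
    have hs2 : r₀ ≤ s := le_max_left _ _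
    have hs3 : (1 + l) / 2 ≤ s := le_max_right _ _
    have hsn : ‖s • e‖ = s := by
      rw [norm_smul, he, mul_one, Real.norm_eq_abs, abs_of_pos (by linarith)]
    have hse : inner ℝ (s • e) e = s := by
      rw [inner_smul_left, real_inner_self_eq_norm_sq, he]; simp
    have hmem : s • e ∈ Sg :=
      ⟨by rw [mem_ball_zero_iff, hsn]; exact hs1, show l < inner ℝ (s • e) e by rw [hse]; linarith⟩
    refine ⟨s • e, hmem, hmem, ?_⟩
    have h1 := hr (s • e) (by rw [hsn]; exact hs2) (by rw [hsn]; exact hs1)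
    have h2 : u (rf e l (s • e)) ≤ u z := by
      apply hz
      rw [mem_closedBall_zero_iff, rf, hse, ← add_smul, norm_smul, he, mul_one, Real.norm_eq_abs,
        abs_le]
      have k1 : |2 * l - 1| ≤ ρ := le_max_left _ _
      have k2 : l ≤ ρ := le_max_right _ _
      have := (abs_le.1 k1).1
      constructor <;> linarith
    change wf u e l (s • e) < 0
    simp only [wf]; linarith
  · rintro q ⟨hqA, hqS⟩
    refine ⟨hqS, ?_⟩
    have hq1 : ‖q‖ < 1 := by simpa using hqS.1
    have hq0 := hw q hq1 hqS.2
    by_contra hne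
    have hq0 : wf u e l q = 0 := le_antisymm hq0 (not_lt.1 hne)
    set ρ := (1 + ‖q‖) / 2 with hρ
    obtain ⟨Λ, hΛ, hlap⟩ := wf_lap S he hl.le (show ρ < 1 by linarith)
    have hnb : ball 0 ρ ∩ Sg ∈ 𝓝 q :=
      (isOpen_ball.inter hopen).mem_nhds ⟨by rw [mem_ball_zero_iff]; linarith, hqS⟩
    obtain ⟨δ, hδ, hδs⟩ := Metric.mem_nhds_iff.1 hnb
    obtain ⟨p, hpA, hpq⟩ := Metric.mem_closure_iff.1 hqA (δ / 4) (by linarith)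
    have hsub : closedBall p (δ / 2) ⊆ ball 0 ρ ∩ Sg := by
      refine Subset.trans ?_ hδs
      intro x hx
      have h1 : dist x p ≤ δ / 2 := hx
      have h2 := dist_triangle x p q
      rw [dist_comm p q] at h2
      rw [mem_ball]; linarith
    set Z := closedBall p (δ / 2) ∩ wf u e l ⁻¹' {0} with hZ
    have hZc : IsCompact Z :=
      (isCompact_closedBall p (δ / 2)).of_isClosed_subset
        ((hcont.mono (hsub.trans inter_subset_right)).preimage_isClosed_of_isClosed
          isClosed_closedBall isClosed_singleton) inter_subset_left
    have hqZ : q ∈ Z := ⟨by rw [mem_closedBall]; linarith, hq0⟩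
    obtain ⟨y, hyZ, hy⟩ := hZc.exists_infDist_eq_dist ⟨q, hqZ⟩ p
    have hyq : dist p y ≤ δ / 4 := by
      rw [← hy]
      refine (infDist_le_dist_of_mem hqZ).trans ?_
      rw [dist_comm]; exact hpq.le
    have hyS := hsub hyZ.1
    have hy1 : ‖y‖ < 1 := by simpa using hyS.2.1
    have hwy : wf u e l y = 0 := hyZ.2
    have hR : 0 < dist p y := by
      rw [dist_pos]
      rintro rfl
      have : wf u e l p < 0 := hpA.2
      linarith
    have hsub2 : closedBall p (dist p y) ⊆ closedBall p (δ / 2) :=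
      closedBall_subset_closedBall (by linarith)
    obtain ⟨w', hw', -⟩ := wf_hasFDerivAt S.hu he hl.le hy1 (le_of_lt hyS.2.2)
    have hneg : ∀ x ∈ ball p (dist p y), wf u e l x < 0 := by
      intro x hx
      have hxs := hsub (hsub2 (ball_subset_closedBall hx))
      refine lt_of_le_of_ne (hw x (by simpa using hxs.2.1) hxs.2.2) fun h0 => ?_
      have : infDist p Z ≤ dist p x :=
        infDist_le_dist_of_mem ⟨hsub2 (ball_subset_closedBall hx), h0⟩
      rw [mem_ball, dist_comm] at hx
      linarith
    have hh := hopf (w := wf u e l) (p := p) (y := y) hR hΛ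
      (hcont.mono (hsub2.trans (hsub.trans inter_subset_right))) hneg
      (by rw [← dist_eq_norm, dist_comm]) hwy
      (fun x hx => by
        have hxs := hsub (hsub2 (ball_subset_closedBall hx))
        refine hlap x ?_ (le_of_lt hxs.2.2) (hneg x hx).le
        have := hxs.1
        rw [mem_ball_zero_iff] at this
        exact this.le) hw'
    have hlm : IsLocalMax (wf u e l) y := by
      filter_upwards [hopen.mem_nhds hyS.2] with x hx
      rw [hwy]
      exact hw x (by simpa using hx.1) hx.2
    rw [hlm.hasFDerivAt_eq_zero hw'] at hh
    simp at hh

lemma wf_right_lim {u : EuclideanSpace ℝ (Fin N) → ℝ} (hu : ContDiffOn ℝ 2 u (ball 0 1))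
    {e : EuclideanSpace ℝ (Fin N)} (he : ‖e‖ = 1) {l : ℝ} (hl : 0 ≤ l) (hl1 : l < 1)
    (h : ∀ m, l < m → m < 1 → ∀ x, ‖x‖ < 1 → m < inner ℝ x e → wf u e m x ≤ 0) :
    ∀ x, ‖x‖ < 1 → l < inner ℝ x e → wf u e l x ≤ 0 := by
  intro x hx hxe
  have hc : ContinuousAt (fun m => wf u e m x) l :=
    ContinuousAt.comp (f := fun m : ℝ => (m, x)) (wf_contAt hu he hl hx hxe.le) (by fun_prop)
  refine le_of_tendsto (hc.tendsto.mono_left nhdsWithin_le_nhds : Tendsto _ (𝓝[>] l) _) ?_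
  filter_upwards [Ioo_mem_nhdsGT hl1, Ioo_mem_nhdsGT hxe] with m h1 h2
  exact h m h1.1 h1.2 x hx h2.2

lemma moving {f : ℝ → ℝ} {a K : ℝ} {u : EuclideanSpace ℝ (Fin N) → ℝ} (S : Sol f a K u)
    {e : EuclideanSpace ℝ (Fin N)} (he : ‖e‖ = 1) :
    ∀ l, 0 < l → l < 1 → ∀ x, ‖x‖ < 1 → l < inner ℝ x e → wf u e l x ≤ 0 := by
  obtain ⟨ε, hε, hε1, hthin⟩ := thin S
  have hthin := hthin e he
  by_contra hcon
  set P : ℝ → Prop := fun l => ∀ x, ‖x‖ < 1 → l < inner ℝ x e → wf u e l x ≤ 0 with hP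
  set B : Set ℝ := {l | 0 < l ∧ l < 1 ∧ ¬ P l} with hB
  have hBne : B.Nonempty := by
    push Not at hcon
    obtain ⟨l, h1, h2, x, h3, h4, h5⟩ := hcon
    exact ⟨l, h1, h2, fun h => absurd (h x h3 h4) (not_le.2 h5)⟩
  have hBb : ∀ l ∈ B, l ≤ 1 - ε := by
    rintro l ⟨h1, h2, h3⟩
    by_contra hc
    push Not at hc
    refine h3 (hthin l h1.le ?_)
    intro x g1 g2
    have : inner ℝ x e ≤ ‖x‖ * ‖e‖ := real_inner_le_norm x e
    rw [he] at this
    linarith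
  have hBdd : BddAbove B := ⟨1 - ε, hBb⟩
  set l₀ := sSup B with hl₀
  have h0 : 0 < l₀ := by
    obtain ⟨l, hl⟩ := hBne
    exact lt_of_lt_of_le hl.1 (le_csSup hBdd hl)
  have h1 : l₀ ≤ 1 - ε := csSup_le hBne hBb
  have hup : ∀ m, l₀ < m → m < 1 → P m := by
    intro m g1 g2
    by_contra hc
    exact absurd (le_csSup hBdd (show m ∈ B from ⟨h0.trans g1, g2, hc⟩)) (not_le.2 g1)
  have hP0 : P l₀ := wf_right_lim S.hu he h0.le (by linarith) hup
  have hs := smp S he h0 (by linarith) hP0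
  set T : Set (EuclideanSpace ℝ (Fin N)) :=
    closedBall 0 (1 - ε) ∩ {x | l₀ + ε / 2 ≤ inner ℝ x e} with hTd
  have hT : IsCompact T :=
    (isCompact_closedBall _ _).inter_right (isClosed_le continuous_const (by fun_prop))
  have hev : ∀ᶠ m in 𝓝 l₀, ∀ x ∈ T, wf u e m x < 0 := by
    refine hT.eventually_forall_of_forall_eventually ?_
    rintro x ⟨hx1, hx2⟩
    have hx1 : ‖x‖ < 1 := by
      rw [mem_closedBall_zero_iff] at hx1; linarith
    have hx2 : l₀ + ε / 2 ≤ inner ℝ x e := hx2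
    exact (wf_contAt S.hu he h0.le hx1 (by linarith)).eventually
      (gt_mem_nhds (hs x hx1 (by linarith)))
  obtain ⟨δ, hδ, hδs⟩ := Metric.eventually_nhds_iff.1 hev
  obtain ⟨m, hmB, hm⟩ := exists_lt_of_lt_csSup hBne
    (show l₀ - min δ (ε / 2) < sSup B by
      have : 0 < min δ (ε / 2) := lt_min hδ (by linarith)
      linarith)
  have hm2 : m ≤ l₀ := le_csSup hBdd hmB
  have k1 : min δ (ε / 2) ≤ δ := min_le_left _ _
  have k2 : min δ (ε / 2) ≤ ε / 2 := min_le_right _ _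
  refine hmB.2.2 (hthin m hmB.1.le ?_)
  intro x g1 g2
  refine (hδs (y := m) ?_ x ⟨by rw [mem_closedBall_zero_iff]; exact g1,
    show l₀ + ε / 2 ≤ inner ℝ x e by linarith⟩).le
  rw [Real.dist_eq, abs_lt]
  constructor <;> linarith

lemma sym_le {f : ℝ → ℝ} {a K : ℝ} {u : EuclideanSpace ℝ (Fin N) → ℝ} (S : Sol f a K u)
    {x y : EuclideanSpace ℝ (Fin N)} (hx : ‖x‖ < 1) (hxy : ‖x‖ = ‖y‖) : u y ≤ u x := by
  rcases eq_or_ne x y with h | h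
  · rw [h]
  have hd : 0 < ‖x - y‖ := norm_pos_iff.2 (sub_ne_zero.2 h)
  set e := ‖x - y‖⁻¹ • (x - y) with he'
  have he : ‖e‖ = 1 := by
    rw [he', norm_smul, Real.norm_eq_abs, abs_of_pos (inv_pos.2 hd), inv_mul_cancel₀ hd.ne']
  have hin : inner ℝ x (x - y) = ‖x - y‖ ^ 2 / 2 := by
    rw [norm_sub_sq_real, ← hxy, inner_sub_right, real_inner_self_eq_norm_sq]; ring
  have hxe : inner ℝ x e = ‖x - y‖ / 2 := by
    rw [he', inner_smul_right, hin]; field_simp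
  have h0 := wf_right_lim S.hu he le_rfl one_pos (fun m h1 h2 => moving S he m h1 h2) x hx
    (by rw [hxe]; positivity)
  have hrf : rf e 0 x = y := by
    rw [rf, hxe, he', smul_smul]
    have : 2 * (0 - ‖x - y‖ / 2) * ‖x - y‖⁻¹ = -1 := by field_simp; ring
    rw [this]; module
  simp only [wf, hrf] at h0
  linarith

lemma radial_pos {f : ℝ → ℝ} {a K : ℝ} {u : EuclideanSpace ℝ (Fin N) → ℝ} (S : Sol f a K u)
    {x : EuclideanSpace ℝ (Fin N)} (hx : ‖x‖ < 1) (hx0 : x ≠ 0) : 0 < fderiv ℝ u x x / ‖x‖ := by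
  have hl : 0 < ‖x‖ := norm_pos_iff.2 hx0
  set l := ‖x‖ with hld
  set e := l⁻¹ • x with hed
  have he : ‖e‖ = 1 := by
    rw [hed, norm_smul, Real.norm_eq_abs, abs_of_pos (inv_pos.2 hl), ← hld, inv_mul_cancel₀ hl.ne']
  have hxe : inner ℝ x e = l := by
    rw [hed, inner_smul_right, real_inner_self_eq_norm_sq, ← hld]; field_simp
  have hs := smp S he hl hx (moving S he l hl hx)
  set R := (1 - l) / 4 with hR
  have hR0 : 0 < R := by linarith
  set p := x + R • e with hp
  have hpn : ‖p‖ ≤ l + R := by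
    refine (norm_add_le _ _).trans ?_
    rw [norm_smul, he, mul_one, Real.norm_eq_abs, abs_of_pos hR0]
  have hpe : inner ℝ p e = l + R := by
    rw [hp, inner_add_left, hxe, inner_smul_left, real_inner_self_eq_norm_sq, he]; simp
  have hyn : ∀ y ∈ closedBall p R, ‖y‖ ≤ (1 + l) / 2 := by
    intro y hy
    rw [mem_closedBall, dist_eq_norm] at hy
    have : ‖y‖ ≤ ‖y - p‖ + ‖p‖ := by simpa using norm_add_le (y - p) p
    linarith
  have hye : ∀ y, l + R - ‖y - p‖ ≤ inner ℝ y e := by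
    intro y
    have h1 : inner ℝ (p - y) e ≤ ‖p - y‖ * ‖e‖ := real_inner_le_norm _ _
    rw [inner_sub_left, hpe, he, mul_one, norm_sub_rev] at h1
    linarith
  obtain ⟨Λ, hΛ, hlap⟩ := wf_lap S he hl.le (show (1 + l) / 2 < 1 by linarith)
  obtain ⟨w', hw', hw'e⟩ := wf_hasFDerivAt S.hu he hl.le hx hxe.ge
  have hrf : rf e l x = x := by simp [rf, hxe]
  have hneg : ∀ y ∈ ball p R, wf u e l y < 0 := by
    intro y hy
    have h1 := hyn y (ball_subset_closedBall hy)
    rw [mem_ball, dist_eq_norm] at hy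
    exact hs y (by linarith) (by linarith [hye y])
  have hh := hopf (w := wf u e l) (p := p) (y := x) hR0 hΛ
    (fun y hy => by
      have h1 := hyn y hy
      rw [mem_closedBall, dist_eq_norm] at hy
      exact (wf_contAt' S.hu he hl.le (by linarith) (by linarith [hye y])).continuousWithinAt)
    hneg
    (by rw [hp, sub_add_cancel_left, norm_neg, norm_smul, he, mul_one, Real.norm_eq_abs,
          abs_of_pos hR0])
    (by simp [wf, hrf])
    (fun y hy => by
      have h1 := hyn y (ball_subset_closedBall hy)
      have h2 := hneg y hy
      rw [mem_ball, dist_eq_norm] at hy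
      exact hlap y h1 (by linarith [hye y]) h2.le) hw'
  rw [hp, add_sub_cancel_left, map_smul, hw'e, hrf, smul_eq_mul] at hh
  have h3 : 0 < fderiv ℝ u x e := by
    by_contra hc
    push Not at hc
    nlinarith
  rw [hed, map_smul, smul_eq_mul] at h3
  rw [div_eq_inv_mul]
  exact h3

end BU

theorem statement4 {N : ℕ} (hN : 1 ≤ N) (f : ℝ → ℝ) (hf : ContDiff ℝ 1 f)
    -- condition (2)
    (a : ℝ) (ha : 0 < f a) (hf0 : ∀ t > a, 0 ≤ f t)
    (F : ℝ → ℝ) (hF : ∀ t, F t = ∫ s in a..t, f s)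
    -- condition (3): Keller-Osserman
    (hKO : ∃ T, (∀ t ≥ T, 0 < F t) ∧
      IntegrableOn (fun t => (Real.sqrt (F t))⁻¹) (Ici T))
    -- f is increasing up to a linear perturbation
    (ftil : ℝ → ℝ) (K : ℝ) (hmono : Monotone ftil)
    (hdecomp : ∀ t, f t = ftil t - K * t)
    (u : EuclideanSpace ℝ (Fin N) → ℝ) (hu : IsBlowUp f u) :
    -- u is radially symmetric
    (∀ x ∈ ball (0 : EuclideanSpace ℝ (Fin N)) 1,
      ∀ y ∈ ball (0 : EuclideanSpace ℝ (Fin N)) 1, ‖x‖ = ‖y‖ → u x = u y) ∧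
    -- and its radial derivative ∂u/∂r = ∇u(x)·x/|x| is positive away from the origin
    ∀ x ∈ ball (0 : EuclideanSpace ℝ (Fin N)) 1, x ≠ 0 →
      0 < fderiv ℝ u x x / ‖x‖ := by
  have hfK : ∀ s t, s ≤ t → -|K| * (t - s) ≤ f t - f s := by
    intro s t hst
    rw [hdecomp t, hdecomp s]
    have h1 := hmono hst
    have h2 : K * (t - s) ≤ |K| * (t - s) :=
      mul_le_mul_of_nonneg_right (le_abs_self K) (by linarith)
    linarith
  have S : BU.Sol f a |K| u := ⟨hN, hf, hf0, abs_nonneg K, hfK, hu.1, hu.2.1, hu.2.2⟩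
  refine ⟨?_, ?_⟩
  · intro x hx y hy hxy
    rw [mem_ball_zero_iff] at hx hy
    exact le_antisymm (BU.sym_le S hy hxy.symm) (BU.sym_le S hx hxy)
  · intro x hx hx0
    rw [mem_ball_zero_iff] at hx
    exact BU.radial_pos S hx hx0
end

section
/- Let N ≥ 1 and let f ∈ C¹(ℝ) satisfy conditions (2) and (3). For U₀ ∈ ℝ set I = [U₀, +∞), v₀(u) = √(2F(u)) for u ∈ I, and let 𝒳 = {v ∈ C(I;ℝ) : ∃ M > 0, |v| ≤ M v₀} with norm ‖v‖ = sup_I |v/v₀|. For v in the closed ball B(v₀, ρ) ⊂ 𝒳 and u ∈ I, define r(u,v) = 1 − ∫_u^{+∞} dt/v(t). Then, if U₀ is chosen sufficiently large, there exists ρ ∈ (0,1) such that the integral equation v(u) = √(2(F(u) − (N−1) ∫_{U₀}^u v(t)/r(t, v) dt)), u ∈ I, has exactly one solution v in B(v₀, ρ). -/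
open MeasureTheory Filter Metric Set Topology

/-- `v` lies in the closed ball `B(v₀, ρ)` of the Banach space `𝒳` (where
`v₀ = √(2F)` and the norm is `sup |v/v₀|` over `[U₀, ∞)`) and solves the
integral equation `v(u) = √(2(F(u) − (N−1) ∫_{U₀}^u v(t)/r(t,v) dt))`,
with `r(t,v) = 1 − ∫_t^∞ ds/v(s)`. -/
def SolvesIntEq (N : ℕ) (F : ℝ → ℝ) (U₀ ρ : ℝ) (v : ℝ → ℝ) : Prop :=
  ContinuousOn v (Set.Ici U₀) ∧
  (∀ u ∈ Set.Ici U₀, |v u - Real.sqrt (2 * F u)| ≤ ρ * Real.sqrt (2 * F u)) ∧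
  ∀ u ∈ Set.Ici U₀, v u = Real.sqrt (2 * (F u - (N - 1 : ℝ) *
    ∫ t in U₀..u, v t / (1 - ∫ s in Set.Ici t, (v s)⁻¹)))


structure KOSetup (n : ℝ) (P : ℝ → ℝ) (U e : ℝ) : Prop where
  hn : 0 ≤ n
  cont : ContinuousOn P (Ici U)
  pos : ∀ u ∈ Ici U, 0 < P u
  mono : MonotoneOn P (Ici U)
  int : IntegrableOn (fun t => (P t)⁻¹) (Ici U)
  eps : ∫ t in Ici U, (P t)⁻¹ ≤ e
  e4 : e ≤ 1 / 4
  en : 32 * (n * e) ≤ 1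

structure KOBall (P : ℝ → ℝ) (U : ℝ) (v : ℝ → ℝ) : Prop where
  cont : ContinuousOn v (Ici U)
  lo : ∀ u ∈ Ici U, P u / 2 ≤ v u
  hi : ∀ u ∈ Ici U, v u ≤ 3 / 2 * P u

noncomputable def koR (v : ℝ → ℝ) (t : ℝ) : ℝ := 1 - ∫ s in Set.Ici t, (v s)⁻¹

noncomputable def koK (n : ℝ) (P : ℝ → ℝ) (U : ℝ) (v : ℝ → ℝ) (u : ℝ) : ℝ :=
  Real.sqrt (P u ^ 2 - 2 * (n * ∫ t in U..u, v t / koR v t))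

lemma ko_primitive {q : ℝ → ℝ} {U : ℝ} (hq : ContinuousOn q (Ici U)) :
    ContinuousOn (fun u => ∫ t in U..u, q t) (Ici U) := by
  have h1 : Continuous (fun t => q (max U t)) :=
    hq.comp_continuous (by fun_prop) (fun t => mem_Ici.2 (le_max_left _ _))
  have h2 : Continuous (fun u => ∫ t in U..u, q (max U t)) :=
    intervalIntegral.continuous_primitive (fun a b => h1.intervalIntegrable a b) U
  refine h2.continuousOn.congr ?_
  intro u hu
  apply intervalIntegral.integral_congr
  intro t ht
  rw [uIcc_of_le hu] at ht
  simp [max_eq_right ht.1]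

lemma ko_ii {q : ℝ → ℝ} {U u : ℝ} (hq : ContinuousOn q (Ici U)) (hu : U ≤ u) :
    IntervalIntegrable q volume U u := by
  apply ContinuousOn.intervalIntegrable
  rw [uIcc_of_le hu]
  exact hq.mono Icc_subset_Ici_self


lemma KOSetup.e0 {n : ℝ} {P : ℝ → ℝ} {U e : ℝ} (S : KOSetup n P U e) : 0 ≤ e := le_trans
  (setIntegral_nonneg measurableSet_Ici (fun t ht => (inv_pos.2 (S.pos t ht)).le)) S.eps

lemma KOSetup.len {n : ℝ} {P : ℝ → ℝ} {U e : ℝ} (S : KOSetup n P U e) {u : ℝ} (hu : U ≤ u) : u - U ≤ e * P u := by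
  have hp := S.pos u hu
  have h1 : ∫ t in U..u, (P u)⁻¹ ≤ ∫ t in U..u, (P t)⁻¹ := by
    apply intervalIntegral.integral_mono_on hu (by simp)
    · exact ko_ii (S.cont.inv₀ (fun t ht => (S.pos t ht).ne')) hu
    · intro t ht
      exact inv_anti₀ (S.pos t ht.1) (S.mono ht.1 hu ht.2)
  have h2 : ∫ t in U..u, (P t)⁻¹ ≤ ∫ t in Ici U, (P t)⁻¹ := by
    rw [intervalIntegral.integral_of_le hu]
    apply setIntegral_mono_set S.int
    · exact (ae_restrict_mem measurableSet_Ici).mono (fun t ht => (inv_pos.2 (S.pos t ht)).le)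
    · exact (Ioc_subset_Ioi_self.trans Ioi_subset_Ici_self).eventuallyLE
  rw [intervalIntegral.integral_const, smul_eq_mul] at h1
  have h3 : (u - U) * (P u)⁻¹ ≤ e := h1.trans (h2.trans S.eps)
  rwa [← div_eq_mul_inv, div_le_iff₀ hp] at h3

lemma KOSetup.vpos {n : ℝ} {P : ℝ → ℝ} {U e : ℝ} (S : KOSetup n P U e) {v : ℝ → ℝ} (B : KOBall P U v) {t : ℝ} (ht : U ≤ t) : 0 < v t := by
  have := S.pos t ht
  have := B.lo t ht
  linarith

lemma KOSetup.vinv {n : ℝ} {P : ℝ → ℝ} {U e : ℝ} (S : KOSetup n P U e) {v : ℝ → ℝ} (B : KOBall P U v) {t : ℝ} (ht : U ≤ t) :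
    (v t)⁻¹ ≤ 2 * (P t)⁻¹ := by
  have h := S.pos t ht
  have := B.lo t ht
  calc (v t)⁻¹ ≤ (P t / 2)⁻¹ := inv_anti₀ (by linarith) this
    _ = 2 * (P t)⁻¹ := by field_simp

lemma KOSetup.vint {n : ℝ} {P : ℝ → ℝ} {U e : ℝ} (S : KOSetup n P U e) {v : ℝ → ℝ} (B : KOBall P U v) :
    IntegrableOn (fun t => (v t)⁻¹) (Ici U) := by
  refine Integrable.mono' (S.int.const_mul 2) ?_ ?_
  · exact (B.cont.inv₀ (fun t ht => (S.vpos B ht).ne')).aestronglyMeasurable measurableSet_Ici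
  · refine (ae_restrict_mem measurableSet_Ici).mono (fun t ht => ?_)
    rw [Real.norm_of_nonneg (inv_pos.2 (S.vpos B ht)).le]
    exact S.vinv B ht

lemma KOSetup.tail {n : ℝ} {P : ℝ → ℝ} {U e : ℝ} (S : KOSetup n P U e) {t : ℝ} (ht : U ≤ t) : ∫ s in Ici t, (P s)⁻¹ ≤ e := by
  refine le_trans ?_ S.eps
  apply setIntegral_mono_set S.int
  · exact (ae_restrict_mem measurableSet_Ici).mono (fun t ht => (inv_pos.2 (S.pos t ht)).le)
  · exact (Ici_subset_Ici.2 ht).eventuallyLE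

lemma KOSetup.rlo {n : ℝ} {P : ℝ → ℝ} {U e : ℝ} (S : KOSetup n P U e) {v : ℝ → ℝ} (B : KOBall P U v) {t : ℝ} (ht : U ≤ t) : 1 / 2 ≤ koR v t := by
  have h1 : ∫ s in Ici t, (v s)⁻¹ ≤ ∫ s in Ici t, 2 * (P s)⁻¹ := by
    apply setIntegral_mono_on ((S.vint B).mono_set (Ici_subset_Ici.2 ht))
      ((S.int.mono_set (Ici_subset_Ici.2 ht)).const_mul 2) measurableSet_Ici
    intro s hs
    exact S.vinv B (ht.trans hs)
  rw [integral_const_mul] at h1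
  have := S.tail ht
  have := S.e4
  unfold koR
  linarith

lemma KOSetup.rcont {n : ℝ} {P : ℝ → ℝ} {U e : ℝ} (S : KOSetup n P U e) {v : ℝ → ℝ} (B : KOBall P U v) : ContinuousOn (koR v) (Ici U) := by
  have h := ko_primitive (B.cont.inv₀ (fun t ht => (S.vpos B ht).ne'))
  have h2 : ContinuousOn (fun t => 1 - ((∫ s in Ici U, (v s)⁻¹) - ∫ s in U..t, (v s)⁻¹))
      (Ici U) := by
    exact continuousOn_const.sub (continuousOn_const.sub h)
  refine h2.congr ?_
  intro t ht
  have hi := (S.vint B).mono_set Ioi_subset_Ici_self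
  have := intervalIntegral.integral_interval_add_Ioi hi
    (hi.mono_set (Ioi_subset_Ioi ht))
  simp only [koR, integral_Ici_eq_integral_Ioi]
  linarith

lemma KOSetup.qcont {n : ℝ} {P : ℝ → ℝ} {U e : ℝ} (S : KOSetup n P U e) {v : ℝ → ℝ} (B : KOBall P U v) :
    ContinuousOn (fun t => v t / koR v t) (Ici U) :=
  B.cont.div (S.rcont B) (fun t ht => by have := S.rlo B ht; positivity)

lemma KOSetup.q0 {n : ℝ} {P : ℝ → ℝ} {U e : ℝ} (S : KOSetup n P U e) {v : ℝ → ℝ} (B : KOBall P U v) {t : ℝ} (ht : U ≤ t) : 0 ≤ v t / koR v t := by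
  have := S.rlo B ht
  have := S.vpos B ht
  positivity

lemma KOSetup.q1 {n : ℝ} {P : ℝ → ℝ} {U e : ℝ} (S : KOSetup n P U e) {v : ℝ → ℝ} (B : KOBall P U v) {t : ℝ} (ht : U ≤ t) :
    v t / koR v t ≤ 3 * P t := by
  have h1 := S.rlo B ht
  have h2 := S.pos t ht
  have h3 := B.hi t ht
  rw [div_le_iff₀ (by linarith)]
  nlinarith

lemma KOSetup.intb {n : ℝ} {P : ℝ → ℝ} {U e : ℝ} (S : KOSetup n P U e) {q : ℝ → ℝ} {C u : ℝ} (hC : 0 ≤ C) (hu : U ≤ u)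
    (hq : ∀ t, U ≤ t → |q t| ≤ C * P t) : |∫ t in U..u, q t| ≤ C * e * P u ^ 2 := by
  have h1 : ‖∫ t in U..u, q t‖ ≤ (C * P u) * |u - U| := by
    apply intervalIntegral.norm_integral_le_of_norm_le_const
    intro t ht
    rw [uIoc_of_le hu] at ht
    exact (hq t ht.1.le).trans (mul_le_mul_of_nonneg_left (S.mono ht.1.le hu ht.2) hC)
  rw [abs_of_nonneg (sub_nonneg.2 hu), Real.norm_eq_abs] at h1
  have h2 := S.len hu
  have h3 := S.pos u hu
  calc _ ≤ _ := h1
    _ ≤ (C * P u) * (e * P u) := by gcongr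
    _ = _ := by ring

lemma KOSetup.kin {n : ℝ} {P : ℝ → ℝ} {U e : ℝ} (S : KOSetup n P U e) {v : ℝ → ℝ} (B : KOBall P U v) {u : ℝ} (hu : U ≤ u) :
    P u ^ 2 / 4 ≤ P u ^ 2 - 2 * (n * ∫ t in U..u, v t / koR v t) ∧
    P u ^ 2 - 2 * (n * ∫ t in U..u, v t / koR v t) ≤ P u ^ 2 := by
  have h0 : 0 ≤ ∫ t in U..u, v t / koR v t :=
    intervalIntegral.integral_nonneg hu (fun t ht => S.q0 B ht.1)
  have h1 := (le_abs_self _).trans (S.intb (q := fun t => v t / koR v t) (C := 3) (by norm_num) hu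
    (fun t ht => by rw [abs_of_nonneg (S.q0 B ht)]; exact S.q1 B ht))
  have hn := S.hn
  have h2 := mul_le_mul_of_nonneg_left h1 hn
  have h3 := mul_le_mul_of_nonneg_right S.en (sq_nonneg (P u))
  have h4 := mul_nonneg hn h0
  have h5 := sq_nonneg (P u)
  constructor <;> nlinarith

lemma KOSetup.kball {n : ℝ} {P : ℝ → ℝ} {U e : ℝ} (S : KOSetup n P U e) {v : ℝ → ℝ} (B : KOBall P U v) : KOBall P U (koK n P U v) where
  cont := by
    have h := ko_primitive (S.qcont B)
    have : ContinuousOn (fun u => P u ^ 2 - 2 * (n * ∫ t in U..u, v t / koR v t)) (Ici U) :=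
      (S.cont.pow 2).sub (continuousOn_const.mul (continuousOn_const.mul h))
    exact this.sqrt
  lo := by
    intro u hu
    apply Real.le_sqrt_of_sq_le
    have := (S.kin B hu).1
    linarith
  hi := by
    intro u hu
    have h := (S.kin B hu).2
    have hp := S.pos u hu
    calc _ ≤ Real.sqrt (P u ^ 2) := Real.sqrt_le_sqrt h
      _ = P u := Real.sqrt_sq hp.le
      _ ≤ _ := by linarith

lemma KOSetup.rdiff {n : ℝ} {P : ℝ → ℝ} {U e : ℝ} (S : KOSetup n P U e) {v w : ℝ → ℝ} (B : KOBall P U v) (C : KOBall P U w) {d : ℝ} (hd : 0 ≤ d)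
    (h : ∀ t, U ≤ t → |v t - w t| ≤ d * P t) {t : ℝ} (ht : U ≤ t) :
    |koR v t - koR w t| ≤ d := by
  have hs := Ici_subset_Ici.2 ht
  have h1 : koR v t - koR w t = ∫ s in Ici t, ((w s)⁻¹ - (v s)⁻¹) := by
    rw [integral_sub ((S.vint C).mono_set hs) ((S.vint B).mono_set hs)]
    unfold koR
    ring
  have h2 : ‖∫ s in Ici t, ((w s)⁻¹ - (v s)⁻¹)‖ ≤ ∫ s in Ici t, (4 * d) * (P s)⁻¹ := by
    apply norm_integral_le_of_norm_le ((S.int.mono_set hs).const_mul _)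
    refine (ae_restrict_mem measurableSet_Ici).mono (fun s hst => ?_)
    have hU : U ≤ s := ht.trans hst
    have hv := S.vpos B hU
    have hw := S.vpos C hU
    have hp := S.pos s hU
    have e1 : (w s)⁻¹ - (v s)⁻¹ = (v s - w s) * ((v s)⁻¹ * (w s)⁻¹) := by field_simp
    rw [e1, Real.norm_eq_abs, abs_mul, abs_of_nonneg (a := (v s)⁻¹ * (w s)⁻¹) (by positivity)]
    calc _ ≤ (d * P s) * ((2 * (P s)⁻¹) * (2 * (P s)⁻¹)) := by
          gcongr
          · exact h s hU
          · exact S.vinv B hU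
          · exact S.vinv C hU
      _ = _ := by field_simp; ring
  rw [integral_const_mul] at h2
  have h3 := S.tail ht
  have h4 := S.e4
  rw [h1]
  refine h2.trans ?_
  nlinarith

lemma KOSetup.kdiff {n : ℝ} {P : ℝ → ℝ} {U e : ℝ} (S : KOSetup n P U e) {v w : ℝ → ℝ} (B : KOBall P U v) (C : KOBall P U w) {d : ℝ} (hd : 0 ≤ d)
    (h : ∀ t, U ≤ t → |v t - w t| ≤ d * P t) {u : ℝ} (hu : U ≤ u) :
    |koK n P U v u - koK n P U w u| ≤ d / 2 * P u := by
  have hq : ∀ t, U ≤ t → |v t / koR v t - w t / koR w t| ≤ (8 * d) * P t := by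
    intro t ht
    have r1 := S.rlo B ht
    have r2 := S.rlo C ht
    have hp := S.pos t ht
    have hw := S.vpos C ht
    have hr := S.rdiff B C hd h ht
    have i1 : (koR v t)⁻¹ ≤ 2 := by
      rw [inv_le_comm₀ (by linarith) (by norm_num)]; linarith
    have i2 : (koR w t)⁻¹ ≤ 2 := by
      rw [inv_le_comm₀ (by linarith) (by norm_num)]; linarith
    have p1 : 0 < koR v t := by linarith
    have p2 : 0 < koR w t := by linarith
    have e1 : v t / koR v t - w t / koR w t = (v t - w t) * (koR v t)⁻¹ -
      w t * (koR v t - koR w t) * ((koR v t)⁻¹ * (koR w t)⁻¹) := by field_simp; ring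
    rw [e1]
    refine (abs_sub _ _).trans ?_
    rw [abs_mul, abs_mul, abs_mul, abs_of_pos (inv_pos.2 p1), abs_of_pos hw,
      abs_of_pos (a := (koR v t)⁻¹ * (koR w t)⁻¹) (by positivity)]
    calc _ ≤ (d * P t) * 2 + (3 / 2 * P t) * d * (2 * 2) := by
          gcongr
          · exact h t ht
          · exact C.hi t ht
      _ = _ := by ring
  have h1 := S.intb (q := fun t => v t / koR v t - w t / koR w t) (by positivity) hu hq
  rw [intervalIntegral.integral_sub (ko_ii (S.qcont B) hu) (ko_ii (S.qcont C) hu)] at h1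
  have hp := S.pos u hu
  have k1 := (S.kball B).lo u hu
  have k2 := (S.kball C).lo u hu
  have a1 := (S.kin B hu).1
  have a2 := (S.kin C hu).1
  have s1 : koK n P U v u ^ 2 = _ := Real.sq_sqrt (le_trans (by positivity) a1)
  have s2 : koK n P U w u ^ 2 = _ := Real.sq_sqrt (le_trans (by positivity) a2)
  set x := koK n P U v u
  set y := koK n P U w u
  set I := ∫ t in U..u, v t / koR v t
  set J := ∫ t in U..u, w t / koR w t
  have m : |x - y| * (x + y) = 2 * n * |I - J| := by
    rw [← abs_of_nonneg (a := x + y) (by linarith), ← abs_mul,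
      ← abs_of_nonneg (a := 2 * n) (by linarith [S.hn]), ← abs_mul, ← abs_neg (2 * n * (I - J))]
    congr 1
    linarith
  have m1 : |x - y| * P u ≤ |x - y| * (x + y) :=
    mul_le_mul_of_nonneg_left (by linarith) (abs_nonneg _)
  have hn := S.hn
  have m2 : 2 * n * |I - J| ≤ 2 * n * (8 * d * e * P u ^ 2) := by gcongr
  have m3 : 2 * n * (8 * d * e * P u ^ 2) ≤ d / 2 * P u * P u := by
    have := mul_le_mul_of_nonneg_right S.en (show 0 ≤ d / 2 * P u ^ 2 by positivity)
    nlinarith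
  exact le_of_mul_le_mul_right (by linarith) hp

lemma KOSetup.uniq {n : ℝ} {P : ℝ → ℝ} {U e : ℝ} (S : KOSetup n P U e) {v w : ℝ → ℝ} (B : KOBall P U v) (C : KOBall P U w)
    (hv : ∀ u, U ≤ u → v u = koK n P U v u) (hw : ∀ u, U ≤ u → w u = koK n P U w u) :
    EqOn v w (Ici U) := by
  have h : ∀ k : ℕ, ∀ t, U ≤ t → |v t - w t| ≤ (1 / 2 : ℝ) ^ k * P t := by
    intro k
    induction k with
    | zero =>
      intro t ht
      have := B.lo t ht
      have := B.hi t ht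
      have := C.lo t ht
      have := C.hi t ht
      rw [abs_le]
      constructor <;> simp <;> linarith
    | succ k ih =>
      intro t ht
      have := S.kdiff B C (by positivity) ih ht
      rw [← hv t ht, ← hw t ht] at this
      refine this.trans (le_of_eq ?_)
      ring
  intro t ht
  have hl : Tendsto (fun k : ℕ => (1 / 2 : ℝ) ^ k * P t) atTop (𝓝 (0 * P t)) :=
    (tendsto_pow_atTop_nhds_zero_of_lt_one (by norm_num) (by norm_num)).mul_const _
  have h0 := ge_of_tendsto' hl (fun k => h k t ht)
  rw [zero_mul] at h0
  exact sub_eq_zero.1 (abs_nonpos_iff.1 h0)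

lemma KOSetup.toBall {n : ℝ} {P : ℝ → ℝ} {U e : ℝ} (S : KOSetup n P U e) {g : ℝ → ℝ} (hg : Continuous g) (h : ∀ x, g x ∈ Icc (1 / 2 : ℝ) (3 / 2)) :
    KOBall P U (fun t => g t * P t) where
  cont := hg.continuousOn.mul S.cont
  lo := fun u hu => by
    have := S.pos u hu
    have := (h u).1
    nlinarith
  hi := fun u hu => by
    have := S.pos u hu
    have := (h u).2
    nlinarith

lemma KOSetup.fromBall {n : ℝ} {P : ℝ → ℝ} {U e : ℝ} (S : KOSetup n P U e) {v : ℝ → ℝ} (B : KOBall P U v) :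
    Continuous (fun x => v (max U x) / P (max U x)) ∧
      ∀ x, v (max U x) / P (max U x) ∈ Icc (1 / 2 : ℝ) (3 / 2) := by
  constructor
  · have h : ContinuousOn (fun t => v t / P t) (Ici U) :=
      B.cont.div S.cont (fun t ht => (S.pos t ht).ne')
    exact h.comp_continuous (f := fun x => max U x) (by fun_prop) (fun t => mem_Ici.2 (le_max_left _ _))
  · intro x
    have hx : U ≤ max U x := le_max_left _ _
    have h1 := S.pos _ hx
    have h2 := B.lo _ hx
    have h3 := B.hi _ hx
    constructor
    · rw [le_div_iff₀ h1]; linarith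
    · rw [div_le_iff₀ h1]; linarith

lemma KOSetup.exist {n : ℝ} {P : ℝ → ℝ} {U e : ℝ} (S : KOSetup n P U e) : ∃ v, KOBall P U v ∧ ∀ u, U ≤ u → v u = koK n P U v u := by
  classical
  let A : Set (BoundedContinuousFunction ℝ ℝ) := {g | ∀ x, g x ∈ Icc (1 / 2 : ℝ) (3 / 2)}
  have hA : IsClosed A := by
    have : A = ⋂ x, (fun g : BoundedContinuousFunction ℝ ℝ => g x) ⁻¹' Icc (1 / 2 : ℝ) (3 / 2) := by
      ext g; simp [A]
    rw [this]
    refine isClosed_iInter (fun x => isClosed_Icc.preimage ?_)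
    exact continuous_eval_const x
  have : CompleteSpace A := hA.completeSpace_coe
  have : Nonempty A := ⟨⟨BoundedContinuousFunction.const ℝ 1, fun x => by
    constructor <;> simp <;> norm_num⟩⟩
  have hB : ∀ g : A, KOBall P U (fun t => g.1 t * P t) := fun g =>
    S.toBall g.1.continuous g.2
  have hK : ∀ g : A, KOBall P U (koK n P U (fun t => g.1 t * P t)) := fun g => S.kball (hB g)
  let Φ : A → A := fun g => ⟨BoundedContinuousFunction.ofNormedAddCommGroup
    (fun x => koK n P U (fun t => g.1 t * P t) (max U x) / P (max U x))
    (S.fromBall (hK g)).1 (3 / 2) (fun x => by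
      have := (S.fromBall (hK g)).2 x
      rw [Real.norm_eq_abs, abs_le]
      constructor
      · linarith [this.1]
      · exact this.2), (S.fromBall (hK g)).2⟩
  have hΦ : ContractingWith (1 / 2) Φ := by
    refine ⟨by rw [← NNReal.coe_lt_coe]; norm_num, LipschitzWith.of_dist_le_mul ?_⟩
    intro g g'
    rw [Subtype.dist_eq, Subtype.dist_eq]
    rw [BoundedContinuousFunction.dist_le (by positivity)]
    intro x
    have hx : U ≤ max U x := le_max_left _ _
    have hp := S.pos _ hx
    have := S.kdiff (hB g) (hB g') (d := dist g.1 g'.1) dist_nonneg (fun t ht => by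
      have hp := S.pos t ht
      rw [← sub_mul, abs_mul, abs_of_pos hp]
      gcongr
      exact BoundedContinuousFunction.dist_coe_le_dist (f := g.1) (g := g'.1) t) hx
    change |koK n P U (fun t => g.1 t * P t) (max U x) / P (max U x) -
      koK n P U (fun t => g'.1 t * P t) (max U x) / P (max U x)| ≤ _
    rw [← sub_div, abs_div, abs_of_pos hp, div_le_iff₀ hp]
    refine this.trans (le_of_eq ?_)
    push_cast
    ring
  let g := ContractingWith.fixedPoint Φ hΦ
  have hg : Φ g = g := hΦ.fixedPoint_isFixedPt
  refine ⟨fun t => g.1 t * P t, hB g, ?_⟩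
  intro u hu
  have h : (Φ g).1 u = g.1 u := by rw [hg]
  change koK n P U (fun t => g.1 t * P t) (max U u) / P (max U u) = _ at h
  rw [max_eq_right hu] at h
  change g.1 u * P u = _
  rw [← h, div_mul_cancel₀ _ (S.pos u hu).ne']


lemma ko_solves {N : ℕ} {F : ℝ → ℝ} {U : ℝ} (hF : ∀ u, U ≤ u → 0 < F u) (v : ℝ → ℝ) :
    SolvesIntEq N F U (1 / 2) v ↔ KOBall (fun u => Real.sqrt (2 * F u)) U v ∧
      ∀ u, U ≤ u → v u = koK (N - 1 : ℝ) (fun u => Real.sqrt (2 * F u)) U v u := by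
  have hk : ∀ u, U ≤ u → koK (N - 1 : ℝ) (fun u => Real.sqrt (2 * F u)) U v u =
      Real.sqrt (2 * (F u - (N - 1 : ℝ) *
        ∫ t in U..u, v t / (1 - ∫ s in Set.Ici t, (v s)⁻¹))) := by
    intro u hu
    simp only [koK, koR]
    rw [Real.sq_sqrt (by linarith [hF u hu]), mul_sub]
  constructor
  · rintro ⟨h1, h2, h3⟩
    refine ⟨⟨h1, fun u hu => ?_, fun u hu => ?_⟩, fun u hu => ?_⟩
    · have := (abs_le.1 (h2 u hu)).1
      linarith
    · have := (abs_le.1 (h2 u hu)).2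
      linarith
    · rw [hk u hu]; exact h3 u hu
  · rintro ⟨⟨h1, h2, h3⟩, h4⟩
    refine ⟨h1, fun u hu => ?_, fun u hu => ?_⟩
    · have := h2 u hu
      have := h3 u hu
      rw [abs_le]
      constructor <;> linarith
    · rw [← hk u hu]; exact h4 u hu

theorem statement5 {N : ℕ} (hN : 1 ≤ N) (f : ℝ → ℝ) (hf : ContDiff ℝ 1 f)
    -- condition (2)
    (a : ℝ) (ha : 0 < f a) (hf0 : ∀ t > a, 0 ≤ f t)
    (F : ℝ → ℝ) (hF : ∀ t, F t = ∫ s in a..t, f s)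
    -- condition (3): Keller-Osserman
    (hKO : ∃ T, (∀ t ≥ T, 0 < F t) ∧
      IntegrableOn (fun t => (Real.sqrt (F t))⁻¹) (Ici T)) :
    -- if U₀ is sufficiently large, for some ρ ∈ (0,1) the integral equation has
    -- exactly one solution in the ball B(v₀, ρ)
    ∃ U₁ : ℝ, ∀ U₀ ≥ U₁, ∃ ρ ∈ Ioo (0 : ℝ) 1,
      (∃ v : ℝ → ℝ, SolvesIntEq N F U₀ ρ v) ∧
      ∀ v w : ℝ → ℝ, SolvesIntEq N F U₀ ρ v → SolvesIntEq N F U₀ ρ w →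
        EqOn v w (Ici U₀) := by
  obtain ⟨T, hT, hI⟩ := hKO
  have hfc : Continuous f := hf.continuous
  have hii : ∀ x y, IntervalIntegrable f volume x y := fun x y => hfc.intervalIntegrable x y
  have hFc : Continuous F := by
    have : F = fun t => ∫ s in a..t, f s := funext hF
    rw [this]
    exact intervalIntegral.continuous_primitive hii a
  have hFm : MonotoneOn F (Ici a) := by
    intro x hx y hy hxy
    rw [hF, hF, ← intervalIntegral.integral_add_adjacent_intervals (hii a x) (hii x y)]
    have : 0 ≤ ∫ s in x..y, f s := by
      apply intervalIntegral.integral_nonneg hxy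
      intro s hs
      rcases eq_or_lt_of_le (show a ≤ s from le_trans hx hs.1) with h | h
      · rw [← h]; exact ha.le
      · exact hf0 s h
    linarith
  have hn : (0 : ℝ) ≤ (N - 1 : ℝ) := by
    have : (1 : ℝ) ≤ N := by exact_mod_cast hN
    linarith
  have hI2 : IntegrableOn (fun t => (Real.sqrt (2 * F t))⁻¹) (Ici T) := by
    have : (fun t => (Real.sqrt (2 * F t))⁻¹) =
        fun t => (Real.sqrt 2)⁻¹ * (Real.sqrt (F t))⁻¹ := by
      funext t
      rw [Real.sqrt_mul (by norm_num), mul_inv]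
    rw [this]
    exact hI.const_mul _
  have hlim : Tendsto (fun u => ∫ t in Ici u, (Real.sqrt (2 * F t))⁻¹) atTop (𝓝 0) := by
    have hi := hI2.mono_set Ioi_subset_Ici_self
    have h1 := intervalIntegral_tendsto_integral_Ioi T hi tendsto_id
    have h2 := h1.const_sub (∫ t in Ioi T, (Real.sqrt (2 * F t))⁻¹)
    rw [sub_self] at h2
    refine h2.congr' ?_
    filter_upwards [eventually_ge_atTop T] with u hu
    have := intervalIntegral.integral_interval_add_Ioi hi (hi.mono_set (Ioi_subset_Ioi hu))
    rw [integral_Ici_eq_integral_Ioi]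
    simp only [id]
    linarith
  obtain ⟨e, he0, he4, hen⟩ : ∃ e : ℝ, 0 < e ∧ e ≤ 1 / 4 ∧ 32 * ((N - 1 : ℝ) * e) ≤ 1 := by
    refine ⟨1 / (32 * ((N - 1 : ℝ) + 1)), by positivity, ?_, ?_⟩
    · rw [div_le_div_iff₀ (by positivity) (by norm_num)]
      linarith
    · rw [mul_one_div, ← mul_div_assoc, div_le_one (by positivity)]
      linarith
  obtain ⟨U₁, hU₁⟩ := eventually_atTop.1 ((hlim.eventually (gt_mem_nhds he0)).and
    ((eventually_ge_atTop T).and (eventually_ge_atTop a)))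
  refine ⟨U₁, fun U hU => ⟨1 / 2, by norm_num, ?_⟩⟩
  obtain ⟨hε, hUT, hUa⟩ := hU₁ U hU
  have hpos : ∀ u, U ≤ u → 0 < F u := fun u hu => hT u (le_trans hUT hu)
  have S : KOSetup (N - 1 : ℝ) (fun u => Real.sqrt (2 * F u)) U e :=
    { hn := hn
      cont := (by fun_prop : Continuous (fun u => Real.sqrt (2 * F u))).continuousOn
      pos := fun u hu => Real.sqrt_pos.2 (by linarith [hpos u hu])
      mono := fun x hx y hy hxy => Real.sqrt_le_sqrt (by
        have := hFm (le_trans hUa hx) (le_trans hUa hy) hxy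
        linarith)
      int := hI2.mono_set (Ici_subset_Ici.2 hUT)
      eps := hε.le
      e4 := he4
      en := hen }
  constructor
  · obtain ⟨v, hv⟩ := S.exist
    exact ⟨v, (ko_solves hpos v).2 hv⟩
  · intro v w hv hw
    obtain ⟨B, hB⟩ := (ko_solves hpos v).1 hv
    obtain ⟨C, hC⟩ := (ko_solves hpos w).1 hw
    exact S.uniq B C hB hC
end

section
/- Let N ≥ 1, let B be the open unit ball of ℝ^N, and let f ∈ C¹(ℝ) satisfy conditions (2) and (3). Let u be any boundary blow-up solution of Δu = f(u) in B, fix r₀ ∈ (0,1) with u(x) ≥ U₀ for |x| ≥ r₀, and for k ≥ 0 let u_k : [r₀, 1) → ℝ be the unique solution of du_k/dr = v_k(u_k) with lim_{r→1⁻} u_k(r) = +∞, where v_k is the k-th iterate of the integral-equation scheme (v₀ = √(2F), v_k(u) = √(2(F(u) − (N−1)∫_{U₀}^u v_{k−1}(t)/(1 − ∫_t^{+∞} ds/v_{k−1}) dt))). Then ∫_{u_k(r)}^{u_{k+1}(r)} du/v₀(u) = o(∫_{u_k(r)}^{+∞} du/v₀(u)) as r → 1⁻, and for every k ∈ ℕ,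 ∫_{u_k(|x|)}^{u(x)} du/v₀(u) = o(∫_{u_k(|x|)}^{+∞} du/v₀(u)) as x → ∂B. -/
open MeasureTheory Filter Metric Set Topology

/-- The iterative scheme `v₀ = √(2F)`,
`v_k(u) = √(2(F(u) − (N−1) ∫_{U₀}^u v_{k−1}(t)/(1 − ∫_t^∞ ds/v_{k−1}(s)) dt))`. -/
noncomputable def vIter (N : ℕ) (F : ℝ → ℝ) (U₀ : ℝ) : ℕ → ℝ → ℝ
  | 0 => fun u => Real.sqrt (2 * F u)
  | k + 1 => fun u => Real.sqrt (2 * (F u - (N - 1 : ℝ) *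
      ∫ t in U₀..u, vIter N F U₀ k t / (1 - ∫ s in Set.Ici t, (vIter N F U₀ k s)⁻¹)))



lemma tail_sub {φ : ℝ → ℝ} {T x y : ℝ} (h : IntegrableOn φ (Ici T)) (hx : T ≤ x) (hy : T ≤ y) :
    ∫ t in x..y, φ t = (∫ t in Ici x, φ t) - ∫ t in Ici y, φ t := by
  rw [integral_Ici_eq_integral_Ioi, integral_Ici_eq_integral_Ioi,
    intervalIntegral.integral_Ioi_sub_Ioi']
  · exact h.mono_set (fun z hz => hx.trans (le_of_lt hz))
  · exact h.mono_set (fun z hz => hy.trans (le_of_lt hz))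

lemma tail_tendsto {φ : ℝ → ℝ} {T : ℝ} (h : IntegrableOn φ (Ici T)) :
    Tendsto (fun t => ∫ s in Ici t, φ s) atTop (𝓝 0) := by
  have h1 := intervalIntegral_tendsto_integral_Ioi T (h.mono_set Ioi_subset_Ici_self)
    (tendsto_id (α := ℝ) (x := atTop))
  have h2 := h1.const_sub (∫ x in Ioi T, φ x)
  rw [sub_self] at h2
  refine h2.congr' ?_
  filter_upwards [eventually_ge_atTop T] with t ht
  simp only [id]
  rw [tail_sub h le_rfl ht, integral_Ici_eq_integral_Ioi (x := T)]
  ring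

lemma tail_deriv {φ : ℝ → ℝ} {T t : ℝ} (h : IntegrableOn φ (Ici T)) (hc : ContinuousOn φ (Ici T))
    (ht : T < t) : HasDerivAt (fun t => ∫ s in Ici t, φ s) (-φ t) t := by
  have hnb : Ici T ∈ 𝓝 t := Ici_mem_nhds ht
  have h1 : HasDerivAt (fun t => ∫ s in T..t, φ s) (φ t) t := by
    apply intervalIntegral.integral_hasDerivAt_right
    · rw [intervalIntegrable_iff_integrableOn_Icc_of_le ht.le]
      exact h.mono_set Icc_subset_Ici_self
    · exact (hc.mono Ioi_subset_Ici_self).stronglyMeasurableAtFilter isOpen_Ioi t ht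
    · exact hc.continuousAt hnb
  have h2 := h1.const_sub (∫ x in Ici T, φ x)
  refine h2.congr_of_eventuallyEq ?_
  filter_upwards [hnb] with s hs
  rw [tail_sub h le_rfl hs]
  ring

lemma tail_nonneg {φ : ℝ → ℝ} {t : ℝ} (h0 : ∀ s ≥ t, 0 ≤ φ s) : 0 ≤ ∫ s in Ici t, φ s :=
  setIntegral_nonneg measurableSet_Ici h0

lemma tail_mono {φ χ : ℝ → ℝ} {t : ℝ} (h : IntegrableOn φ (Ici t)) (h' : IntegrableOn χ (Ici t))
    (h0 : ∀ s ≥ t, φ s ≤ χ s) : ∫ s in Ici t, φ s ≤ ∫ s in Ici t, χ s :=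
  setIntegral_mono_on h h' measurableSet_Ici h0

/-- A function tending to zero at `1` with derivative at least `-C` is at most `C (1-r)`. -/
lemma le_of_deriv_ge {D D' : ℝ → ℝ} {r2 C : ℝ} (hD : ∀ r ∈ Ioo r2 1, HasDerivAt D (D' r) r)
    (hC : ∀ r ∈ Ioo r2 1, -C ≤ D' r) (h0 : Tendsto D (𝓝[<] 1) (𝓝 0)) :
    ∀ r ∈ Ioo r2 1, D r ≤ C * (1 - r) := by
  intro r hr
  have hder : ∀ r ∈ Ioo r2 1, HasDerivAt (fun r => D r - C * (1 - r)) (D' r + C) r := by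
    intro r hr
    have := (hD r hr).sub (((hasDerivAt_id r).const_sub 1).const_mul C)
    refine HasDerivAt.congr_deriv this ?_
    ring
  have hm : MonotoneOn (fun r => D r - C * (1 - r)) (Ioo r2 1) := by
    apply monotoneOn_of_deriv_nonneg (convex_Ioo _ _)
    · intro r hr; exact (hder r hr).continuousAt.continuousWithinAt
    · intro r hr; rw [interior_Ioo] at hr
      exact (hder r hr).differentiableAt.differentiableWithinAt
    · intro r hr; rw [interior_Ioo] at hr
      rw [(hder r hr).deriv]; linarith [hC r hr]
  have ht : Tendsto (fun r => D r - C * (1 - r)) (𝓝[<] 1) (𝓝 0) := by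
    have h1 : Tendsto (fun r : ℝ => C * (1 - r)) (𝓝[<] 1) (𝓝 (C * (1 - 1))) :=
      (Continuous.tendsto (by fun_prop) 1).mono_left nhdsWithin_le_nhds
    simpa using h0.sub h1
  have : D r - C * (1 - r) ≤ 0 := by
    refine ge_of_tendsto ht ?_
    filter_upwards [Ioo_mem_nhdsLT hr.2] with s hs
    exact hm hr ⟨hr.1.trans hs.1, hs.2⟩ hs.1.le
  linarith

lemma second_test {φ φ' : ℝ → ℝ} {c : ℝ} (h1 : ∀ᶠ t in 𝓝 0, HasDerivAt φ (φ' t) t)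
    (h2 : HasDerivAt φ' c 0) (hm : IsLocalMax φ 0) : φ' 0 = 0 ∧ c ≤ 0 := by
  have h3 : φ' 0 = 0 := hm.hasDerivAt_eq_zero h1.self_of_nhds
  refine ⟨h3, ?_⟩
  by_contra hc
  push Not at hc
  have hd : deriv φ =ᶠ[𝓝 0] φ' := h1.mono fun t ht => ht.deriv
  have hdd : deriv (deriv φ) 0 = c := by rw [hd.deriv_eq, h2.deriv]
  have hmin : IsLocalMin φ 0 := isLocalMin_of_deriv_deriv_pos (by rw [hdd]; exact hc)
    (by rw [hd.self_of_nhds, h3]) h1.self_of_nhds.continuousAt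
  have hconst : φ =ᶠ[𝓝 0] fun _ => φ 0 := by
    filter_upwards [hm, hmin] with t ht ht'
    exact le_antisymm ht ht'
  have : deriv (deriv φ) 0 = 0 := by
    have h4 : deriv φ =ᶠ[𝓝 0] deriv (fun _ => φ 0) := hconst.deriv
    rw [h4.deriv_eq]; simp
  linarith

lemma point_test {N : ℕ} {u : EuclideanSpace ℝ (Fin N) → ℝ} {y : EuclideanSpace ℝ (Fin N)}
    (hu : ContDiffAt ℝ 2 u y) {H g : ℝ → ℝ} {g' A B σ : ℝ}
    (hH : ∀ᶠ t in 𝓝 (u y), HasDerivAt H (-(g t)⁻¹) t) (hg : HasDerivAt g g' (u y))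
    (hg0 : 0 < g (u y))
    (hm : IsLocalMax (fun x => σ * (H (u x) - (A * (1 - ‖x‖ ^ 2) + B * (1 - ‖x‖ ^ 2) ^ 2))) y)
    (hσ : σ ≠ 0) :
    σ * (-(lap u y) / g (u y) + g' * (4 * (A + 2 * B * (1 - ‖y‖ ^ 2)) ^ 2 * ‖y‖ ^ 2)
      - (8 * B * ‖y‖ ^ 2 - 2 * N * (A + 2 * B * (1 - ‖y‖ ^ 2)))) ≤ 0 := by
  set h1 : ℝ := A + 2 * B * (1 - ‖y‖ ^ 2) with hh1
  set G := g (u y) with hG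
  have key : ∀ i : Fin N, σ * (-(fderiv ℝ (fun z => fderiv ℝ u z (EuclideanSpace.single i 1)) y
      (EuclideanSpace.single i 1)) / G + g' * (4 * h1 ^ 2 * (y i) ^ 2)
      - (8 * B * (y i) ^ 2 - 2 * h1)) ≤ 0 := by
    intro i
    set e : EuclideanSpace ℝ (Fin N) := EuclideanSpace.single i 1 with he
    set ℓ : ℝ → EuclideanSpace ℝ (Fin N) := fun t => y + t • e with hℓ
    have hℓ0 : ℓ 0 = y := by simp [hℓ]
    have hℓd : ∀ t, HasDerivAt ℓ e t := by
      intro t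
      simpa [hℓ] using ((hasDerivAt_id t).smul_const e).const_add y
    have hℓc : Tendsto ℓ (𝓝 0) (𝓝 y) := by
      have := (hℓd 0).continuousAt.tendsto
      rwa [hℓ0] at this
    have hnorm : ∀ t, ‖ℓ t‖ ^ 2 = ‖y‖ ^ 2 + 2 * t * y i + t ^ 2 := by
      intro t
      rw [hℓ, norm_add_sq_real]
      simp only [inner_smul_right, he, EuclideanSpace.inner_single_right, norm_smul]
      simp
      ring
    set p : ℝ → ℝ := fun t => fderiv ℝ u (ℓ t) e with hp
    set q : ℝ := fderiv ℝ (fun z => fderiv ℝ u z e) y e with hq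
    have hud : ∀ᶠ z in 𝓝 y, DifferentiableAt ℝ u z := by
      filter_upwards [hu.eventually (by simp)] with z hz
      exact hz.differentiableAt (by simp)
    have hpt : ∀ᶠ t in 𝓝 (0:ℝ), HasDerivAt (fun t => u (ℓ t)) (p t) t := by
      filter_upwards [hℓc.eventually hud] with t ht
      exact ht.hasFDerivAt.comp_hasDerivAt t (hℓd t)
    have hpd : HasDerivAt p q 0 := by
      have h2 : DifferentiableAt ℝ (fun z => fderiv ℝ u z e) y := by
        have := (hu.fderiv_right (m := 1) (by norm_num)).differentiableAt (by simp)
        exact this.clm_apply (differentiableAt_const e)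
      have h3 : HasFDerivAt (fun z => fderiv ℝ u z e) (fderiv ℝ (fun z => fderiv ℝ u z e) y) (ℓ 0) := by
        rw [hℓ0]; exact h2.hasFDerivAt
      exact h3.comp_hasDerivAt 0 (hℓd 0)
    have huc : Tendsto (fun t => u (ℓ t)) (𝓝 0) (𝓝 (u y)) := by
      have := hpt.self_of_nhds.continuousAt.tendsto
      simpa [hℓ0] using this
    set s : ℝ → ℝ := fun t => 1 - (‖y‖ ^ 2 + 2 * t * y i + t ^ 2) with hs
    have hsd : ∀ t, HasDerivAt s (-(2 * y i + 2 * t)) t := by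
      intro t
      have h5 := (((((hasDerivAt_id t).const_mul 2).mul_const (y i)).const_add (‖y‖ ^ 2)).add
        ((hasDerivAt_id t).pow 2)).const_sub 1
      refine HasDerivAt.congr_deriv h5 ?_
      simp
    set φ : ℝ → ℝ := fun t => σ * (H (u (ℓ t)) - (A * s t + B * (s t) ^ 2)) with hφ
    set φ' : ℝ → ℝ := fun t => σ * (-(g (u (ℓ t)))⁻¹ * p t + (A + 2 * B * s t) * (2 * y i + 2 * t)) with hφ'
    have hmax : IsLocalMax φ 0 := by
      have := hm
      have h6 : ∀ᶠ t in 𝓝 (0:ℝ), _ := hℓc.eventually this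
      filter_upwards [h6] with t ht
      have e1 : s t = 1 - ‖ℓ t‖ ^ 2 := by rw [hnorm]
      have e2 : s 0 = 1 - ‖y‖ ^ 2 := by simp [hs]
      simp only [hφ, e1, e2, hℓ0]
      exact ht
    have hφd : ∀ᶠ t in 𝓝 (0:ℝ), HasDerivAt φ (φ' t) t := by
      filter_upwards [hpt, huc.eventually hH] with t ht hHt
      have h7 : HasDerivAt (fun t => H (u (ℓ t))) _ t := HasDerivAt.comp t hHt ht
      have h8 := (h7.sub (((hsd t).const_mul A).add (((hsd t).pow 2).const_mul B))).const_mul σ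
      refine HasDerivAt.congr_deriv h8 ?_
      simp only [hφ']
      push_cast
      ring
    have hgc : HasDerivAt (fun t => g (u (ℓ t))) (g' * q * 0 + g' * p 0) 0 := by
      have : HasDerivAt g g' (u (ℓ 0)) := by rw [hℓ0]; exact hg
      have := HasDerivAt.comp (0:ℝ) this hpt.self_of_nhds
      refine HasDerivAt.congr_deriv this ?_
      ring
    have hG0 : g (u (ℓ 0)) = G := by rw [hℓ0]
    have hφ'd := ((((hgc.inv (by rw [hG0]; exact hg0.ne')).neg.mul hpd)).add
      ((((hsd 0).const_mul (2 * B)).const_add A).mul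
        (((hasDerivAt_id (0:ℝ)).const_mul 2).const_add (2 * y i)))).const_mul σ
    obtain ⟨k1, k2⟩ := second_test hφd hφ'd hmax
    have s0 : s 0 = 1 - ‖y‖ ^ 2 := by simp [hs]
    have k3 : p 0 = G * (h1 * (2 * y i)) := by
      simp only [hφ', hG0, s0, mul_zero, add_zero] at k1
      have := (mul_eq_zero.1 k1).resolve_left hσ
      field_simp at this
      rw [hh1]
      linarith
    refine le_trans (le_of_eq ?_) k2
    congr 1
    simp only [Pi.inv_apply, Pi.neg_apply, hG0, s0, k3, id]
    have : G ≠ 0 := hg0.ne'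
    field_simp
    ring
  have hsum : ∑ i : Fin N, (y i) ^ 2 = ‖y‖ ^ 2 := by
    rw [EuclideanSpace.norm_sq_eq]; simp
  have := Finset.sum_nonpos (fun i (_ : i ∈ Finset.univ) => key i)
  refine le_trans (le_of_eq ?_) this
  rw [← Finset.mul_sum, Finset.sum_sub_distrib, Finset.sum_add_distrib, Finset.sum_sub_distrib,
    ← Finset.mul_sum, ← Finset.mul_sum, ← Finset.mul_sum, ← Finset.sum_div, Finset.sum_neg_distrib, hsum]
  simp [lap]
  left; ring


lemma tail_anti {φ : ℝ → ℝ} {T : ℝ} (h : IntegrableOn φ (Ici T)) (h0 : ∀ s ≥ T, 0 ≤ φ s)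
    {x y : ℝ} (hx : T ≤ x) (hxy : x ≤ y) : ∫ t in Ici y, φ t ≤ ∫ t in Ici x, φ t := by
  have := tail_sub h hx (hx.trans hxy)
  have h2 : 0 ≤ ∫ t in x..y, φ t :=
    intervalIntegral.integral_nonneg hxy (fun s hs => h0 s (hx.trans hs.1))
  linarith

lemma integrable_of_ratio {v g : ℝ → ℝ} {T T' : ℝ}
    (hv : IntegrableOn (fun t => (v t)⁻¹) (Ici T)) (hv0 : ∀ t ≥ T, 0 < v t)
    (hg : ContinuousOn g (Ici T')) (hg0 : ∀ t ≥ T', 0 < g t)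
    (hr : Tendsto (fun t => g t / v t) atTop (𝓝 1)) :
    IntegrableOn (fun t => (g t)⁻¹) (Ici T') := by
  have hc : ContinuousOn (fun t => (g t)⁻¹) (Ici T') := hg.inv₀ (fun t ht => (hg0 t ht).ne')
  have h1 : ∀ᶠ t in atTop, 1 / 2 < g t / v t := hr.eventually (lt_mem_nhds (by norm_num))
  obtain ⟨S, hS⟩ := eventually_atTop.1 h1
  set R := max S (max T T') with hR
  have hRS : S ≤ R := le_max_left _ _
  have hRT : T ≤ R := (le_max_left _ _).trans (le_max_right _ _)
  have hRT' : T' ≤ R := (le_max_right _ _).trans (le_max_right _ _)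
  have hI : IntegrableOn (fun t => (g t)⁻¹) (Ici R) := by
    have h2 : IntegrableOn (fun t => 2 * (v t)⁻¹) (Ici R) :=
      (hv.mono_set (Ici_subset_Ici.2 hRT)).const_mul 2
    refine Integrable.mono' h2
      ((hc.mono (Ici_subset_Ici.2 hRT')).aestronglyMeasurable measurableSet_Ici) ?_
    refine (ae_restrict_iff' measurableSet_Ici).2 (ae_of_all _ fun t ht => ?_)
    have ht : R ≤ t := ht
    have hvt := hv0 t (hRT.trans ht)
    have hgt := hg0 t (hRT'.trans ht)
    have h3 := hS t (hRS.trans ht)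
    rw [Real.norm_of_nonneg (inv_nonneg.2 hgt.le)]
    rw [lt_div_iff₀ hvt] at h3
    rw [← div_eq_mul_inv, inv_eq_one_div, div_le_div_iff₀ hgt hvt]
    linarith
  have hIcc : IntegrableOn (fun t => (g t)⁻¹) (Icc T' R) :=
    (hc.mono Icc_subset_Ici_self).integrableOn_Icc
  rw [← Icc_union_Ici_eq_Ici hRT']
  exact hIcc.union hI

lemma tail_ratio {v g : ℝ → ℝ} {T T' : ℝ}
    (hv : IntegrableOn (fun t => (v t)⁻¹) (Ici T)) (hv0 : ∀ t ≥ T, 0 < v t)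
    (hg : IntegrableOn (fun t => (g t)⁻¹) (Ici T')) (hg0 : ∀ t ≥ T', 0 < g t)
    (hr : Tendsto (fun t => g t / v t) atTop (𝓝 1)) {ε : ℝ} (hε : 0 < ε) :
    ∀ᶠ t in atTop, (∫ s in Ici t, (g s)⁻¹) ≤ (1 + ε) * ∫ s in Ici t, (v s)⁻¹ ∧
      (∫ s in Ici t, (v s)⁻¹) ≤ (1 + ε) * ∫ s in Ici t, (g s)⁻¹ := by
  have h1 : ∀ᶠ t in atTop, 1 / (1 + ε) < g t / v t :=
    hr.eventually (lt_mem_nhds (by rw [div_lt_one (by linarith)]; linarith))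
  have h2 : ∀ᶠ t in atTop, g t / v t < 1 + ε := hr.eventually (gt_mem_nhds (by linarith))
  obtain ⟨S, hS⟩ := eventually_atTop.1 (h1.and h2)
  filter_upwards [eventually_ge_atTop S, eventually_ge_atTop T, eventually_ge_atTop T']
    with t h3 h4 h5
  have hvt := hv.mono_set (Ici_subset_Ici.2 h4)
  have hgt := hg.mono_set (Ici_subset_Ici.2 h5)
  constructor
  · rw [← integral_const_mul]
    refine tail_mono hgt (hvt.const_mul _) (fun s hs => ?_)
    have p1 := hv0 s (h4.trans hs)
    have p2 := hg0 s (h5.trans hs)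
    have := (hS s (h3.trans hs)).1
    rw [div_lt_div_iff₀ (by linarith) p1] at this
    rw [← div_eq_mul_inv, inv_eq_one_div, div_le_div_iff₀ p2 p1]
    linarith
  · rw [← integral_const_mul]
    refine tail_mono hvt (hgt.const_mul _) (fun s hs => ?_)
    have p1 := hv0 s (h4.trans hs)
    have p2 := hg0 s (h5.trans hs)
    have := (hS s (h3.trans hs)).2
    rw [div_lt_iff₀ p1] at this
    rw [← div_eq_mul_inv, inv_eq_one_div, div_le_div_iff₀ p1 p2]
    linarith

lemma blow_unif {N : ℕ} {f : ℝ → ℝ} {u : EuclideanSpace ℝ (Fin N) → ℝ} (hu : IsBlowUp f u)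
    (K : ℝ) : ∃ r < 1, ∀ x ∈ ball (0 : EuclideanSpace ℝ (Fin N)) 1, r ≤ ‖x‖ → K ≤ u x := by
  set W : Set (EuclideanSpace ℝ (Fin N)) := {x | x ∈ ball 0 1 → K ≤ u x} with hW
  have h1 : sphere (0 : EuclideanSpace ℝ (Fin N)) 1 ⊆ interior W := by
    intro x hx
    have h2 := (hu.2.2 x (by simpa using hx)).eventually (eventually_ge_atTop K)
    rw [eventually_nhdsWithin_iff] at h2
    exact mem_interior_iff_mem_nhds.2 h2
  obtain ⟨δ, hδ, hsub⟩ := (isCompact_sphere (0 : EuclideanSpace ℝ (Fin N)) 1).exists_thickening_subset_open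
    isOpen_interior h1
  refine ⟨max (1 / 2) (1 - δ / 2), max_lt (by norm_num) (by linarith), fun x hx hr => ?_⟩
  have hx1 : ‖x‖ < 1 := by simpa using hx
  have hxh : 1 / 2 ≤ ‖x‖ := (le_max_left _ _).trans hr
  have hxd : 1 - δ / 2 ≤ ‖x‖ := (le_max_right _ _).trans hr
  have hx0 : 0 < ‖x‖ := by linarith
  have : x ∈ thickening δ (sphere (0 : EuclideanSpace ℝ (Fin N)) 1) := by
    rw [mem_thickening_iff]
    refine ⟨‖x‖⁻¹ • x, ?_, ?_⟩
    · rw [mem_sphere_zero_iff_norm, norm_smul, norm_inv, norm_norm, inv_mul_cancel₀ hx0.ne']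
    · have : x - ‖x‖⁻¹ • x = (1 - ‖x‖⁻¹) • x := by rw [sub_smul, one_smul]
      rw [dist_eq_norm, this, norm_smul, Real.norm_eq_abs]
      have h4 : |1 - ‖x‖⁻¹| * ‖x‖ = |(1 - ‖x‖⁻¹) * ‖x‖| := by rw [abs_mul, abs_norm]
      rw [h4, sub_mul, inv_mul_cancel₀ hx0.ne', abs_lt]
      constructor <;> linarith
  exact interior_subset (hsub this) hx

lemma cmp_upper {N : ℕ} (hN : 1 ≤ N) {f : ℝ → ℝ} {u : EuclideanSpace ℝ (Fin N) → ℝ}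
    (hu : IsBlowUp f u) {g g' : ℝ → ℝ} {T t1 r1 A : ℝ} (hT : T < t1)
    (hg0 : ∀ t ≥ T, 0 < g t) (hgc : ContinuousOn g (Ici T)) (hgd : ∀ t > T, HasDerivAt g (g' t) t)
    (hgi : IntegrableOn (fun t => (g t)⁻¹) (Ici T))
    (hf : ∀ t > T, 0 ≤ f t) (hgg : ∀ t > T, g t * g' t = f t)
    (hr1 : 0 < r1) (hu1 : ∀ x ∈ ball (0 : EuclideanSpace ℝ (Fin N)) 1, r1 ≤ ‖x‖ → t1 ≤ u x)
    (hA : A = 1 / (2 * r1)) (hH : ∫ s in Ici t1, (g s)⁻¹ ≤ A * (1 - r1 ^ 2)) :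
    ∀ x ∈ ball (0 : EuclideanSpace ℝ (Fin N)) 1, r1 ≤ ‖x‖ →
      ∫ s in Ici (u x), (g s)⁻¹ ≤ A * (1 - ‖x‖ ^ 2) := by
  intro x hx hxr
  by_contra hcon
  push Not at hcon
  have hA0 : 0 < A := by rw [hA]; positivity
  have hx1 : ‖x‖ < 1 := by simpa using hx
  have hgic : ContinuousOn (fun t => (g t)⁻¹) (Ici T) := hgc.inv₀ (fun t ht => (hg0 t ht).ne')
  have hgi0 : ∀ t ≥ T, 0 ≤ (g t)⁻¹ := fun t ht => inv_nonneg.2 (hg0 t ht).le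
  set H : ℝ → ℝ := fun t => ∫ s in Ici t, (g s)⁻¹ with hHdef
  have hHd : ∀ t > T, HasDerivAt H (-(g t)⁻¹) t := fun t ht => tail_deriv hgi hgic ht
  set w : EuclideanSpace ℝ (Fin N) → ℝ :=
    fun x => 1 * (H (u x) - (A * (1 - ‖x‖ ^ 2) + 0 * (1 - ‖x‖ ^ 2) ^ 2)) with hw
  have hwx : 0 < w x := by simp only [hw, hHdef]; linarith
  obtain ⟨K, hK⟩ := eventually_atTop.1 ((tail_tendsto hgi).eventually (gt_mem_nhds hwx))
  obtain ⟨r, hr, hrK⟩ := blow_unif hu K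
  set r2 := max r ‖x‖ with hr2
  have hr21 : r2 < 1 := max_lt hr hx1
  set S : Set (EuclideanSpace ℝ (Fin N)) := {y | r1 ≤ ‖y‖} ∩ closedBall 0 r2 with hS
  have hScpt : IsCompact S :=
    (isCompact_closedBall 0 r2).inter_left (isClosed_le continuous_const continuous_norm)
  have hSb : ∀ y ∈ S, y ∈ ball (0 : EuclideanSpace ℝ (Fin N)) 1 := by
    intro y hy
    have : ‖y‖ ≤ r2 := by simpa using hy.2
    simpa using this.trans_lt hr21
  have hut : ∀ y ∈ S, T < u y := fun y hy => hT.trans_le (hu1 y (hSb y hy) hy.1)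
  have hcd : ∀ y ∈ S, ContDiffAt ℝ 2 u y := fun y hy =>
    hu.1.contDiffAt (isOpen_ball.mem_nhds (hSb y hy))
  have hwc : ContinuousOn w S := by
    intro y hy
    have h1 : ContinuousAt (fun x => H (u x)) y :=
      ContinuousAt.comp (f := u) (hHd _ (hut y hy)).continuousAt (hcd y hy).continuousAt
    have h2 : ContinuousAt (fun x : EuclideanSpace ℝ (Fin N) => A * (1 - ‖x‖ ^ 2) + 0 * (1 - ‖x‖ ^ 2) ^ 2) y := by
      fun_prop
    exact ((h1.sub h2).const_mul 1).continuousWithinAt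
  have hxS : x ∈ S := ⟨hxr, by simp [hr2]⟩
  obtain ⟨y, hyS, hym⟩ := hScpt.exists_isMaxOn ⟨x, hxS⟩ hwc
  have hwy : w x ≤ w y := hym hxS
  have hyb : ‖y‖ < 1 := by simpa using hSb y hyS
  have hy2 : ‖y‖ ≤ r2 := by simpa using hyS.2
  have hny : ‖y‖ ^ 2 ≤ 1 := by nlinarith [norm_nonneg y]
  have hy2' : ‖y‖ < r2 := by
    refine lt_of_le_of_ne hy2 fun he => ?_
    have h1 : K ≤ u y := hrK y (hSb y hyS) (by rw [he]; exact le_max_left _ _)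
    have h2 := hK _ h1
    have h3 : w y = H (u y) - A * (1 - ‖y‖ ^ 2) := by simp only [hw]; ring
    have : 0 ≤ A * (1 - ‖y‖ ^ 2) := mul_nonneg hA0.le (by linarith)
    linarith
  have hy1' : r1 < ‖y‖ := by
    refine lt_of_le_of_ne hyS.1 fun he => ?_
    have h1 : H (u y) ≤ H t1 := tail_anti hgi hgi0 hT.le (hu1 y (hSb y hyS) hyS.1)
    have h3 : w y = H (u y) - A * (1 - r1 ^ 2) := by simp only [hw, he]; ring
    linarith
  have hnb : S ∈ 𝓝 y := by
    refine inter_mem ?_ ?_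
    · filter_upwards [(isOpen_lt continuous_const continuous_norm).mem_nhds hy1'] with z hz
      exact le_of_lt hz
    · exact closedBall_mem_nhds_of_mem (by simpa using hy2')
  have hloc : IsLocalMax w y := hym.isLocalMax hnb
  have hty := hut y hyS
  have := point_test (hcd y hyS) (H := H) (g := g)
    (by filter_upwards [lt_mem_nhds hty] with t ht using hHd t ht) (hgd _ hty) (hg0 _ hty.le) hloc one_ne_zero
  rw [hu.2.1 y (hSb y hyS)] at this
  have hgy := hg0 _ hty.le
  have e1 : g' (u y) = f (u y) / g (u y) := by
    rw [eq_div_iff hgy.ne', ← hgg _ hty]; ring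
  have hq : 0 ≤ f (u y) / g (u y) := div_nonneg (hf _ hty) hgy.le
  have hA2 : 1 ≤ 4 * A ^ 2 * ‖y‖ ^ 2 := by
    have : 1 ≤ 2 * A * ‖y‖ := by
      rw [hA]; field_simp; exact hy1'.le
    nlinarith
  rw [e1, neg_div] at this
  have hNr : (1:ℝ) ≤ N := by exact_mod_cast hN
  have : 0 < (N:ℝ) * A := by positivity
  nlinarith [mul_nonneg hq (sub_nonneg.2 hA2)]

set_option maxHeartbeats 600000 in
lemma cmp_lower {N : ℕ} {f : ℝ → ℝ} {u : EuclideanSpace ℝ (Fin N) → ℝ}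
    (hu : IsBlowUp f u) {g g' : ℝ → ℝ} {T t1 r1 A B : ℝ} (hT : T < t1)
    (hg0 : ∀ t ≥ T, 0 < g t) (hgc : ContinuousOn g (Ici T)) (hgd : ∀ t > T, HasDerivAt g (g' t) t)
    (hgi : IntegrableOn (fun t => (g t)⁻¹) (Ici T))
    (hg' : ∀ t > T, 0 ≤ g' t) (hgg : ∀ t > T, g t * g' t ≤ f t)
    (hr1 : 0 < r1) (hu1 : ∀ x, ‖x‖ = r1 → u x < t1)
    (hA : 0 ≤ A) (hB : 0 < B) (hAB : A + 2 * B * (1 - r1 ^ 2) ≤ 1 / 2) (hBN : N < 8 * B * r1 ^ 2)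
    (hH : A * (1 - r1 ^ 2) + B * (1 - r1 ^ 2) ^ 2 ≤ ∫ s in Ici t1, (g s)⁻¹) :
    ∀ x ∈ ball (0 : EuclideanSpace ℝ (Fin N)) 1, r1 ≤ ‖x‖ → t1 ≤ u x →
      A * (1 - ‖x‖ ^ 2) + B * (1 - ‖x‖ ^ 2) ^ 2 ≤ ∫ s in Ici (u x), (g s)⁻¹ := by
  intro x hx hxr hxu
  by_contra hcon
  push Not at hcon
  have hx1 : ‖x‖ < 1 := by simpa using hx
  have hgic : ContinuousOn (fun t => (g t)⁻¹) (Ici T) := hgc.inv₀ (fun t ht => (hg0 t ht).ne')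
  have hgi0 : ∀ t ≥ T, 0 ≤ (g t)⁻¹ := fun t ht => inv_nonneg.2 (hg0 t ht).le
  set H : ℝ → ℝ := fun t => ∫ s in Ici t, (g s)⁻¹ with hHdef
  have hHd : ∀ t > T, HasDerivAt H (-(g t)⁻¹) t := fun t ht => tail_deriv hgi hgic ht
  set ψ : EuclideanSpace ℝ (Fin N) → ℝ :=
    fun x => A * (1 - ‖x‖ ^ 2) + B * (1 - ‖x‖ ^ 2) ^ 2 with hψ
  set w : EuclideanSpace ℝ (Fin N) → ℝ :=
    fun x => (-1) * (H (u x) - (A * (1 - ‖x‖ ^ 2) + B * (1 - ‖x‖ ^ 2) ^ 2)) with hw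
  have hwψ : ∀ x, w x = ψ x - H (u x) := fun x => by simp only [hw, hψ]; ring
  have hwx : 0 < w x := by rw [hwψ]; simp only [hψ, hHdef]; linarith
  have hpt : Tendsto (fun r : ℝ => A * (1 - r ^ 2) + B * (1 - r ^ 2) ^ 2) (𝓝 1) (𝓝 0) := by
    have : Continuous (fun r : ℝ => A * (1 - r ^ 2) + B * (1 - r ^ 2) ^ 2) := by fun_prop
    simpa using this.tendsto 1
  obtain ⟨r, hr, hrK⟩ : ∃ r < 1, ∀ s, r ≤ s → s < 1 → A * (1 - s ^ 2) + B * (1 - s ^ 2) ^ 2 < w x := by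
    obtain ⟨δ, hδ, h⟩ := Metric.eventually_nhds_iff.1 (hpt.eventually (gt_mem_nhds hwx))
    refine ⟨1 - δ / 2, by linarith, fun s hs hs1 => h ?_⟩
    rw [Real.dist_eq, abs_lt]; constructor <;> linarith
  set r2 := max r ‖x‖ with hr2
  have hr21 : r2 < 1 := max_lt hr hx1
  have hcd' : ∀ y ∈ ball (0 : EuclideanSpace ℝ (Fin N)) 1, ContDiffAt ℝ 2 u y := fun y hy =>
    hu.1.contDiffAt (isOpen_ball.mem_nhds hy)
  have hsubb : closedBall (0 : EuclideanSpace ℝ (Fin N)) r2 ⊆ ball 0 1 := closedBall_subset_ball hr21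
  set S : Set (EuclideanSpace ℝ (Fin N)) := {y | r1 ≤ ‖y‖} ∩ (closedBall 0 r2 ∩ u ⁻¹' (Ici t1)) with hS
  have hScpt : IsCompact S := by
    refine IsCompact.inter_left ?_ (isClosed_le continuous_const continuous_norm)
    refine IsCompact.of_isClosed_subset (isCompact_closedBall 0 r2) ?_ inter_subset_left
    refine ContinuousOn.preimage_isClosed_of_isClosed (fun y hy => ?_) isClosed_closedBall isClosed_Ici
    exact (hcd' y (hsubb hy)).continuousAt.continuousWithinAt
  have hSb : ∀ y ∈ S, y ∈ ball (0 : EuclideanSpace ℝ (Fin N)) 1 := fun y hy => hsubb hy.2.1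
  have hut : ∀ y ∈ S, T < u y := fun y hy => hT.trans_le hy.2.2
  have hcd : ∀ y ∈ S, ContDiffAt ℝ 2 u y := fun y hy => hcd' y (hSb y hy)
  have hwc : ContinuousOn w S := by
    intro y hy
    have h1 : ContinuousAt (fun x => H (u x)) y :=
      ContinuousAt.comp (f := u) (hHd _ (hut y hy)).continuousAt (hcd y hy).continuousAt
    have h2 : ContinuousAt (fun x : EuclideanSpace ℝ (Fin N) => A * (1 - ‖x‖ ^ 2) + B * (1 - ‖x‖ ^ 2) ^ 2) y := by
      fun_prop
    exact ((h1.sub h2).const_mul (-1)).continuousWithinAt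
  have hxS : x ∈ S := ⟨hxr, by simp [hr2], hxu⟩
  obtain ⟨y, hyS, hym⟩ := hScpt.exists_isMaxOn ⟨x, hxS⟩ hwc
  have hwy : w x ≤ w y := hym hxS
  have hyb : ‖y‖ < 1 := by simpa using hSb y hyS
  have hy2 : ‖y‖ ≤ r2 := by simpa using hyS.2.1
  have hny : ‖y‖ ^ 2 ≤ 1 := by nlinarith [norm_nonneg y]
  have hHnn : 0 ≤ H (u y) := tail_nonneg fun s hs => hgi0 s ((hut y hyS).le.trans hs)
  have hy2' : ‖y‖ < r2 := by
    refine lt_of_le_of_ne hy2 fun he => ?_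
    have h2 := hrK ‖y‖ (by rw [he]; exact le_max_left _ _) hyb
    have h3 := hwψ y
    simp only [hψ] at h3
    linarith
  have hy1' : r1 < ‖y‖ := by
    refine lt_of_le_of_ne hyS.1 fun he => ?_
    have h1 : t1 ≤ u y := hyS.2.2
    linarith [hu1 y he.symm]
  have hsq : r1 ^ 2 ≤ ‖y‖ ^ 2 := by gcongr
  have hyt : t1 < u y := by
    refine lt_of_le_of_ne hyS.2.2 fun he => ?_
    have h3 := hwψ y
    rw [← he] at h3
    have h4 : ψ y ≤ A * (1 - r1 ^ 2) + B * (1 - r1 ^ 2) ^ 2 := by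
      simp only [hψ]
      have : 0 ≤ 1 - ‖y‖ ^ 2 := by linarith
      gcongr
    have h5 : H t1 = ∫ s in Ici t1, (g s)⁻¹ := rfl
    linarith
  have hnb : S ∈ 𝓝 y := by
    refine inter_mem ?_ (inter_mem ?_ ?_)
    · filter_upwards [(isOpen_lt continuous_const continuous_norm).mem_nhds hy1'] with z hz
      exact le_of_lt hz
    · exact closedBall_mem_nhds_of_mem (by simpa using hy2')
    · exact (hcd y hyS).continuousAt (Ici_mem_nhds hyt)
  have hloc : IsLocalMax w y := hym.isLocalMax hnb
  have hty := hut y hyS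
  have ptest := point_test (hcd y hyS) (H := H) (g := g)
    (by filter_upwards [lt_mem_nhds hty] with t ht using hHd t ht) (hgd _ hty) (hg0 _ hty.le) hloc
    (by norm_num)
  rw [hu.2.1 y (hSb y hyS), neg_div] at ptest
  have hgy := hg0 _ hty.le
  have e1 : g' (u y) ≤ f (u y) / g (u y) := by
    rw [le_div_iff₀ hgy]; linarith [hgg _ hty]
  set h1 : ℝ := A + 2 * B * (1 - ‖y‖ ^ 2) with hh1
  have hh0 : 0 ≤ h1 := by
    have : 0 ≤ 1 - ‖y‖ ^ 2 := by linarith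
    positivity
  have hh2 : h1 ≤ 1 / 2 := by
    have : 2 * B * (1 - ‖y‖ ^ 2) ≤ 2 * B * (1 - r1 ^ 2) := by gcongr
    linarith
  have hth : 4 * h1 ^ 2 * ‖y‖ ^ 2 ≤ 1 := by
    have h4 : 4 * h1 ^ 2 ≤ 1 := by nlinarith only [hh0, hh2]
    exact mul_le_one₀ h4 (sq_nonneg _) hny
  have hB2 : 8 * B * r1 ^ 2 ≤ 8 * B * ‖y‖ ^ 2 := by gcongr
  have hNh : 2 * (N:ℝ) * h1 ≤ N := by
    have : (0:ℝ) ≤ N := by positivity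
    nlinarith only [this, hh2]
  have hlast := mul_le_of_le_one_right (hg' _ hty) hth
  linarith only [hlast, ptest, e1, hB2, hNh, hBN]


lemma F_mono {f F : ℝ → ℝ} {a : ℝ} (hFd : ∀ t, HasDerivAt F (f t) t) (hf0 : ∀ t > a, 0 ≤ f t) :
    MonotoneOn F (Ici a) := by
  apply monotoneOn_of_deriv_nonneg (convex_Ici a)
  · intro t _; exact (hFd t).continuousAt.continuousWithinAt
  · intro t _; exact (hFd t).differentiableAt.differentiableWithinAt
  · intro t ht; rw [interior_Ici] at ht; rw [(hFd t).deriv]; exact hf0 t ht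

lemma v_cont {f F : ℝ → ℝ} (hFd : ∀ t, HasDerivAt F (f t) t) :
    Continuous (fun t => Real.sqrt (2 * F t)) := by
  have : Continuous F := continuous_iff_continuousAt.2 fun t => (hFd t).continuousAt
  fun_prop

lemma v_lin {f F : ℝ → ℝ} {a T : ℝ} (hFd : ∀ t, HasDerivAt F (f t) t) (hf0 : ∀ t > a, 0 ≤ f t)
    (haT : a < T) (hFp : ∀ t ≥ T, 0 < F t)
    (hv : IntegrableOn (fun t => (Real.sqrt (2 * F t))⁻¹) (Ici T)) :
    Tendsto (fun t => t / Real.sqrt (2 * F t)) atTop (𝓝 0) := by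
  have hm := F_mono hFd hf0
  have h1 : Tendsto (fun t : ℝ => 2 * ∫ s in Ici (t / 2), (Real.sqrt (2 * F s))⁻¹) atTop (𝓝 0) := by
    have := ((tail_tendsto hv).comp (tendsto_id.atTop_div_const (r := (2:ℝ)) (by norm_num))).const_mul 2
    simpa using this
  refine squeeze_zero' ?_ ?_ h1
  · filter_upwards [eventually_ge_atTop 0] with t ht
    positivity
  · filter_upwards [eventually_ge_atTop 0, eventually_ge_atTop (2 * T)] with t ht htT
    have h2 : T ≤ t / 2 := by linarith
    have h3 := tail_sub hv h2 (by linarith : T ≤ t)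
    have h4 : 0 ≤ ∫ s in Ici t, (Real.sqrt (2 * F s))⁻¹ := tail_nonneg fun s _ => by positivity
    have hle : t / 2 ≤ t := by linarith
    have h5 : ∫ s in (t/2)..t, (Real.sqrt (2 * F t))⁻¹ ≤ ∫ s in (t/2)..t, (Real.sqrt (2 * F s))⁻¹ := by
      apply intervalIntegral.integral_mono_on hle
      · exact intervalIntegrable_const
      · rw [intervalIntegrable_iff_integrableOn_Icc_of_le hle]
        exact hv.mono_set (fun z hz => h2.trans hz.1)
      · intro s hs
        have p1 := hFp s (h2.trans hs.1)
        have p2 : F s ≤ F t := hm (by simp; linarith [hs.1]) (by simp; linarith) hs.2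
        gcongr
    rw [intervalIntegral.integral_const, smul_eq_mul] at h5
    rw [div_eq_mul_inv]
    linarith

lemma F_top {f F : ℝ → ℝ} {a T : ℝ} (hFd : ∀ t, HasDerivAt F (f t) t) (hf0 : ∀ t > a, 0 ≤ f t)
    (haT : a < T) (hFp : ∀ t ≥ T, 0 < F t)
    (hv : IntegrableOn (fun t => (Real.sqrt (2 * F t))⁻¹) (Ici T)) :
    Tendsto F atTop atTop := by
  have h := (v_lin hFd hf0 haT hFp hv).eventually (gt_mem_nhds (zero_lt_one))
  refine tendsto_atTop_mono' atTop (f₁ := fun t => t / 2) ?_ (tendsto_id.atTop_div_const (by norm_num))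
  filter_upwards [h, eventually_ge_atTop 1, eventually_ge_atTop T] with t h1 h2 h3
  have p := hFp t h3
  rw [div_lt_one (by positivity), Real.lt_sqrt (by linarith)] at h1
  nlinarith

lemma ratio_sqrt {F J : ℝ → ℝ} (hFt : Tendsto F atTop atTop)
    (hJ : Tendsto (fun t => J t / F t) atTop (𝓝 1)) :
    Tendsto (fun t => Real.sqrt (2 * J t) / Real.sqrt (2 * F t)) atTop (𝓝 1) := by
  have h1 := (Real.continuous_sqrt.tendsto 1).comp hJ
  rw [Real.sqrt_one] at h1
  refine h1.congr' ?_
  filter_upwards [hFt.eventually_gt_atTop 0] with t ht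
  rw [← Real.sqrt_div' _ (by positivity)]
  simp only [Function.comp]
  congr 1
  field_simp

lemma upper_bd {N : ℕ} (hN : 1 ≤ N) {f F : ℝ → ℝ} {u : EuclideanSpace ℝ (Fin N) → ℝ}
    (hu : IsBlowUp f u) {a T : ℝ} (hFd : ∀ t, HasDerivAt F (f t) t) (hf0 : ∀ t > a, 0 ≤ f t)
    (haT : a < T) (hFp : ∀ t ≥ T, 0 < F t)
    (hv : IntegrableOn (fun t => (Real.sqrt (2 * F t))⁻¹) (Ici T)) {ε : ℝ} (hε : 0 < ε) :
    ∃ r < 1, ∀ x ∈ ball (0 : EuclideanSpace ℝ (Fin N)) 1, r ≤ ‖x‖ →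
      ∫ s in Ici (u x), (Real.sqrt (2 * F s))⁻¹ ≤ (1 + ε) ^ 2 * (1 - ‖x‖) := by
  have hFt := F_top hFd hf0 haT hFp hv
  obtain ⟨r', hr', hur'⟩ := blow_unif hu (T + 1)
  set r1 := max r' (1 / (1 + ε)) with hr1
  have hr11 : r1 < 1 := max_lt hr' (by rw [div_lt_one (by linarith)]; linarith)
  have hr1e : 1 / (1 + ε) ≤ r1 := le_max_right _ _
  have hr10 : 0 < r1 := lt_of_lt_of_le (by positivity) hr1e
  set A := 1 / (2 * r1) with hA
  have hA0 : 0 < A := by positivity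
  set β := A * (1 - r1 ^ 2) with hβ
  have hβ0 : 0 < β := mul_pos hA0 (by nlinarith)
  obtain ⟨M2, hM2a, hM2⟩ : ∃ M2, T + 1 ≤ M2 ∧ ∫ s in Ici M2, (Real.sqrt (2 * F s))⁻¹ ≤ β / 2 := by
    obtain ⟨M, h1, h2⟩ := ((eventually_ge_atTop (T + 1)).and
      ((tail_tendsto hv).eventually (gt_mem_nhds (by positivity : 0 < β / 2)))).exists
    exact ⟨M, h1, h2.le⟩
  set D := 2 * (M2 - (T + 1)) / β with hD
  have hD0 : 0 ≤ D := div_nonneg (by linarith) hβ0.le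
  set c := (D ^ 2 + 1) / 2 with hc
  have hc0 : 0 < c := by positivity
  set g : ℝ → ℝ := fun t => Real.sqrt (2 * (F t + c)) with hg
  have hpos : ∀ t ≥ T, 0 < 2 * (F t + c) := fun t ht => by linarith [hFp t ht]
  have hg0 : ∀ t ≥ T, 0 < g t := fun t ht => Real.sqrt_pos.2 (hpos t ht)
  have hFc : Continuous F := continuous_iff_continuousAt.2 fun t => (hFd t).continuousAt
  have hgc : ContinuousOn g (Ici T) := by
    have : Continuous g := by fun_prop
    exact this.continuousOn
  have hratio : Tendsto (fun t => g t / Real.sqrt (2 * F t)) atTop (𝓝 1) := by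
    apply ratio_sqrt hFt (J := fun t => F t + c)
    have h1 : Tendsto (fun t => 1 + c / F t) atTop (𝓝 (1 + 0)) :=
      (hFt.const_div_atTop c).const_add 1
    rw [add_zero] at h1
    refine h1.congr' ?_
    filter_upwards [hFt.eventually_gt_atTop 0] with t ht
    field_simp
  have hv0 : ∀ t ≥ T, 0 < Real.sqrt (2 * F t) := fun t ht =>
    Real.sqrt_pos.2 (by linarith [hFp t ht])
  have hgi := integrable_of_ratio hv hv0 hgc hg0 hratio
  have hH : ∫ s in Ici (T + 1), (g s)⁻¹ ≤ A * (1 - r1 ^ 2) := by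
    have h1 := tail_sub hgi (by linarith : T ≤ T + 1) (by linarith : T ≤ M2)
    have h2 : ∫ s in Ici M2, (g s)⁻¹ ≤ ∫ s in Ici M2, (Real.sqrt (2 * F s))⁻¹ := by
      have hTM : T ≤ M2 := by linarith
      refine tail_mono (hgi.mono_set (Ici_subset_Ici.2 hTM)) (hv.mono_set (Ici_subset_Ici.2 hTM)) ?_
      intro s hs
      have := hv0 s (hTM.trans hs)
      simp only [hg]
      gcongr
      linarith
    have h3 : ∫ s in (T+1)..M2, (g s)⁻¹ ≤ β / 2 := by
      rcases hM2a.eq_or_lt with he | hlt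
      · rw [← he]; simp; positivity
      have hDp : 0 < D := div_pos (by linarith) hβ0
      have h4 : ∫ s in (T+1)..M2, (g s)⁻¹ ≤ ∫ s in (T+1)..M2, D⁻¹ := by
        apply intervalIntegral.integral_mono_on hM2a
        · rw [intervalIntegrable_iff_integrableOn_Icc_of_le hM2a]
          exact hgi.mono_set (fun z hz => by simp; linarith [hz.1])
        · exact intervalIntegrable_const
        · intro s hs
          have p := hFp s (by linarith [hs.1])
          have : D ≤ g s := by
            apply Real.le_sqrt_of_sq_le
            rw [hc]; linarith
          gcongr
      rw [intervalIntegral.integral_const, smul_eq_mul] at h4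
      refine h4.trans (le_of_eq ?_)
      have : M2 - (T + 1) ≠ 0 := by linarith
      rw [hD]; field_simp
    linarith
  have hgd : ∀ t > T, HasDerivAt g (f t / g t) t := by
    intro t ht
    have := (((hFd t).add_const c).const_mul 2).sqrt (hpos t ht.le).ne'
    refine HasDerivAt.congr_deriv this ?_
    have := (hg0 t ht.le).ne'
    simp only [hg] at this ⊢
    field_simp
  have key := cmp_upper hN hu (T := T) (t1 := T + 1) (r1 := r1) (A := A) (by linarith) hg0 hgc hgd hgi
    (fun t ht => hf0 t (haT.trans ht))
    (fun t ht => by have := (hg0 t ht.le).ne'; field_simp) hr10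
    (fun x hx h => hur' x hx ((le_max_left _ _).trans h)) hA hH
  obtain ⟨K, hK⟩ := eventually_atTop.1 (tail_ratio hv hv0 hgi hg0 hratio hε)
  obtain ⟨r3, hr3, hr3K⟩ := blow_unif hu K
  refine ⟨max r1 r3, max_lt hr11 hr3, fun x hx hxr => ?_⟩
  have h1 := key x hx ((le_max_left _ _).trans hxr)
  have h2 := (hK _ (hr3K x hx ((le_max_right _ _).trans hxr))).2
  have hx1 : ‖x‖ < 1 := by simpa using hx
  have h3 : A * (1 - ‖x‖ ^ 2) ≤ (1 + ε) * (1 - ‖x‖) := by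
    have h4 : A ≤ (1 + ε) / 2 := by
      rw [hA]
      rw [div_le_iff₀ (by linarith)] at hr1e
      rw [div_le_div_iff₀ (by positivity) (by norm_num)]
      linarith
    have h5 : 1 - ‖x‖ ^ 2 ≤ 2 * (1 - ‖x‖) := by nlinarith
    calc A * (1 - ‖x‖ ^ 2) ≤ (1 + ε) / 2 * (2 * (1 - ‖x‖)) := by
          apply mul_le_mul h4 h5 (by nlinarith [norm_nonneg x]) (by positivity)
      _ = _ := by ring
  calc _ ≤ (1 + ε) * ∫ s in Ici (u x), (g s)⁻¹ := h2
    _ ≤ (1 + ε) * ((1 + ε) * (1 - ‖x‖)) := by gcongr; exact h1.trans h3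
    _ = _ := by ring

lemma lower_bd {N : ℕ} (hN : 1 ≤ N) {f F : ℝ → ℝ} (hf : Continuous f) {u : EuclideanSpace ℝ (Fin N) → ℝ}
    (hu : IsBlowUp f u) {a T : ℝ} (hFd : ∀ t, HasDerivAt F (f t) t) (hf0 : ∀ t > a, 0 ≤ f t)
    (haT : a < T) (hFp : ∀ t ≥ T, 0 < F t)
    (hv : IntegrableOn (fun t => (Real.sqrt (2 * F t))⁻¹) (Ici T)) {ε : ℝ} (hε : 0 < ε) (hε1 : ε < 1) :
    ∃ r < 1, ∀ x ∈ ball (0 : EuclideanSpace ℝ (Fin N)) 1, r ≤ ‖x‖ →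
      (1 - ε) ^ 2 * (1 - ‖x‖) ≤ (1 + ε) * ∫ s in Ici (u x), (Real.sqrt (2 * F s))⁻¹ := by
  have hFt := F_top hFd hf0 haT hFp hv
  have hFm := F_mono hFd hf0
  have hNr : (1:ℝ) ≤ N := by exact_mod_cast hN
  have hv0 : ∀ t ≥ T, 0 < Real.sqrt (2 * F t) := fun t ht =>
    Real.sqrt_pos.2 (by linarith [hFp t ht])
  set r1 : ℝ := 1 - ε / (8 * N) with hr1
  have hεN : 0 < ε / (8 * N) := by positivity
  have hεN1 : ε / (8 * N) ≤ 1 / 8 := by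
    rw [div_le_div_iff₀ (by positivity) (by norm_num)]; nlinarith
  have hr11 : r1 < 1 := by linarith
  have hr1h : 7 / 8 ≤ r1 := by linarith
  have hsq : N * (1 - r1 ^ 2) ≤ ε / 4 := by
    have h1 : 1 - r1 ^ 2 ≤ 2 * (ε / (8 * N)) := by nlinarith
    calc N * (1 - r1 ^ 2) ≤ N * (2 * (ε / (8 * N))) := by gcongr
      _ = ε / 4 := by field_simp; norm_num
  have hsq0 : 0 < 1 - r1 ^ 2 := by nlinarith
  -- bound of u on the sphere
  obtain ⟨b, hbT, hbu⟩ : ∃ b, T ≤ b ∧ ∀ x, ‖x‖ = r1 → u x ≤ b := by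
    have hcont : ContinuousOn u (sphere (0 : EuclideanSpace ℝ (Fin N)) r1) := by
      refine hu.1.continuousOn.mono fun x hx => ?_
      have : ‖x‖ = r1 := by simpa using hx
      simpa [this] using hr11
    obtain ⟨C, hC⟩ := (isCompact_sphere (0 : EuclideanSpace ℝ (Fin N)) r1).bddAbove_image hcont
    refine ⟨max T C, le_max_left _ _, fun x hx => ?_⟩
    exact (hC ⟨x, by simpa using hx, rfl⟩).trans (le_max_right _ _)
  obtain ⟨C, hC⟩ : ∃ C, ∀ t ∈ Icc b (b + 1), f t ≤ C := by
    obtain ⟨C, hC⟩ := (isCompact_Icc (a := b) (b := b + 1)).bddAbove_image hf.continuousOn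
    exact ⟨C, fun t ht => hC ⟨t, ht, rfl⟩⟩
  have hC0 : 0 ≤ C := (hf0 (b + 1) (by linarith)).trans (hC _ ⟨by linarith, le_rfl⟩)
  set D := 2 * C + 1 with hD
  have hD1 : 1 ≤ D := by linarith
  set δ := 1 / (2 * D ^ 3) with hδ
  have hD3 : 1 ≤ D ^ 3 := one_le_pow₀ hD1
  have hδ0 : 0 < δ := by positivity
  have hδ1 : δ ≤ 1 / 2 := by
    rw [hδ, div_le_div_iff₀ (by positivity) (by norm_num)]; linarith
  have hab : a < b := haT.trans_le hbT
  set q : ℝ → ℝ := fun t => F t - F b + δ with hq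
  have hq0 : ∀ t ≥ b, δ ≤ q t := fun t ht => by
    have := hFm (by simp; exact hab.le) (by simp; linarith) ht
    simp only [hq]; linarith
  have hqp : ∀ t ≥ b, 0 < q t := fun t ht => hδ0.trans_le (hq0 t ht)
  have hqd : ∀ t, HasDerivAt q (f t) t := fun t => ((hFd t).sub_const (F b)).add_const δ
  have hqC : ∀ t ∈ Icc b (b + 2 * δ), q t ≤ D * δ := by
    intro t ht
    have h1 : F t - F b ≤ C * (t - b) := by
      refine Convex.image_sub_le_mul_sub_of_deriv_le (convex_Icc b (b + 1))
        (fun t _ => (hFd t).continuousAt.continuousWithinAt)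
        (fun t _ => (hFd t).differentiableAt.differentiableWithinAt)
        (fun s hs => ?_) b ⟨le_rfl, by linarith⟩ t ⟨ht.1, by linarith [ht.2]⟩ ht.1
      rw [(hFd s).deriv]; exact hC s (interior_subset hs)
    have h2 : C * (t - b) ≤ C * (2 * δ) := by gcongr; linarith [ht.2]
    simp only [hq, hD]; linarith
  set J : ℝ → ℝ := fun t => q t ^ 3 / (1 + q t) ^ 2 with hJ
  have hJp : ∀ t ≥ b, 0 < J t := fun t ht => by have := hqp t ht; simp only [hJ]; positivity
  set g : ℝ → ℝ := fun t => Real.sqrt (2 * J t) with hg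
  have hg0 : ∀ t ≥ b, 0 < g t := fun t ht => Real.sqrt_pos.2 (by linarith [hJp t ht])
  set J' : ℝ → ℝ := fun t => (q t ^ 3 + 3 * q t ^ 2) / (1 + q t) ^ 3 with hJ'
  have hJd : ∀ t ≥ b, HasDerivAt J (J' t * f t) t := by
    intro t ht
    have hp := hqp t ht
    have h1 := ((hqd t).pow 3).div (((hqd t).const_add 1).pow 2)
      (pow_ne_zero 2 (by positivity : (1 + q t) ≠ 0))
    refine HasDerivAt.congr_deriv h1 ?_
    simp only [hJ', Pi.pow_apply]
    field_simp
    push_cast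
    ring
  have hJ'0 : ∀ t ≥ b, 0 ≤ J' t := fun t ht => by have := hqp t ht; simp only [hJ']; positivity
  have hJ'1 : ∀ t ≥ b, J' t ≤ 1 := fun t ht => by
    have := hqp t ht
    simp only [hJ']
    rw [div_le_one (by positivity)]
    nlinarith
  have hgd : ∀ t > b, HasDerivAt g (J' t * f t / g t) t := by
    intro t ht
    have := ((hJd t ht.le).const_mul 2).sqrt (by linarith [hJp t ht.le])
    refine HasDerivAt.congr_deriv this ?_
    have := (hg0 t ht.le).ne'
    simp only [hg] at this ⊢
    field_simp
  have hgc : ContinuousOn g (Ici b) := by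
    intro t ht
    exact ((hJd t ht).continuousAt.const_mul 2).sqrt.continuousWithinAt
  have hratio : Tendsto (fun t => g t / Real.sqrt (2 * F t)) atTop (𝓝 1) := by
    apply ratio_sqrt hFt (J := J)
    have hqt : Tendsto q atTop atTop := by
      have := tendsto_atTop_add_const_right atTop (-F b + δ) hFt
      refine this.congr fun t => ?_
      simp only [hq]; ring
    have h1 : Tendsto (fun t => (1 + (-F b + δ) / F t) * (1 - 1 / (1 + q t)) ^ 2) atTop
        (𝓝 ((1 + 0) * (1 - 0) ^ 2)) := by
      refine Tendsto.mul ((hFt.const_div_atTop _).const_add 1) (Tendsto.pow (Tendsto.const_sub 1 ?_) 2)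
      exact (tendsto_atTop_add_const_left atTop 1 hqt).const_div_atTop 1
    norm_num at h1
    refine h1.congr' ?_
    filter_upwards [hFt.eventually_gt_atTop 0, eventually_ge_atTop b] with t ht htb
    have hp := hqp t htb
    have e : (1 + (-F b + δ) / F t) = q t / F t := by
      simp only [hq]; field_simp; ring
    rw [e]
    simp only [hJ]
    field_simp
    ring
  have hgi := integrable_of_ratio hv hv0 hgc hg0 hratio
  have hH1 : 1 ≤ ∫ s in Ici (b + δ), (g s)⁻¹ := by
    have h1 := tail_sub hgi (by linarith : b ≤ b + δ) (by linarith : b ≤ b + 2 * δ)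
    have h2 : 0 ≤ ∫ s in Ici (b + 2 * δ), (g s)⁻¹ :=
      tail_nonneg fun s _ => inv_nonneg.2 (Real.sqrt_nonneg _)
    have hle : b + δ ≤ b + 2 * δ := by linarith
    have h3 : ∫ s in (b + δ)..(b + 2 * δ), δ⁻¹ ≤ ∫ s in (b + δ)..(b + 2 * δ), (g s)⁻¹ := by
      apply intervalIntegral.integral_mono_on hle
      · exact intervalIntegrable_const
      · rw [intervalIntegrable_iff_integrableOn_Icc_of_le hle]
        exact hgi.mono_set (fun z hz => by simp; linarith [hz.1])
      · intro s hs
        have hsb : b ≤ s := by linarith [hs.1]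
        have hp := hqp s hsb
        have h4 : g s ≤ δ := by
          apply Real.sqrt_le_iff.2 ⟨hδ0.le, ?_⟩
          have h5 : J s ≤ q s ^ 3 := by
            simp only [hJ]
            apply div_le_self (by positivity)
            nlinarith
          have h6 : q s ^ 3 ≤ (D * δ) ^ 3 := by
            gcongr; exact hqC s ⟨hsb, hs.2⟩
          have h7 : 2 * (D * δ) ^ 3 = δ ^ 2 := by
            have : 2 * D ^ 3 * δ = 1 := by rw [hδ]; field_simp
            calc 2 * (D * δ) ^ 3 = (2 * D ^ 3 * δ) * δ ^ 2 := by ring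
              _ = _ := by rw [this, one_mul]
          linarith
        have := hg0 s hsb
        gcongr
    rw [intervalIntegral.integral_const, smul_eq_mul] at h3
    have h8 : (b + 2 * δ - (b + δ)) * δ⁻¹ = 1 := by field_simp; ring
    linarith
  have key := cmp_lower hu (T := b) (t1 := b + δ) (r1 := r1) (A := (1 - ε) / 2) (B := N)
    (by linarith) hg0 hgc hgd hgi
    (fun t ht => div_nonneg (mul_nonneg (hJ'0 t ht.le) (hf0 t (hab.trans ht))) (hg0 t ht.le).le)
    (fun t ht => by
      rw [mul_div_cancel₀ _ (hg0 t ht.le).ne']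
      exact mul_le_of_le_one_left (hf0 t (hab.trans ht)) (hJ'1 t ht.le))
    (by linarith) (fun x hx => by linarith [hbu x hx]) (by linarith) (by linarith)
    (by linarith) (by nlinarith)
    (by nlinarith)
  obtain ⟨K, hK⟩ := eventually_atTop.1 (tail_ratio hv hv0 hgi hg0 hratio hε)
  obtain ⟨r3, hr3, hr3K⟩ := blow_unif hu (max K (b + δ))
  refine ⟨max r1 (max (1 - ε) r3), max_lt hr11 (max_lt (by linarith) hr3), fun x hx hxr => ?_⟩
  have hx3 : r3 ≤ ‖x‖ := (le_max_right _ _).trans ((le_max_right _ _).trans hxr)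
  have hxe : 1 - ε ≤ ‖x‖ := (le_max_left _ _).trans ((le_max_right _ _).trans hxr)
  have h1 := key x hx ((le_max_left _ _).trans hxr) ((le_max_right _ _).trans (hr3K x hx hx3))
  have h2 := (hK _ ((le_max_left _ _).trans (hr3K x hx hx3))).1
  have hx1 : ‖x‖ < 1 := by simpa using hx
  refine le_trans ?_ (h1.trans h2)
  have h4 : 0 ≤ (N:ℝ) * (1 - ‖x‖ ^ 2) ^ 2 := by positivity
  have h5 : (1 - ε) ^ 2 * (1 - ‖x‖) ≤ (1 - ε) / 2 * (1 - ‖x‖ ^ 2) := by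
    have h6 : 0 ≤ (1 - ε) * (1 - ‖x‖) := mul_nonneg (by linarith) (by linarith)
    nlinarith [mul_nonneg h6 (by linarith : (0:ℝ) ≤ 1 + ‖x‖ - 2 * (1 - ε))]
  linarith


lemma vIter_asymp {N : ℕ} {f F : ℝ → ℝ} {a T : ℝ} (U₀ : ℝ)
    (hFd : ∀ t, HasDerivAt F (f t) t) (hf0 : ∀ t > a, 0 ≤ f t)
    (haT : a < T) (hFp : ∀ t ≥ T, 0 < F t)
    (hv : IntegrableOn (fun t => (Real.sqrt (2 * F t))⁻¹) (Ici T)) (k : ℕ) :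
    (∃ S, ContinuousOn (vIter N F U₀ k) (Ici S)) ∧
      Tendsto (fun t => vIter N F U₀ k t / Real.sqrt (2 * F t)) atTop (𝓝 1) := by
  have hFt := F_top hFd hf0 haT hFp hv
  have hFm := F_mono hFd hf0
  have hlin := v_lin hFd hf0 haT hFp hv
  have hFc : Continuous F := continuous_iff_continuousAt.2 fun t => (hFd t).continuousAt
  have hv0 : ∀ t ≥ T, 0 < Real.sqrt (2 * F t) := fun t ht =>
    Real.sqrt_pos.2 (by linarith [hFp t ht])
  induction k with
  | zero =>
    refine ⟨⟨T, (v_cont hFd).continuousOn⟩, ?_⟩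
    refine (tendsto_const_nhds (x := (1:ℝ))).congr' ?_
    filter_upwards [eventually_ge_atTop T] with t ht
    simp only [vIter]
    exact (div_self (hv0 t ht).ne').symm
  | succ k ih =>
    obtain ⟨⟨S, hS⟩, hr⟩ := ih
    set v := vIter N F U₀ k with hvdef
    have e1 : ∀ᶠ t in atTop, 1 / 2 < v t / Real.sqrt (2 * F t) :=
      hr.eventually (lt_mem_nhds (by norm_num))
    have e2 : ∀ᶠ t in atTop, v t / Real.sqrt (2 * F t) < 2 :=
      hr.eventually (gt_mem_nhds (by norm_num))
    obtain ⟨S1, hS1⟩ := eventually_atTop.1 (e1.and e2)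
    set S2 := max S (max T S1) with hS2
    have hS2S : S ≤ S2 := le_max_left _ _
    have hS2T : T ≤ S2 := (le_max_left _ _).trans (le_max_right _ _)
    have hS2S1 : S1 ≤ S2 := (le_max_right _ _).trans (le_max_right _ _)
    have hvp : ∀ t ≥ S2, 0 < v t := by
      intro t ht
      have p := hv0 t (hS2T.trans ht)
      have := (hS1 t (hS2S1.trans ht)).1
      rw [lt_div_iff₀ p] at this
      linarith
    have hvu : ∀ t ≥ S2, v t ≤ 2 * Real.sqrt (2 * F t) := by
      intro t ht
      have p := hv0 t (hS2T.trans ht)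
      have := (hS1 t (hS2S1.trans ht)).2
      rw [div_lt_iff₀ p] at this
      exact this.le
    have hvc : ContinuousOn v (Ici S2) := hS.mono (Ici_subset_Ici.2 hS2S)
    have hvi := integrable_of_ratio hv hv0 hvc hvp hr
    set j : ℝ → ℝ := fun t => ∫ s in Ici t, (v s)⁻¹ with hj
    have hjt : Tendsto j atTop (𝓝 0) := tail_tendsto hvi
    obtain ⟨S3, hS3⟩ := eventually_atTop.1 (hjt.eventually (gt_mem_nhds (by norm_num : (0:ℝ) < 1/2)))
    set R := max (max S3 (S2 + 1)) (max U₀ 0) with hR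
    have hRS3 : S3 ≤ R := (le_max_left _ _).trans (le_max_left _ _)
    have hRS2 : S2 + 1 ≤ R := (le_max_right _ _).trans (le_max_left _ _)
    have hRU : U₀ ≤ R := (le_max_left _ _).trans (le_max_right _ _)
    have hR0 : 0 ≤ R := (le_max_right _ _).trans (le_max_right _ _)
    set h : ℝ → ℝ := fun t => v t / (1 - j t) with hh
    have hjd : ∀ t > S2, HasDerivAt j (-(v t)⁻¹) t := fun t ht =>
      tail_deriv hvi (hvc.inv₀ fun t ht => (hvp t ht).ne') ht
    have hj2 : ∀ t ≥ R, 1 / 2 ≤ 1 - j t := fun t ht => by linarith [hS3 t (hRS3.trans ht)]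
    have hhc : ContinuousOn h (Ici R) := by
      refine ContinuousOn.div (hvc.mono (Ici_subset_Ici.2 (by linarith))) ?_ ?_
      · intro t ht
        have ht : R ≤ t := ht
        exact (continuousAt_const.sub (hjd t (by linarith)).continuousAt).continuousWithinAt
      · intro t ht
        linarith [hj2 t ht]
    have hhb : ∀ t ≥ R, |h t| ≤ 4 * Real.sqrt (2 * F t) := by
      intro t ht
      have p1 := hvp t (by linarith)
      have p2 := hj2 t ht
      have p3 := hvu t (by linarith)
      have p4 := hv0 t (by linarith)
      simp only [hh]
      rw [abs_of_nonneg (div_nonneg p1.le (by linarith)), div_le_iff₀ (by linarith)]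
      nlinarith
    set I : ℝ → ℝ := fun x => ∫ t in U₀..x, h t with hI
    have hint : ∀ x ≥ R, IntervalIntegrable h volume R x := fun x hx =>
      (hhc.mono (by rw [uIcc_of_le hx]; exact Icc_subset_Ici_self)).intervalIntegrable
    have hIc : ∃ C0 : ℝ, ContinuousOn I (Ioi R) ∧
        ∀ x ≥ R, |I x| ≤ C0 + 4 * Real.sqrt (2 * F x) * (x - R) := by
      by_cases hii : IntervalIntegrable h volume U₀ R
      · have hsplit : ∀ x ≥ R, I x = I R + ∫ t in R..x, h t := fun x hx =>
          (intervalIntegral.integral_add_adjacent_intervals hii (hint x hx)).symm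
        refine ⟨|I R|, ?_, ?_⟩
        · intro x hx
          have hx : R < x := hx
          have hd : HasDerivAt (fun x => ∫ t in R..x, h t) (h x) x := by
            apply intervalIntegral.integral_hasDerivAt_right (hint x hx.le)
            · exact (hhc.mono Ioi_subset_Ici_self).stronglyMeasurableAtFilter isOpen_Ioi x hx
            · exact hhc.continuousAt (Ici_mem_nhds hx)
          have : ContinuousAt I x := by
            refine (hd.continuousAt.const_add (I R)).congr ?_
            filter_upwards [lt_mem_nhds hx] with y hy
            exact (hsplit y hy.le).symm
          exact this.continuousWithinAt
        · intro x hx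
          rw [hsplit x hx]
          refine (abs_add_le _ _).trans ?_
          gcongr
          have := intervalIntegral.norm_integral_le_of_norm_le_const (a := R) (b := x) (f := h)
            (C := 4 * Real.sqrt (2 * F x)) (fun t ht => by
              rw [uIoc_of_le hx] at ht
              refine (hhb t ht.1.le).trans ?_
              have : F t ≤ F x := hFm (by simp; linarith [ht.1]) (by simp; linarith) ht.2
              gcongr)
          rwa [abs_of_nonneg (by linarith : 0 ≤ x - R)] at this
      · have hz : ∀ x ≥ R, I x = 0 := fun x hx => by
          apply intervalIntegral.integral_undef
          intro hx2
          apply hii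
          refine hx2.mono_set ?_
          rw [uIcc_of_le hRU, uIcc_of_le (hRU.trans hx)]
          exact Icc_subset_Icc_right hx
        refine ⟨0, ?_, ?_⟩
        · exact (continuousOn_const (c := (0:ℝ))).congr fun x hx => hz x (le_of_lt hx)
        · intro x hx
          rw [hz x hx, abs_zero]
          have : 0 ≤ x - R := by linarith
          positivity
    obtain ⟨C0, hIcont, hIb⟩ := hIc
    have hsucc : vIter N F U₀ (k + 1) = fun x => Real.sqrt (2 * (F x - (N - 1 : ℝ) * I x)) := by
      funext x; simp only [vIter, hI, hh, hj, hvdef]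
    rw [hsucc]
    refine ⟨⟨R + 1, ?_⟩, ?_⟩
    · have : ContinuousOn I (Ici (R + 1)) := hIcont.mono (fun x hx => by
        have hx : R + 1 ≤ x := hx
        simp; linarith)
      fun_prop
    · apply ratio_sqrt hFt (J := fun x => F x - (N - 1 : ℝ) * I x)
      have hIF : Tendsto (fun x => I x / F x) atTop (𝓝 0) := by
        have hb : Tendsto (fun x => C0 / F x + 8 * (x / Real.sqrt (2 * F x))) atTop (𝓝 (0 + 8 * 0)) :=
          (hFt.const_div_atTop C0).add (hlin.const_mul 8)
        rw [mul_zero, add_zero] at hb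
        refine squeeze_zero_norm' ?_ hb
        filter_upwards [eventually_ge_atTop R, eventually_ge_atTop T] with x hx hxT
        have p := hFp x hxT
        have pv := hv0 x hxT
        rw [norm_div, Real.norm_eq_abs, Real.norm_of_nonneg p.le]
        have hsqv : Real.sqrt (2 * F x) * Real.sqrt (2 * F x) = 2 * F x :=
          Real.mul_self_sqrt (by linarith)
        have e3 : C0 / F x + 8 * (x / Real.sqrt (2 * F x)) = (C0 + 4 * Real.sqrt (2 * F x) * x) / F x := by
          rw [eq_div_iff p.ne', add_mul, div_mul_cancel₀ _ p.ne']
          congr 1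
          have : F x = Real.sqrt (2 * F x) * Real.sqrt (2 * F x) / 2 := by linarith
          rw [mul_assoc 8, div_mul_eq_mul_div]
          rw [← mul_div_assoc, div_eq_iff pv.ne']
          calc 8 * (x * F x) = 4 * x * (2 * F x) := by ring
            _ = 4 * x * (Real.sqrt (2 * F x) * Real.sqrt (2 * F x)) := by rw [hsqv]
            _ = _ := by ring
        rw [e3]
        gcongr
        refine (hIb x hx).trans ?_
        gcongr
        linarith
      have h1 := (hIF.const_mul (N - 1 : ℝ)).const_sub 1
      rw [mul_zero, sub_zero] at h1
      refine h1.congr' ?_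
      filter_upwards [eventually_ge_atTop T] with x hxT
      have p := hFp x hxT
      field_simp

lemma uk_asymp {v0 v w : ℝ → ℝ} {T r₀ : ℝ} (hr₀ : r₀ < 1) (hc : ContinuousOn v0 (Ici T))
    (hv0 : ∀ t ≥ T, 0 < v0 t) (hv : IntegrableOn (fun t => (v0 t)⁻¹) (Ici T))
    (hr : Tendsto (fun t => v t / v0 t) atTop (𝓝 1))
    (hw : ∀ r ∈ Ico r₀ (1 : ℝ), HasDerivAt w (v (w r)) r)
    (hwb : Tendsto w (𝓝[<] (1 : ℝ)) atTop) {ε : ℝ} (hε : 0 < ε) :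
    ∀ᶠ r in 𝓝[<] (1:ℝ), |(∫ s in Ici (w r), (v0 s)⁻¹) - (1 - r)| ≤ ε * (1 - r) := by
  have e1 : ∀ᶠ t in atTop, 1 - ε < v t / v0 t := hr.eventually (lt_mem_nhds (by linarith))
  have e2 : ∀ᶠ t in atTop, v t / v0 t < 1 + ε := hr.eventually (gt_mem_nhds (by linarith))
  have e3 := hwb.eventually (e1.and (e2.and (eventually_gt_atTop T)))
  obtain ⟨r1, hr1, h1⟩ := (mem_nhdsLT_iff_exists_Ioo_subset).1 e3
  have hr1 : r1 < 1 := hr1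
  set r2 := max r1 r₀ with hr2
  have hr21 : r2 < 1 := max_lt hr1 hr₀
  have hsub : ∀ r ∈ Ioo r2 1, (1 - ε < v (w r) / v0 (w r) ∧ v (w r) / v0 (w r) < 1 + ε ∧ T < w r) :=
    fun r hr => h1 ⟨(le_max_left _ _).trans_lt hr.1, hr.2⟩
  set D : ℝ → ℝ := fun r => ∫ s in Ici (w r), (v0 s)⁻¹ with hD
  have hDd : ∀ r ∈ Ioo r2 1, HasDerivAt D (-(v (w r) / v0 (w r))) r := by
    intro r hr
    have h2 := tail_deriv hv (hc.inv₀ fun t ht => (hv0 t ht).ne') (hsub r hr).2.2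
    have h3 := HasDerivAt.comp r h2 (hw r ⟨(le_max_right _ _).trans hr.1.le, hr.2⟩)
    refine HasDerivAt.congr_deriv h3 ?_
    rw [div_eq_mul_inv]; ring
  have hD0 : Tendsto D (𝓝[<] 1) (𝓝 0) := (tail_tendsto hv).comp hwb
  have u1 := le_of_deriv_ge hDd (C := 1 + ε) (fun r hr => by linarith [(hsub r hr).2.1]) hD0
  have u2 := le_of_deriv_ge (fun r hr => (hDd r hr).neg) (C := -(1 - ε))
    (fun r hr => by linarith [(hsub r hr).1]) (by have := hD0.neg; rw [neg_zero] at this; exact this)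
  filter_upwards [Ioo_mem_nhdsLT hr21] with r hr
  have a1 := u1 r hr
  have a2 := u2 r hr
  simp only [Pi.neg_apply] at a2
  rw [abs_le]
  constructor <;> linarith


/-- From two quantities close to `d` conclude smallness of the difference. -/
lemma arith_fin {p q d c : ℝ} (hd : 0 ≤ d) (hc : 0 < c) (hp : |p - d| ≤ min (1/2) (c / 4) * d)
    (hq : |q - d| ≤ c / 4 * d) : |p - q| ≤ c * |p| := by
  have h1 : |p - d| ≤ c / 4 * d := hp.trans (by gcongr; exact min_le_right _ _)
  have h2 : |p - d| ≤ 1 / 2 * d := hp.trans (by gcongr; exact min_le_left _ _)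
  have h3 : 1 / 2 * d ≤ |p| := by
    have := (abs_le.1 h2).1
    exact le_trans (by linarith) (le_abs_self p)
  have h4 : |p - q| ≤ c / 4 * d + c / 4 * d := by
    rw [abs_le] at *
    constructor <;> linarith [h1.1, h1.2, hq.1, hq.2]
  nlinarith


open Asymptotics in
theorem statement7 {N : ℕ} (hN : 1 ≤ N) (f : ℝ → ℝ) (hf : ContDiff ℝ 1 f)
    -- condition (2)
    (a : ℝ) (ha : 0 < f a) (hf0 : ∀ t > a, 0 ≤ f t)
    (F : ℝ → ℝ) (hF : ∀ t, F t = ∫ s in a..t, f s)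
    -- condition (3): Keller-Osserman
    (hKO : ∃ T, (∀ t ≥ T, 0 < F t) ∧
      IntegrableOn (fun t => (Real.sqrt (F t))⁻¹) (Ici T))
    (U₀ : ℝ)
    -- u is a boundary blow-up solution, and r₀ ∈ (0,1) is such that u ≥ U₀ on |x| ≥ r₀
    (u : EuclideanSpace ℝ (Fin N) → ℝ) (hu : IsBlowUp f u)
    (r₀ : ℝ) (hr₀ : r₀ ∈ Ioo (0 : ℝ) 1)
    (hular : ∀ x ∈ ball (0 : EuclideanSpace ℝ (Fin N)) 1, r₀ ≤ ‖x‖ → U₀ ≤ u x)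
    -- u_k : [r₀, 1) → ℝ solves du_k/dr = v_k(u_k), u_k(r) → +∞ as r → 1⁻
    (uk : ℕ → ℝ → ℝ)
    (huk : ∀ k, ∀ r ∈ Ico r₀ (1 : ℝ), HasDerivAt (uk k) (vIter N F U₀ k (uk k r)) r)
    (hukblow : ∀ k, Tendsto (uk k) (𝓝[<] (1 : ℝ)) atTop) :
    -- ∫_{u_k(r)}^{u_{k+1}(r)} du/v₀ = o(∫_{u_k(r)}^{∞} du/v₀) as r → 1⁻
    (∀ k : ℕ,
      (fun r => ∫ t in (uk k r)..(uk (k + 1) r), (Real.sqrt (2 * F t))⁻¹)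
        =o[𝓝[<] (1 : ℝ)]
      (fun r => ∫ t in Ici (uk k r), (Real.sqrt (2 * F t))⁻¹)) ∧
    -- ∫_{u_k(|x|)}^{u(x)} du/v₀ = o(∫_{u_k(|x|)}^{∞} du/v₀) as x → ∂B
    ∀ k : ℕ,
      (fun x : EuclideanSpace ℝ (Fin N) =>
          ∫ t in (uk k ‖x‖)..(u x), (Real.sqrt (2 * F t))⁻¹)
        =o[comap (fun x : EuclideanSpace ℝ (Fin N) => ‖x‖) (𝓝[<] (1 : ℝ)) ⊓
            𝓟 (ball (0 : EuclideanSpace ℝ (Fin N)) 1)]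
      (fun x : EuclideanSpace ℝ (Fin N) =>
          ∫ t in Ici (uk k ‖x‖), (Real.sqrt (2 * F t))⁻¹) := by

  have hfc : Continuous f := hf.continuous
  have hFd : ∀ t, HasDerivAt F (f t) t := by
    intro t
    have : F = fun t => ∫ s in a..t, f s := funext hF
    rw [this]
    exact intervalIntegral.integral_hasDerivAt_right (hfc.intervalIntegrable _ _)
      (hfc.stronglyMeasurableAtFilter _ _) hfc.continuousAt
  obtain ⟨T0, hT0, hI0⟩ := hKO
  obtain ⟨T, haT, hFp, hv⟩ : ∃ T, a < T ∧ (∀ t ≥ T, 0 < F t) ∧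
      IntegrableOn (fun t => (Real.sqrt (2 * F t))⁻¹) (Ici T) := by
    refine ⟨max T0 (a + 1), lt_of_lt_of_le (by linarith) (le_max_right _ _),
      fun t ht => hT0 t ((le_max_left _ _).trans ht), ?_⟩
    have h1 := (hI0.mono_set (Ici_subset_Ici.2 (le_max_left T0 (a + 1)))).const_mul (Real.sqrt 2)⁻¹
    refine h1.congr (ae_of_all _ fun t => ?_)
    simp only
    rw [Real.sqrt_mul (by norm_num), mul_inv]
  have hv0 : ∀ t ≥ T, 0 < Real.sqrt (2 * F t) := fun t ht =>
    Real.sqrt_pos.2 (by linarith [hFp t ht])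
  have hukT : ∀ k, ∀ᶠ r in 𝓝[<] (1:ℝ), T ≤ uk k r := fun k =>
    (hukblow k).eventually (eventually_ge_atTop T)
  have hlt : ∀ᶠ r in 𝓝[<] (1:ℝ), r < 1 := self_mem_nhdsWithin
  have huka : ∀ k, ∀ ε > 0, ∀ᶠ r in 𝓝[<] (1:ℝ),
      |(∫ s in Ici (uk k r), (Real.sqrt (2 * F s))⁻¹) - (1 - r)| ≤ ε * (1 - r) := fun k ε hε =>
    uk_asymp hr₀.2 (v_cont hFd).continuousOn hv0 hv
      (vIter_asymp (N := N) U₀ hFd hf0 haT hFp hv k).2 (huk k) (hukblow k) hε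
  have hua : ∀ ε > 0, ∃ r < 1, ∀ x ∈ ball (0 : EuclideanSpace ℝ (Fin N)) 1, r ≤ ‖x‖ →
      |(∫ s in Ici (u x), (Real.sqrt (2 * F s))⁻¹) - (1 - ‖x‖)| ≤ ε * (1 - ‖x‖) := by
    intro ε hε
    set η := min (1 / 2) (ε / 4) with hη
    have hη0 : 0 < η := by positivity
    have hη1 : η ≤ 1 / 2 := min_le_left _ _
    have hη2 : η ≤ ε / 4 := min_le_right _ _
    obtain ⟨r1, hr1, h1⟩ := upper_bd hN hu hFd hf0 haT hFp hv hη0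
    obtain ⟨r2, hr2, h2⟩ := lower_bd hN hfc hu hFd hf0 haT hFp hv hη0 (by linarith)
    refine ⟨max r1 r2, max_lt hr1 hr2, fun x hx hxr => ?_⟩
    have k1 := h1 x hx ((le_max_left _ _).trans hxr)
    have k2 := h2 x hx ((le_max_right _ _).trans hxr)
    have hx1 : ‖x‖ < 1 := by simpa using hx
    set d := 1 - ‖x‖ with hd
    have hd0 : 0 < d := by linarith
    set Q := ∫ s in Ici (u x), (Real.sqrt (2 * F s))⁻¹ with hQ
    have hle : η * d ≤ ε / 4 * d := by gcongr
    have hsq : η ^ 2 * d ≤ 1 / 2 * η * d := by gcongr; nlinarith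
    rw [abs_le]
    constructor
    · have k3 : (1 + η) * ((1 - 4 * η) * d) ≤ (1 + η) * Q := by
        refine le_trans ?_ k2
        nlinarith [mul_pos hη0 hd0, mul_nonneg (sq_nonneg η) hd0.le]
      have k4 := le_of_mul_le_mul_left k3 (by linarith)
      nlinarith
    · nlinarith
  refine ⟨fun k => ?_, fun k => ?_⟩
  · rw [Asymptotics.isLittleO_iff]
    intro c hc
    filter_upwards [hukT k, hukT (k + 1), hlt, huka k (min (1/2) (c / 4)) (by positivity),
      huka (k + 1) (c / 4) (by positivity)] with r h1 h2 h3 h4 h5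
    rw [tail_sub hv h1 h2]
    exact arith_fin (by linarith) hc h4 h5
  · rw [Asymptotics.isLittleO_iff]
    intro c hc
    obtain ⟨r1, hr1, h1⟩ := hua (c / 4) (by positivity)
    obtain ⟨r2, hr2, h2⟩ := blow_unif hu T
    have hev : ∀ᶠ r in 𝓝[<] (1:ℝ), T ≤ uk k r ∧ r < 1 ∧ r1 ≤ r ∧ r2 ≤ r ∧
        |(∫ s in Ici (uk k r), (Real.sqrt (2 * F s))⁻¹) - (1 - r)| ≤ min (1/2) (c / 4) * (1 - r) := by
      filter_upwards [hukT k, hlt, huka k (min (1/2) (c / 4)) (by positivity),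
        Ioo_mem_nhdsLT hr1, Ioo_mem_nhdsLT hr2] with r a1 a2 a3 a4 a5
      exact ⟨a1, a2, a4.1.le, a5.1.le, a3⟩
    have hev2 := (hev.comap (fun x : EuclideanSpace ℝ (Fin N) => ‖x‖)).filter_mono
      (inf_le_left (b := 𝓟 (ball (0 : EuclideanSpace ℝ (Fin N)) 1)))
    filter_upwards [hev2] with x hx
    obtain ⟨a1, a2, a3, a4, a5⟩ := hx
    have hxb : x ∈ ball (0 : EuclideanSpace ℝ (Fin N)) 1 := by simpa using a2
    rw [tail_sub hv a1 (h2 x hxb a4)]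
    exact arith_fin (by linarith) hc a5 (h1 x hxb a3)
end
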